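/- Assume that the Yoneda ring Y(e) is (left and right) Artinian and has finite global dimension. Then A has finite global dimension if and only if Γ := (1-e)A(1-e) has finite global dimension. -/

import Mathlib

set_option linter.unusedVariables false
set_option maxHeartbeats 1000000

/-! Common setup: corner rings, the simple module `S_e`, Ext-algebras (Yoneda rings),
semiperfect and basic rings, finite global dimension. -/

open CategoryTheory CategoryTheory.Abelian
open scoped DirectSum

noncomputable section

/-- Smallness of Ext groups for module categories. -/
instance hasExtModuleCat (R : Type u) [Ring R] : HasExt.{u + 1} (ModuleCat.{u} R) :=
  letI := HasDerivedCategory.standard (ModuleCat.{u} R)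
  hasExt_of_hasDerivedCategory _

/-! ### Corner rings `eAe` -/

/-- The corner ring `eAe = {x : A | e * x = x ∧ x * e = x}` of an idempotent `e : A`. -/
def CornerRing {A : Type*} [Ring A] (e : A) (_ : IsIdempotentElem e) : Type _ :=
  {x : A // e * x = x ∧ x * e = x}

namespace CornerRing

variable {A : Type*} [Ring A] {e : A} {he : IsIdempotentElem e}

instance : Zero (CornerRing e he) := ⟨⟨0, by simp, by simp⟩⟩
instance : One (CornerRing e he) := ⟨⟨e, he, he⟩⟩
instance : Add (CornerRing e he) :=
  ⟨fun x y => ⟨x.1 + y.1, by rw [mul_add, x.2.1, y.2.1], by rw [add_mul, x.2.2, y.2.2]⟩⟩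
instance : Neg (CornerRing e he) :=
  ⟨fun x => ⟨-x.1, by rw [mul_neg, x.2.1], by rw [neg_mul, x.2.2]⟩⟩
instance : Mul (CornerRing e he) :=
  ⟨fun x y => ⟨x.1 * y.1, by rw [← mul_assoc, x.2.1], by rw [mul_assoc, y.2.2]⟩⟩

instance instRing : Ring (CornerRing e he) where
  add_assoc x y z := Subtype.ext (add_assoc _ _ _)
  zero_add x := Subtype.ext (zero_add _)
  add_zero x := Subtype.ext (add_zero _)
  add_comm x y := Subtype.ext (add_comm _ _)
  neg_add_cancel x := Subtype.ext (neg_add_cancel _)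
  mul_assoc x y z := Subtype.ext (mul_assoc _ _ _)
  one_mul x := Subtype.ext x.2.1
  mul_one x := Subtype.ext x.2.2
  left_distrib x y z := Subtype.ext (left_distrib _ _ _)
  right_distrib x y z := Subtype.ext (right_distrib _ _ _)
  zero_mul x := Subtype.ext (zero_mul _)
  mul_zero x := Subtype.ext (mul_zero _)
  nsmul := nsmulRec
  zsmul := zsmulRec

end CornerRing

/-! ### The semisimple module `S_e = eA / e rad A` -/

/-- The Jacobson radical of the ring `A`, as a set. -/
def ringRadical (A : Type*) [Ring A] : Set A :=
  ((⊥ : TwoSidedIdeal A).jacobson : Set A)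

/-- The right ideal `eA`, as a right `A`-module (i.e. an `Aᵐᵒᵖ`-module). -/
def rightIdeal (A : Type*) [Ring A] (e : A) : Submodule Aᵐᵒᵖ A :=
  Submodule.span Aᵐᵒᵖ {e}

/-- The right submodule `e (rad A)` of `A`. -/
def eRad (A : Type*) [Ring A] (e : A) : Submodule Aᵐᵒᵖ A :=
  Submodule.span Aᵐᵒᵖ ((e * ·) '' ringRadical A)

/-- The semisimple right `A`-module `S_e = eA / e rad A` associated with an idempotent `e`. -/
def SeModule (A : Type*) [Ring A] (e : A) : Type _ :=
  rightIdeal A e ⧸ (eRad A e).comap (rightIdeal A e).subtype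

instance (A : Type*) [Ring A] (e : A) : AddCommGroup (SeModule A e) :=
  inferInstanceAs (AddCommGroup (rightIdeal A e ⧸ (eRad A e).comap (rightIdeal A e).subtype))

instance (A : Type*) [Ring A] (e : A) : Module Aᵐᵒᵖ (SeModule A e) :=
  inferInstanceAs (Module Aᵐᵒᵖ (rightIdeal A e ⧸ (eRad A e).comap (rightIdeal A e).subtype))

/-- `S_e` as an object of the category of right `A`-modules. -/
def Se (A : Type) [Ring A] (e : A) : ModuleCat Aᵐᵒᵖ :=
  ModuleCat.of Aᵐᵒᵖ (SeModule A e)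

/-! ### The Ext-algebra (Yoneda ring) of an object of an abelian category -/

namespace ExtYoneda

universe w v u
variable {C : Type u} [Category.{v} C] [Abelian C] [HasExt.{w} C]

lemma comp_heq {X Y Z : C} {a b c : ℕ} (h : a + b = c) (α : Ext X Y a) (β : Ext Y Z b) :
    HEq (α.comp β rfl) (α.comp β h) := by subst h; rfl

variable (X : C)

def gmul : GradedMonoid.GMul (fun i : ℕ => Ext X X i) where
  mul {i j} α β := α.comp β rfl

def gone : GradedMonoid.GOne (fun i : ℕ => Ext X X i) where
  one := Ext.mk₀ (𝟙 X)

def gmonoid : GradedMonoid.GMonoid (fun i : ℕ => Ext X X i) :=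
  letI := gmul X
  letI := gone X
  { one_mul := fun a => by
      obtain ⟨i, α⟩ := a
      exact Sigma.ext (zero_add i)
        ((comp_heq (zero_add i) _ _).trans (heq_of_eq (Ext.mk₀_id_comp α)))
    mul_one := fun a => by
      obtain ⟨i, α⟩ := a
      exact Sigma.ext (add_zero i)
        ((comp_heq (add_zero i) _ _).trans (heq_of_eq (Ext.comp_mk₀_id α)))
    mul_assoc := fun a b c => by
      obtain ⟨i, α⟩ := a
      obtain ⟨j, β⟩ := b
      obtain ⟨k, γ⟩ := c
      refine Sigma.ext (add_assoc i j k) ?_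
      refine (heq_of_eq (Ext.comp_assoc α β γ rfl rfl rfl)).trans ?_
      exact (comp_heq (h := (add_assoc i j k).symm ▸ rfl) _ _).symm }

/-- The graded ring structure on `fun i => Ext X X i` given by the Yoneda product. -/
def gring : DirectSum.GRing (fun i : ℕ => Ext X X i) :=
  letI := gmonoid X
  { __ := gmonoid X
    mul_zero := fun {i j} α => Ext.comp_zero α _ _ _ rfl
    zero_mul := fun {i j} β => Ext.zero_comp _ _ β _ rfl
    mul_add := fun {_ _} α β γ => Ext.comp_add _ _ _ rfl
    add_mul := fun {_ _} α β γ => Ext.add_comp _ _ _ rfl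
    natCast := fun n => n • Ext.mk₀ (𝟙 X)
    natCast_zero := zero_smul _ _
    natCast_succ := fun n => succ_nsmul _ _
    intCast := fun z => z • Ext.mk₀ (𝟙 X)
    intCast_ofNat := fun n => natCast_zsmul _ _
    intCast_negSucc_ofNat := fun n => negSucc_zsmul _ _ }

end ExtYoneda

/-- The Yoneda (Ext-) ring `⨁ i, Ext X X i` of an object `X` of an abelian category,
with multiplication induced by the Yoneda product. -/
def ExtRing {C : Type u} [Category.{v} C] [Abelian C] [HasExt.{w} C] (X : C) : Type w :=
  ⨁ i : ℕ, Ext X X i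

instance {C : Type u} [Category.{v} C] [Abelian C] [HasExt.{w} C] (X : C) :
    Ring (ExtRing X) :=
  letI := ExtYoneda.gring X
  inferInstanceAs (Ring (⨁ i : ℕ, Ext X X i))

/-- The Yoneda ring `Y(e) = Ext_A^*(S_e, S_e)` of an idempotent `e` of the ring `A`. -/
def YonedaRing (A : Type) [Ring A] (e : A) : Type 1 :=
  ExtRing (Se A e)

instance (A : Type) [Ring A] (e : A) : Ring (YonedaRing A e) :=
  inferInstanceAs (Ring (ExtRing (Se A e)))

/-! ### Homological and ring-theoretic conditions -/

/-- A ring `R` has finite (right) global dimension if there is a uniform bound `n` such that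
`Ext^i(M, N)` vanishes for all right `R`-modules `M`, `N` and all `i > n`. -/
def HasFiniteGlobalDimension (R : Type u) [Ring R] : Prop :=
  ∃ n : ℕ, ∀ (M N : ModuleCat.{u} Rᵐᵒᵖ) (i : ℕ), n < i → Subsingleton (Ext M N i)

/-- A ring is Artinian on both sides. -/
def IsTwoSidedArtinian (R : Type u) [Ring R] : Prop :=
  IsArtinianRing R ∧ IsArtinianRing Rᵐᵒᵖ

/-- A ring is Noetherian on both sides. -/
def IsTwoSidedNoetherian (R : Type u) [Ring R] : Prop :=
  IsNoetherianRing R ∧ IsNoetherianRing Rᵐᵒᵖ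

/-- A ring is semiperfect iff `1` decomposes as a finite sum of pairwise orthogonal
idempotents each of whose corner rings is local. -/
def IsSemiperfectRing (A : Type*) [Ring A] : Prop :=
  ∃ (n : ℕ) (f : Fin n → A) (hf : ∀ i, IsIdempotentElem (f i)),
    (∀ i j, i ≠ j → f i * f j = 0) ∧ (∑ i, f i = 1) ∧
      ∀ i, IsLocalRing (CornerRing (f i) (hf i))

/-- An idempotent is primitive if it is nonzero and cannot be written as the sum of two
nonzero orthogonal idempotents. -/
def IsPrimitiveIdempotent {A : Type*} [Ring A] (e : A) : Prop :=
  IsIdempotentElem e ∧ e ≠ 0 ∧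
    ∀ f g : A, IsIdempotentElem f → IsIdempotentElem g → f * g = 0 → g * f = 0 →
      f + g = e → f = 0 ∨ g = 0

/-- A ring is basic if `1` decomposes as a finite sum of pairwise orthogonal primitive
idempotents whose associated indecomposable projective right modules are pairwise
non-isomorphic. -/
def IsBasicRing (A : Type*) [Ring A] : Prop :=
  ∃ (n : ℕ) (f : Fin n → A),
    (∀ i, IsPrimitiveIdempotent (f i)) ∧ (∀ i j, i ≠ j → f i * f j = 0) ∧ (∑ i, f i = 1) ∧
      ∀ i j, i ≠ j → IsEmpty ((rightIdeal A (f i)) ≃ₗ[Aᵐᵒᵖ] (rightIdeal A (f j)))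

end
namespace GlDim

/-! ### Part 1: ring theory -/

section RingTheory

variable {A : Type} [Ring A]

lemma mem_J_iff {x : A} : x ∈ Ring.jacobson A ↔ ∀ y, ∃ z, z * (1 + y * x) = 1 := by
  rw [← Ideal.jacobson_bot, Ideal.mem_jacobson_iff]
  refine forall_congr' fun y => exists_congr fun z => ?_
  rw [Ideal.mem_bot, sub_eq_zero, mul_add, mul_one, mul_assoc, add_comm]

lemma one_add_unit {x : A} (hx : x ∈ Ring.jacobson A) : ∃ w, w * (1 + x) = 1 ∧ (1 + x) * w = 1 := by
  obtain ⟨w, hw⟩ := mem_J_iff.1 hx 1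
  rw [one_mul] at hw
  obtain ⟨w', hw'⟩ := mem_J_iff.1 hx (-w)
  have h1 : 1 + -w * x = w := by
    have : w + w * x = 1 := by rw [← hw]; noncomm_ring
    rw [← this]; noncomm_ring
  rw [h1] at hw'
  have : w' = 1 + x := by
    calc w' = w' * (w * (1 + x)) := by rw [hw, mul_one]
      _ = _ := by rw [← mul_assoc, hw', one_mul]
  exact ⟨w, hw, by rw [← this, hw']⟩

lemma op_mem_J_of {x : A} (hx : x ∈ Ring.jacobson A) : MulOpposite.op x ∈ Ring.jacobson Aᵐᵒᵖ := by
  rw [mem_J_iff]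
  intro y
  obtain ⟨w, _, h⟩ := one_add_unit ((Ring.jacobson A).mul_mem_right y.unop hx)
  exact ⟨MulOpposite.op w, MulOpposite.unop_injective (by simpa using h)⟩

lemma unop_mem_J_of {x : Aᵐᵒᵖ} (hx : x ∈ Ring.jacobson Aᵐᵒᵖ) : x.unop ∈ Ring.jacobson A := by
  rw [mem_J_iff]
  intro y
  obtain ⟨w, _, h⟩ := one_add_unit ((Ring.jacobson Aᵐᵒᵖ).mul_mem_right (MulOpposite.op y) hx)
  exact ⟨w.unop, MulOpposite.op_injective (by simpa using h)⟩

lemma op_mem_J_iff {x : A} : MulOpposite.op x ∈ Ring.jacobson Aᵐᵒᵖ ↔ x ∈ Ring.jacobson A :=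
  ⟨fun h => unop_mem_J_of h, op_mem_J_of⟩

lemma mem_J_of_right {x : A} (h : ∀ y, ∃ z, (1 + x * y) * z = 1) : x ∈ Ring.jacobson A := by
  rw [← op_mem_J_iff, mem_J_iff]
  intro y
  obtain ⟨w, h⟩ := h y.unop
  exact ⟨MulOpposite.op w, MulOpposite.unop_injective (by simpa using h)⟩

lemma mem_ringRadical {x : A} : x ∈ ringRadical A ↔ x ∈ Ring.jacobson A := by
  rw [mem_J_iff]
  change x ∈ (⊥ : TwoSidedIdeal A).jacobson ↔ _
  rw [TwoSidedIdeal.mem_jacobson_iff]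
  refine forall_congr' fun y => exists_congr fun z => ?_
  rw [TwoSidedIdeal.mem_bot, sub_eq_zero, mul_add, mul_one, mul_assoc, add_comm]

/-- A working form of local idempotent. -/
def LocalIdem (f : A) : Prop :=
  f * f = f ∧ f ≠ 0 ∧ ∀ c, f * c = c → c * f = c →
    (∃ v, f * v = v ∧ v * f = v ∧ c * v = f) ∨ (∃ v, f * v = v ∧ v * f = v ∧ (f + c) * v = f)

lemma localIdem_of_corner {f : A} (hf : IsIdempotentElem f) (h : IsLocalRing (CornerRing f hf)) :
    LocalIdem f := by
  refine ⟨hf, ?_, fun c h1 h2 => ?_⟩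
  · intro h0
    apply one_ne_zero (α := CornerRing f hf)
    apply Subtype.ext
    exact h0
  · let c' : CornerRing f hf := ⟨c, h1, h2⟩
    rcases IsLocalRing.isUnit_or_isUnit_of_add_one (a := -c') (b := 1 + c') (by abel) with h | h
    · left
      obtain ⟨v, hv⟩ := h.exists_right_inv
      refine ⟨-v.1, by rw [mul_neg, v.2.1], by rw [neg_mul, v.2.2], ?_⟩
      have : -c * v.1 = f := congrArg Subtype.val hv
      rw [neg_mul] at this
      rw [mul_neg]; exact this
    · right
      obtain ⟨v, hv⟩ := h.exists_right_inv
      exact ⟨v.1, v.2.1, v.2.2, congrArg Subtype.val hv⟩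

lemma LocalIdem.mem_J {f w : A} (hf : LocalIdem f) (hw : f * w = w)
    (h : ∀ y v, f * v = v → v * f = v → w * y * f * v ≠ f) : w ∈ Ring.jacobson A := by
  apply mem_J_of_right
  intro y
  rcases hf.2.2 (w * y * f) (by rw [← mul_assoc, ← mul_assoc, hw]) (by rw [mul_assoc, hf.1]) with
    ⟨v, h1, h2, h3⟩ | ⟨v, h1, h2, h3⟩
  · exact absurd h3 (h y v h1 h2)
  · refine ⟨1 - v * (w * y), ?_⟩
    have h4 : (f + w * y * f) * v * (w * y) = w * y := by rw [h3, ← mul_assoc, hw]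
    have h5 : (f + w * y * f) * v * (w * y) = v * (w * y) + w * y * (v * (w * y)) := by
      rw [add_mul, h1, mul_assoc (w * y) f v, h1]; noncomm_ring
    rw [h5] at h4
    calc (1 + w * y) * (1 - v * (w * y))
        = 1 + w * y - (v * (w * y) + w * y * (v * (w * y))) := by noncomm_ring
      _ = 1 := by rw [h4]; abel

lemma LocalIdem.dich {f g : A} (hf : LocalIdem f) (hg : IsPrimitiveIdempotent g) :
    (∃ a b, f * a = a ∧ a * g = a ∧ g * b = b ∧ b * f = b ∧ a * b = f ∧ b * a = g) ∨
      ∀ x, f * x * g ∈ Ring.jacobson A := by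
  by_cases H : ∃ x y v, f * v = v ∧ v * f = v ∧ f * x * g * y * f * v = f
  · left
    obtain ⟨x, y, v, h1, h2, h3⟩ := H
    have hgg : g * g = g := hg.1
    have hff := hf.1
    have key : (f * x * g) * (g * y * v) = f := by
      calc (f * x * g) * (g * y * v) = f * x * (g * g) * y * v := by noncomm_ring
        _ = f * x * g * y * (f * v) := by rw [hgg, h1]
        _ = f := by rw [← mul_assoc, h3]
    refine ⟨f * x * g, g * y * v, by simp only [← mul_assoc, hff], by simp only [mul_assoc, hgg],
      by simp only [← mul_assoc, hgg], by simp only [mul_assoc, h2], key, ?_⟩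
    generalize ha : f * x * g = a at key
    generalize hb : g * y * v = b at key
    have hfa : f * a = a := by rw [← ha]; simp only [← mul_assoc, hff]
    have hag : a * g = a := by rw [← ha]; simp only [mul_assoc, hgg]
    have hgb : g * b = b := by rw [← hb]; simp only [← mul_assoc, hgg]
    have hp : (b * a) * (b * a) = b * a := by
      calc (b * a) * (b * a) = b * ((a * b) * a) := by noncomm_ring
        _ = _ := by rw [key, hfa]
    have hgp : g * (b * a) = b * a := by rw [← mul_assoc, hgb]
    have hpg : (b * a) * g = b * a := by rw [mul_assoc, hag]
    rcases hg.2.2 (b * a) (g - b * a) hp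
      (by rw [IsIdempotentElem, sub_mul, mul_sub, mul_sub, hgg, hgp, hpg, hp]; abel)
      (by rw [mul_sub, hpg, hp, sub_self]) (by rw [sub_mul, hgp, hp, sub_self]) (by abel) with h | h
    · exfalso
      apply hf.2.1
      calc f = f * f := hff.symm
        _ = a * (b * a) * b := by nth_rw 1 [← key]; rw [← key]; noncomm_ring
        _ = 0 := by rw [h]; noncomm_ring
    · exact (sub_eq_zero.1 h).symm
  · right
    intro x
    refine hf.mem_J (by simp only [← mul_assoc, hf.1]) fun y v h1 h2 h3 => H ⟨x, y, v, h1, h2, h3⟩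

lemma LocalIdem.transport {f g a b : A} (hf : LocalIdem f) (hg : g * g = g)
    (h1 : f * a = a) (h2 : a * g = a) (h3 : g * b = b) (h4 : b * f = b)
    (h5 : a * b = f) (h6 : b * a = g) : LocalIdem g := by
  refine ⟨hg, ?_, fun c hc1 hc2 => ?_⟩
  · intro h0
    apply hf.2.1
    rw [← h5, ← h2, h0]; simp
  · have e1 : ∀ v, g * (b * v * a) = b * v * a := fun v => by simp only [← mul_assoc, h3]
    have e2 : ∀ v, (b * v * a) * g = b * v * a := fun v => by simp only [mul_assoc, h2]
    have e3 : ∀ v, c * (b * v * a) = b * (a * c * b * v) * a := fun v => by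
      calc c * (b * v * a) = (g * c) * (b * v * a) := by rw [hc1]
        _ = _ := by rw [← h6]; noncomm_ring
    rcases hf.2.2 (a * c * b) (by simp only [← mul_assoc, h1]) (by simp only [mul_assoc, h4]) with
      ⟨v, hv1, hv2, hv3⟩ | ⟨v, hv1, hv2, hv3⟩
    · left
      exact ⟨b * v * a, e1 v, e2 v, by rw [e3, hv3, h4, h6]⟩
    · right
      refine ⟨b * v * a, e1 v, e2 v, ?_⟩
      rw [add_mul, e1, e3]
      calc b * v * a + b * (a * c * b * v) * a = b * (v + a * c * b * v) * a := by noncomm_ring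
        _ = b * ((f + a * c * b) * v) * a := by rw [add_mul, hv1]
        _ = g := by rw [hv3, h4, h6]

lemma mem_rightIdeal {f : A} (hf : f * f = f) {x : A} : x ∈ rightIdeal A f ↔ f * x = x := by
  unfold rightIdeal
  rw [Submodule.mem_span_singleton]
  constructor
  · rintro ⟨r, rfl⟩
    change f * (f * r.unop) = f * r.unop
    rw [← mul_assoc, hf]
  · intro h
    exact ⟨MulOpposite.op x, h⟩

lemma rightIdeal_iso {f g a b : A} (hf : f * f = f) (hg : g * g = g)
    (h1 : f * a = a) (h2 : a * g = a) (h3 : g * b = b) (h4 : b * f = b)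
    (h5 : a * b = f) (h6 : b * a = g) : Nonempty (rightIdeal A f ≃ₗ[Aᵐᵒᵖ] rightIdeal A g) :=
  ⟨{ toFun := fun x => ⟨b * x.1, (mem_rightIdeal hg).2 (by rw [← mul_assoc, h3])⟩
     map_add' := fun x y => Subtype.ext (mul_add _ _ _)
     map_smul' := fun r x => Subtype.ext (mul_assoc b x.1 r.unop).symm
     invFun := fun x => ⟨a * x.1, (mem_rightIdeal hf).2 (by rw [← mul_assoc, h1])⟩
     left_inv := fun x => Subtype.ext (by
       change a * (b * x.1) = x.1
       rw [← mul_assoc, h5, (mem_rightIdeal hf).1 x.2])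
     right_inv := fun x => Subtype.ext (by
       change b * (a * x.1) = x.1
       rw [← mul_assoc, h6, (mem_rightIdeal hg).1 x.2]) }⟩

/-- Summary of the consequences of being semiperfect and basic. -/
lemma exists_good_idempotents (hsemi : IsSemiperfectRing A) (hbasic : IsBasicRing A) :
    ∃ (n : ℕ) (g : Fin n → A), (∀ i, g i * g i = g i) ∧ (∑ i, g i = 1) ∧
      (∀ i k x, i ≠ k → g i * x * g k ∈ Ring.jacobson A) ∧
      (∀ i x, g i * x * g i ∈ Ring.jacobson A ∨ ∃ v, g i * v = v ∧ g i * x * g i * v = g i) := by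
  obtain ⟨m, f, hf, hf0, hf1, hfl⟩ := hsemi
  obtain ⟨n, g, hg, hg0, hg1, hgi⟩ := hbasic
  have hloc : ∀ i, LocalIdem (g i) := by
    intro i
    by_contra hcon
    have key : ∀ j x, f j * x * g i ∈ Ring.jacobson A := by
      intro j
      have hj := localIdem_of_corner (hf j) (hfl j)
      rcases hj.dich (hg i) with ⟨a, b, h1, h2, h3, h4, h5, h6⟩ | h
      · exact absurd (hj.transport (hg i).1 h1 h2 h3 h4 h5 h6) hcon
      · exact h
    have hJ : g i ∈ Ring.jacobson A := by
      have : g i = ∑ j, f j * 1 * g i := by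
        rw [← Finset.sum_mul]; simp [hf1]
      rw [this]
      exact Submodule.sum_mem _ fun j _ => key j 1
    obtain ⟨w, hw, _⟩ := one_add_unit (neg_mem hJ)
    apply (hg i).2.1
    have h7 : (1 + -g i) * g i = 0 := by
      have h8 : g i * g i = g i := (hg i).1
      rw [add_mul, neg_mul, h8, one_mul, add_neg_cancel]
    calc g i = w * (1 + -g i) * g i := by rw [hw, one_mul]
      _ = 0 := by rw [mul_assoc, h7, mul_zero]
  refine ⟨n, g, fun i => (hg i).1, hg1, fun i k x hik => ?_, fun i x => ?_⟩
  · rcases (hloc i).dich (hg k) with ⟨a, b, h1, h2, h3, h4, h5, h6⟩ | h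
    · exact ((hgi i k hik).false (rightIdeal_iso (hg i).1 (hg k).1 h1 h2 h3 h4 h5 h6).some).elim
    · exact h x
  · by_cases H : ∃ y v, g i * v = v ∧ v * g i = v ∧ g i * x * g i * y * g i * v = g i
    · right
      obtain ⟨y, v, h1, h2, h3⟩ := H
      have h8 : g i * g i = g i := (hg i).1
      refine ⟨g i * y * v, by simp only [← mul_assoc, h8], ?_⟩
      calc g i * x * g i * (g i * y * v) = g i * x * (g i * g i) * y * v := by noncomm_ring
        _ = g i * x * g i * y * (g i * v) := by rw [h8, h1]
        _ = g i := by rw [← mul_assoc, h3]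
    · left
      exact (hloc i).mem_J (by simp only [← mul_assoc, (hloc i).1])
        fun y v h1 h2 h3 => H ⟨y, v, h1, h2, h3⟩

lemma corner_mem_J (hsemi : IsSemiperfectRing A) (hbasic : IsBasicRing A) (e : A)
    (he : IsIdempotentElem e) (x : A) : e * x * (1 - e) ∈ Ring.jacobson A := by
  obtain ⟨n, g, hgg, hg1, hoff, hdiag⟩ := exists_good_idempotents hsemi hbasic
  have hI : ∀ a b : A, a ∈ Ring.jacobson A → b - a ∈ Ring.jacobson A → b ∈ Ring.jacobson A :=
    fun a b h1 h2 => by simpa using add_mem h2 h1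
  let q := Ideal.Quotient.mk (Ring.jacobson A)
  have hq : ∀ a, q a = 0 ↔ a ∈ Ring.jacobson A := fun a => Ideal.Quotient.eq_zero_iff_mem
  have hsum : ∑ i, q (g i) = 1 := by rw [← map_sum, hg1, map_one]
  have hoff' : ∀ i k (y : A), i ≠ k → q (g i) * q y * q (g k) = 0 := fun i k y h => by
    rw [← map_mul, ← map_mul]; exact (hq _).2 (hoff i k y h)
  have hcen : ∀ i (y : A), q (g i) * q y = q (g i) * q y * q (g i) := by
    intro i y
    conv_lhs => rw [← mul_one (q (g i) * q y), ← hsum, Finset.mul_sum]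
    exact Finset.sum_eq_single i (fun k _ hk => hoff' i k y hk.symm) (by simp)
  have hcen' : ∀ i (y : A), q y * q (g i) = q (g i) * q y * q (g i) := by
    intro i y
    conv_lhs => rw [← one_mul (q y), ← hsum, Finset.sum_mul, Finset.sum_mul]
    exact Finset.sum_eq_single i (fun k _ hk => hoff' k i y hk) (by simp)
  have hggq : ∀ i, q (g i) * q (g i) = q (g i) := fun i => by rw [← map_mul, hgg]
  have heq : q e * q e = q e := by rw [← map_mul]; exact congrArg q he
  have he' : ∀ i, q (g i) * q e = 0 ∨ q (g i) * q e = q (g i) := by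
    intro i
    rcases hdiag i e with h | ⟨v, h1, h2⟩
    · left
      rw [hcen, ← map_mul, ← map_mul]; exact (hq _).2 h
    · right
      have h3 : q (g i) * q e * q v = q (g i) := by
        rw [hcen, ← map_mul, ← map_mul, ← map_mul, h2]
      have h4 : q (g i) * q e * (q (g i) * q e) = q (g i) * q e := by
        rw [← mul_assoc, ← hcen, mul_assoc, heq]
      have h5 : q e * q (g i) = q (g i) * q e := by rw [hcen', ← hcen]
      calc q (g i) * q e = q e * q (g i) := h5.symm
        _ = q e * (q (g i) * q e * q v) := by rw [h3]
        _ = q (g i) * (q e * q e) * q v := by rw [← mul_assoc, ← mul_assoc, h5, mul_assoc (q (g i))]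
        _ = q (g i) := by rw [heq, h3]
  rw [← hq, map_mul, map_mul]
  rw [← one_mul (q e), ← hsum, Finset.sum_mul, Finset.sum_mul, Finset.sum_mul]
  refine Finset.sum_eq_zero fun i _ => ?_
  rcases he' i with h | h
  · rw [h, zero_mul, zero_mul]
  · rw [h, hcen, mul_assoc, map_sub, map_one, mul_sub, mul_one, h, sub_self, mul_zero]

lemma isSemisimple_of_J_smul (hsemi : IsSemiperfectRing A) (hbasic : IsBasicRing A)
    (M : Type) [AddCommGroup M] [Module Aᵐᵒᵖ M]
    (hM : ∀ j ∈ Ring.jacobson Aᵐᵒᵖ, ∀ m : M, j • m = 0) : IsSemisimpleModule Aᵐᵒᵖ M := by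
  obtain ⟨n, g, hgg, hg1, hoff, hdiag⟩ := exists_good_idempotents hsemi hbasic
  have key : ∀ i (r : Aᵐᵒᵖ), r * MulOpposite.op (g i) ∈ Ring.jacobson Aᵐᵒᵖ ∨
      ∃ v, v * (r * MulOpposite.op (g i)) = MulOpposite.op (g i) := by
    intro i r
    rcases hdiag i r.unop with h | ⟨v, h1, h2⟩
    · left
      have : r * MulOpposite.op (g i) = MulOpposite.op (g i * r.unop) := rfl
      rw [this, op_mem_J_iff]
      rw [← mul_one (g i * r.unop), ← hg1, Finset.mul_sum]
      refine Submodule.sum_mem _ fun k _ => ?_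
      by_cases hk : i = k
      · subst hk; exact h
      · exact hoff i k _ hk
    · right
      refine ⟨MulOpposite.op v, MulOpposite.unop_injective ?_⟩
      change (g i * r.unop) * v = g i
      rw [← h1, ← mul_assoc, h2]
  apply IsSemisimpleModule.of_sSup_simples_eq_top
  rw [eq_top_iff]
  intro m _
  have hm : m = ∑ i, MulOpposite.op (g i) • m := by
    rw [← Finset.sum_smul, ← Finset.op_sum, hg1, MulOpposite.op_one, one_smul]
  rw [hm]
  refine Submodule.sum_mem _ fun i _ => ?_
  by_cases h0 : MulOpposite.op (g i) • m = 0
  · rw [h0]; exact Submodule.zero_mem _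
  have hG : MulOpposite.op (g i) * MulOpposite.op (g i) = MulOpposite.op (g i) :=
    MulOpposite.unop_injective (hgg i)
  refine Submodule.mem_sSup_of_mem (s := Submodule.span Aᵐᵒᵖ {MulOpposite.op (g i) • m}) ?_
    (Submodule.mem_span_singleton_self _)
  change IsSimpleModule _ _
  rw [isSimpleModule_iff_isAtom]
  refine ⟨by simpa using h0, fun N hN => ?_⟩
  by_contra hN0
  apply hN.not_ge
  obtain ⟨y, hy, hy0⟩ := Submodule.exists_mem_ne_zero_of_ne_bot hN0
  obtain ⟨r, rfl⟩ := Submodule.mem_span_singleton.1 (hN.le hy)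
  rcases key i r with h | ⟨v, hv⟩
  · exact absurd (by rw [smul_smul]; exact hM _ h m) hy0
  · rw [Submodule.span_singleton_le_iff_mem, ← hv, mul_smul, mul_smul]
    exact N.smul_mem v hy

/-- The canonical generator of `S_e`. -/
lemma exists_gen_Se (e : A) (he : IsIdempotentElem e) : ∃ s : SeModule A e,
    (∀ x : SeModule A e, ∃ r : Aᵐᵒᵖ, x = r • s) ∧
    (∀ r : Aᵐᵒᵖ, r • s = 0 ↔ r * MulOpposite.op e ∈ Ring.jacobson Aᵐᵒᵖ) := by
  have hrad : ∀ x, x ∈ eRad A e ↔ e * x = x ∧ x ∈ Ring.jacobson A := by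
    intro x
    constructor
    · intro hx
      refine Submodule.span_induction (p := fun x _ => e * x = x ∧ x ∈ Ring.jacobson A)
        ?_ ?_ ?_ ?_ hx
      · rintro _ ⟨j, hj, rfl⟩
        refine ⟨?_, Ideal.mul_mem_left _ _ (mem_ringRadical.1 hj)⟩
        change e * (e * j) = e * j
        rw [← mul_assoc, he]
      · exact ⟨mul_zero _, zero_mem _⟩
      · rintro x y _ _ ⟨h1, h2⟩ ⟨h3, h4⟩
        exact ⟨by rw [mul_add, h1, h3], add_mem h2 h4⟩
      · rintro r x _ ⟨h1, h2⟩
        refine ⟨?_, (Ring.jacobson A).mul_mem_right _ h2⟩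
        change e * (x * r.unop) = x * r.unop
        rw [← mul_assoc, h1]
    · rintro ⟨h1, h2⟩
      exact Submodule.subset_span ⟨x, mem_ringRadical.2 h2, h1⟩
  let e' : rightIdeal A e := ⟨e, Submodule.mem_span_singleton_self e⟩
  let s : rightIdeal A e ⧸ (eRad A e).comap (rightIdeal A e).subtype := Submodule.Quotient.mk e'
  refine ⟨s, fun x => ?_, fun r => ?_⟩
  · obtain ⟨y, rfl⟩ := Submodule.Quotient.mk_surjective _ x
    refine ⟨MulOpposite.op y.1, ?_⟩
    have : y = MulOpposite.op y.1 • e' := Subtype.ext ((mem_rightIdeal he).1 y.2).symm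
    exact congrArg (Submodule.Quotient.mk (p := (eRad A e).comap (rightIdeal A e).subtype)) this
  · have h1 : r • s = Submodule.Quotient.mk (r • e') := rfl
    have h2 : r * MulOpposite.op e = MulOpposite.op (e * r.unop) := rfl
    rw [h2, op_mem_J_iff]
    change r • s = 0 ↔ _
    rw [h1, Submodule.Quotient.mk_eq_zero, Submodule.mem_comap]
    change e * r.unop ∈ eRad A e ↔ _
    rw [hrad, ← mul_assoc, he]
    simp

end RingTheory
end GlDim

namespace GlDim
noncomputable section

/-! ### Part 2: the corner functor `F` and its right adjoint `G` -/

section Corner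

variable {R Λ : Type} [Ring R] [Ring Λ] (ι : Λ →ₙ+* R)

/-- The elements of `M` fixed by the idempotent `ι 1`. -/
def Fm (M : Type) [AddCommGroup M] [Module R M] : AddSubgroup M where
  carrier := {m | ι 1 • m = m}
  zero_mem' := smul_zero _
  add_mem' := fun {a b} ha hb => by
    change ι 1 • (a + b) = a + b
    rw [smul_add, show ι 1 • a = a from ha, show ι 1 • b = b from hb]
  neg_mem' := fun {a} ha => by
    change ι 1 • (-a) = -a
    rw [smul_neg, show ι 1 • a = a from ha]

lemma iota_one_mul (l : Λ) : ι 1 * ι l = ι l := by rw [← map_mul, one_mul]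
lemma iota_mul_one (l : Λ) : ι l * ι 1 = ι l := by rw [← map_mul, mul_one]

noncomputable instance fmModule (M : Type) [AddCommGroup M] [Module R M] : Module Λ (Fm ι M) where
  smul l m := ⟨ι l • m.1, by
    change ι 1 • ι l • m.1 = ι l • m.1
    rw [smul_smul, iota_one_mul]⟩
  one_smul m := Subtype.ext m.2
  mul_smul a b m := Subtype.ext (by
    change ι (a * b) • m.1 = ι a • ι b • m.1
    rw [map_mul, mul_smul])
  smul_zero a := Subtype.ext (smul_zero _)
  smul_add a x y := Subtype.ext (smul_add _ _ _)
  add_smul a b m := Subtype.ext (by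
    change ι (a + b) • m.1 = ι a • m.1 + ι b • m.1
    rw [map_add, add_smul])
  zero_smul m := Subtype.ext (by
    change ι 0 • m.1 = 0
    rw [map_zero, zero_smul])

lemma fm_smul_val {M : Type} [AddCommGroup M] [Module R M] (l : Λ) (m : Fm ι M) :
    (l • m).1 = ι l • m.1 := rfl

/-- Functoriality of `Fm`. -/
def FmMap {M N : Type} [AddCommGroup M] [Module R M] [AddCommGroup N] [Module R N]
    (φ : M →ₗ[R] N) : Fm ι M →ₗ[Λ] Fm ι N where
  toFun m := ⟨φ m.1, by
    change ι 1 • φ m.1 = φ m.1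
    rw [← map_smul, show ι 1 • m.1 = m.1 from m.2]⟩
  map_add' x y := Subtype.ext (map_add φ x.1 y.1)
  map_smul' l x := Subtype.ext (map_smul φ (ι l) x.1)

/-- The corner functor. -/
def F : ModuleCat.{0} R ⥤ ModuleCat.{0} Λ where
  obj M := ModuleCat.of Λ (Fm ι M)
  map φ := ModuleCat.ofHom (FmMap ι φ.hom)
  map_id M := rfl
  map_comp f g := rfl

lemma F_map_apply {M N : ModuleCat.{0} R} (φ : M ⟶ N) (m : Fm ι M) :
    (((F ι).map φ).hom m : Fm ι N).1 = φ.hom m.1 := rfl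

instance : (F ι).Additive where
  map_add := by intros; rfl

/-- The projection `M → Fm M`. -/
def toFm {M : Type} [AddCommGroup M] [Module R M] (m : M) : Fm ι M :=
  ⟨ι 1 • m, by
    change ι 1 • ι 1 • m = ι 1 • m
    rw [smul_smul, iota_one_mul]⟩

/-- `x • m` for `x ∈ Fm R`. -/
def fmSmul {M : Type} [AddCommGroup M] [Module R M] (m : M) : Fm ι R →ₗ[Λ] Fm ι M :=
  FmMap ι (LinearMap.toSpanSingleton R M m)

lemma fmSmul_val {M : Type} [AddCommGroup M] [Module R M] (m : M) (x : Fm ι R) :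
    (fmSmul ι m x).1 = x.1 • m := rfl

/-- The underlying module of the right adjoint. -/
def Gm (I : Type) [AddCommGroup I] [Module Λ I] : Type := Fm ι R →ₗ[Λ] I

instance (I : Type) [AddCommGroup I] [Module Λ I] : AddCommGroup (Gm ι I) :=
  inferInstanceAs (AddCommGroup (Fm ι R →ₗ[Λ] I))

variable {ι} in
/-- The linear map underlying an element of `Gm`. -/
def Gm.ev {I : Type} [AddCommGroup I] [Module Λ I] (φ : Gm ι I) : Fm ι R →ₗ[Λ] I := φ

variable {ι} in
lemma Gm.ext {I : Type} [AddCommGroup I] [Module Λ I] {φ ψ : Gm ι I}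
    (h : ∀ x, φ.ev x = ψ.ev x) : φ = ψ := LinearMap.ext h

/-- Build an element of `Gm`. -/
def Gm.mk {I : Type} [AddCommGroup I] [Module Λ I] (φ : Fm ι R →ₗ[Λ] I) : Gm ι I := φ

instance (I : Type) [AddCommGroup I] [Module Λ I] : Module R (Gm ι I) where
  smul r φ := Gm.mk ι (φ.ev.comp (fmSmul ι r))
  one_smul φ := Gm.ext fun x => congrArg φ.ev (Subtype.ext (mul_one x.1))
  mul_smul a b φ := Gm.ext fun x => congrArg φ.ev (Subtype.ext (mul_assoc x.1 a b).symm)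
  smul_zero r := rfl
  smul_add r φ ψ := rfl
  add_smul a b φ := Gm.ext fun x => (by
    change φ.ev (fmSmul ι (a + b) x) = φ.ev (fmSmul ι a x) + φ.ev (fmSmul ι b x)
    rw [← map_add]
    exact congrArg φ.ev (Subtype.ext (mul_add x.1 a b)))
  zero_smul φ := Gm.ext fun x => (by
    change φ.ev (fmSmul ι 0 x) = 0
    rw [show fmSmul ι (0 : R) x = 0 from Subtype.ext (mul_zero x.1), map_zero])

lemma gm_smul_apply (I : Type) [AddCommGroup I] [Module Λ I] (r : R) (φ : Gm ι I) (x : Fm ι R) :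
    (r • φ).ev x = φ.ev (fmSmul ι r x) := rfl

/-- The right adjoint of the corner functor. -/
def G : ModuleCat.{0} Λ ⥤ ModuleCat.{0} R where
  obj I := ModuleCat.of R (Gm ι I)
  map {I I'} φ := ModuleCat.ofHom
    { toFun := fun (ψ : Gm ι I) => Gm.mk ι (φ.hom.comp ψ.ev)
      map_add' := fun a b => LinearMap.comp_add _ _ _
      map_smul' := fun r a => rfl }
  map_id I := rfl
  map_comp f g := rfl

/-- The element `ι 1` of `Fm R`. -/
def unitFm : Fm ι R := ⟨ι 1, iota_one_mul ι 1⟩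

/-- The adjunct of a map `F M ⟶ I`. -/
def adjTo {M : Type} [AddCommGroup M] [Module R M] {I : Type} [AddCommGroup I] [Module Λ I]
    (ψ : Fm ι M →ₗ[Λ] I) : M →ₗ[R] Gm ι I where
  toFun := fun m => Gm.mk ι (ψ.comp (fmSmul ι m))
  map_add' := fun a b => Gm.ext fun x => (by
    change ψ (fmSmul ι (a + b) x) = ψ (fmSmul ι a x) + ψ (fmSmul ι b x)
    rw [← map_add]
    exact congrArg ψ (Subtype.ext (smul_add x.1 a b)))
  map_smul' := fun r m => Gm.ext fun x =>
    congrArg ψ (Subtype.ext (smul_smul x.1 r m))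

/-- The inverse adjunct. -/
def adjInv {M : Type} [AddCommGroup M] [Module R M] {I : Type} [AddCommGroup I] [Module Λ I]
    (Φ : M →ₗ[R] Gm ι I) : Fm ι M →ₗ[Λ] I where
  toFun := fun m => (Φ m.1).ev (unitFm ι)
  map_add' := fun a b => (by
    rw [AddSubgroup.coe_add, map_add]; rfl)
  map_smul' := fun l m => (by
    rw [fm_smul_val, map_smul]
    change (Φ m.1).ev (fmSmul ι (ι l) (unitFm ι)) = _
    rw [RingHom.id_apply, ← map_smul]
    refine congrArg (Φ m.1).ev (Subtype.ext ?_)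
    change ι 1 * ι l = ι l * ι 1
    rw [iota_one_mul, iota_mul_one])

lemma adjInv_adjTo {M : Type} [AddCommGroup M] [Module R M] {I : Type} [AddCommGroup I] [Module Λ I]
    (ψ : Fm ι M →ₗ[Λ] I) : adjInv ι (adjTo ι ψ) = ψ :=
  LinearMap.ext fun m => congrArg ψ (Subtype.ext m.2)

lemma adjTo_adjInv {M : Type} [AddCommGroup M] [Module R M] {I : Type} [AddCommGroup I] [Module Λ I]
    (Φ : M →ₗ[R] Gm ι I) : adjTo ι (adjInv ι Φ) = Φ :=
  LinearMap.ext fun m => Gm.ext fun x => (by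
    change (Φ (x.1 • m)).ev (unitFm ι) = (Φ m).ev x
    rw [map_smul]
    exact congrArg (Φ m).ev (Subtype.ext x.2))

/-- The adjunction between the corner functor and `G`. -/
def adj : F ι ⊣ G ι :=
  Adjunction.mkOfHomEquiv
    { homEquiv := fun M I =>
        { toFun := fun ψ => ModuleCat.ofHom (adjTo ι (M := M) (I := I) ψ.hom)
          invFun := fun Φ => ModuleCat.ofHom (adjInv ι (M := M) (I := I) Φ.hom)
          left_inv := fun ψ => ModuleCat.hom_ext (adjInv_adjTo ι (M := M) (I := I) ψ.hom)
          right_inv := fun Φ => ModuleCat.hom_ext (adjTo_adjInv ι (M := M) (I := I) Φ.hom) }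
      homEquiv_naturality_left_symm := fun f g => rfl
      homEquiv_naturality_right := fun f g => rfl }

instance : (F ι).IsLeftAdjoint := (adj ι).isLeftAdjoint

instance : Limits.PreservesFiniteColimits (F ι) :=
  have : Limits.PreservesColimitsOfSize.{0, 0} (F ι) := (adj ι).leftAdjoint_preservesColimits
  Limits.PreservesColimitsOfSize.preservesFiniteColimits.{0, 0} (F ι)

instance : Limits.PreservesFiniteLimits (F ι) := by
  rw [Functor.preservesFiniteLimits_iff_forall_exact_map_and_mono]
  intro S hS
  constructor
  · rw [ShortComplex.moduleCat_exact_iff]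
    intro x hx
    obtain ⟨y, hy⟩ := (ShortComplex.moduleCat_exact_iff S).1 hS.exact x.1 (congrArg Subtype.val hx)
    refine ⟨toFm ι (M := S.X₁) y, Subtype.ext ?_⟩
    change S.f.hom (ι 1 • y) = x.1
    rw [map_smul]
    change ι 1 • S.f.hom y = x.1
    have : S.f.hom y = x.1 := hy
    rw [this]
    exact x.2
  · rw [ModuleCat.mono_iff_injective]
    intro a b h
    exact Subtype.ext (hS.moduleCat_injective_f (congrArg Subtype.val h))

lemma counit_apply (I : ModuleCat.{0} Λ) (x : Fm ι (Gm ι I)) :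
    ((adj ι).counit.app I).hom x = x.1.ev (unitFm ι) := by
  rfl

lemma isIso_counit (hinj : Function.Injective ι)
    (hsurj : ∀ x : R, ι 1 * x = x → x * ι 1 = x → ∃ l, ι l = x) (I : ModuleCat.{0} Λ) :
    IsIso ((adj ι).counit.app I) := by
  have key : ∀ x : Fm ι R, ∃ l : Λ, ι l = x.1 * ι 1 := fun x => hsurj _
    (by rw [← mul_assoc, show ι 1 * x.1 = x.1 from x.2])
    (by rw [mul_assoc, iota_one_mul])
  choose lam hlam using key
  rw [ConcreteCategory.isIso_iff_bijective]
  constructor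
  · intro x y hxy
    replace hxy : x.1.ev (unitFm ι) = y.1.ev (unitFm ι) := hxy
    have h1 : ∀ (x : Fm ι (Gm ι I)) (z : Fm ι R), x.1.ev z =
        lam z • x.1.ev (unitFm ι) := by
      intro x z
      have h2 : ι 1 • x.1 = x.1 := x.2
      conv_lhs => rw [← h2]
      rw [← map_smul]
      refine congrArg x.1.ev (Subtype.ext ?_)
      change z.1 * ι 1 = ι (lam z) * ι 1
      rw [hlam, mul_assoc, iota_one_mul]
    exact Subtype.ext (Gm.ext fun z => by rw [h1 x, h1 y, hxy])
  · intro i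
    let φ : Fm ι R →ₗ[Λ] I :=
      { toFun := fun z => lam z • i
        map_add' := fun a b => (by
          rw [← add_smul]; congr 1
          apply hinj
          rw [map_add, hlam, hlam, hlam, AddSubgroup.coe_add, add_mul])
        map_smul' := fun l a => (by
          rw [RingHom.id_apply, smul_smul]; congr 1
          apply hinj
          rw [map_mul, hlam, hlam, fm_smul_val, smul_eq_mul, mul_assoc]) }
    refine ⟨⟨Gm.mk ι φ, ?_⟩, ?_⟩
    · refine Gm.ext fun z => ?_
      change lam (fmSmul ι (ι 1) z) • i = lam z • i
      congr 1
      apply hinj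
      rw [hlam, hlam, fmSmul_val, smul_eq_mul, mul_assoc, iota_one_mul]
    · change lam (unitFm ι) • i = i
      rw [show lam (unitFm ι) = 1 from hinj (by rw [hlam]; exact iota_one_mul ι 1), one_smul]

lemma injective_G (I : ModuleCat.{0} Λ) [Injective I] : Injective ((G ι).obj I) :=
  Injective.injective_of_adjoint (adj ι) I

lemma isZero_F_iff (M : ModuleCat.{0} R) :
    Limits.IsZero ((F ι).obj M) ↔ ∀ m : M, ι 1 • m = 0 := by
  rw [ModuleCat.isZero_iff_subsingleton]
  constructor
  · intro h m
    exact congrArg Subtype.val (h.elim (toFm ι (M := M) m) 0)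
  · intro h
    exact ⟨fun a b => Subtype.ext (by
      rw [← show ι 1 • a.1 = a.1 from a.2, ← show ι 1 • b.1 = b.1 from b.2, h, h])⟩

end Corner
end
end GlDim

namespace GlDim
noncomputable section

/-! ### Part 3: the left adjoint of the corner functor -/

section Left

variable {R Λ : Type} [Ring R] [Ring Λ] (ι : Λ →ₙ+* R)

/-- The projective module `R η`. -/
def Peta : ModuleCat.{0} R := ModuleCat.of R (Submodule.span R {ι 1})

/-- The generator of `R η`. -/
def etaGen : Submodule.span R {ι 1} := ⟨ι 1, Submodule.mem_span_singleton_self _⟩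

lemma peta_mul (x : Submodule.span R {ι 1}) : x.1 * ι 1 = x.1 := by
  obtain ⟨r, hr⟩ := Submodule.mem_span_singleton.1 x.2
  rw [← hr, smul_eq_mul, mul_assoc, iota_one_mul]

lemma peta_eq (x : Submodule.span R {ι 1}) : x = x.1 • etaGen ι :=
  Subtype.ext (peta_mul ι x).symm

lemma peta_hom {M : Type} [AddCommGroup M] [Module R M]
    (f : Submodule.span R {ι 1} →ₗ[R] M) (x : Submodule.span R {ι 1}) :
    x.1 • f (etaGen ι) = f x := by
  rw [← map_smul, ← peta_eq]

/-- `F` followed by the forgetful functor is corepresentable. -/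
def FforgetIso : F ι ⋙ forget (ModuleCat.{0} Λ) ≅ coyoneda.obj (Opposite.op (Peta ι)) :=
  NatIso.ofComponents (fun M => Equiv.toIso
    { toFun := fun (m : Fm ι M) => ModuleCat.ofHom
        ((LinearMap.toSpanSingleton R M m.1).comp (Submodule.span R {ι 1}).subtype)
      invFun := fun f => (⟨f.hom (etaGen ι), by
        exact peta_hom ι (M := M) f.hom (etaGen ι)⟩ : Fm ι M)
      left_inv := fun m => Subtype.ext m.2
      right_inv := fun f => ModuleCat.hom_ext (LinearMap.ext fun x => peta_hom ι (M := M) f.hom x) }) (by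
    intro M N f
    ext m
    apply ModuleCat.hom_ext
    apply LinearMap.ext
    intro x
    exact (map_smul f.hom x.1 (Subtype.val (p := fun z => z ∈ Fm ι M) m)).symm)

instance : Limits.PreservesLimitsOfSize.{0, 0} (F ι) := by
  have : Limits.PreservesLimitsOfSize.{0, 0} (F ι ⋙ forget (ModuleCat.{0} Λ)) :=
    Limits.preservesLimits_of_natIso (FforgetIso ι).symm
  exact Limits.preservesLimits_of_reflects_of_preserves (F ι) (forget (ModuleCat.{0} Λ))

instance : (F ι).IsRightAdjoint :=
  isRightAdjoint_of_preservesLimits_of_isCoseparating (isCoseparator_coseparator _) _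

/-- The left adjoint of the corner functor. -/
def L : ModuleCat.{0} Λ ⥤ ModuleCat.{0} R := (F ι).leftAdjoint

/-- The adjunction. -/
def adjL : L ι ⊣ F ι := Adjunction.ofIsRightAdjoint (F ι)

lemma isIso_unit_L (hinj : Function.Injective ι)
    (hsurj : ∀ x : R, ι 1 * x = x → x * ι 1 = x → ∃ l, ι l = x) (N : ModuleCat.{0} Λ) :
    IsIso ((adjL ι).unit.app N) := by
  have h : IsIso (adj ι).counit := by
    have := isIso_counit ι hinj hsurj
    exact NatIso.isIso_of_isIso_app _
  have := (Adjunction.Triple.isIso_unit_iff_isIso_counit ⟨adjL ι, adj ι⟩).2 h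
  infer_instance

lemma projective_L (Q : ModuleCat.{0} Λ) [Projective Q] : Projective ((L ι).obj Q) :=
  (adjL ι).map_projective Q inferInstance

end Left
end
end GlDim

set_option linter.unusedSectionVars false
namespace GlDim
noncomputable section

/-! ### Part 4: dimension shifting along an exact functor with adjoints -/

section Abstract

universe w v u w' v' u'
variable {C : Type u} [Category.{v} C] [Abelian C] [HasExt.{w} C]
variable {D : Type u'} [Category.{v'} D] [Abelian D] [HasExt.{w'} D]

/-- Ext vanishing in degrees `≥ n`. -/
def EV (X N : C) (n : ℕ) : Prop := ∀ i, n ≤ i → ∀ x : Ext X N i, x = 0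

lemma EV.mono {X N : C} {n m : ℕ} (h : EV X N n) (hnm : n ≤ m) : EV X N m :=
  fun i hi x => h i (hnm.trans hi) x

lemma EV.X₂ {X : C} {T : ShortComplex C} (hT : T.ShortExact) {n : ℕ}
    (h₁ : EV X T.X₁ n) (h₃ : EV X T.X₃ n) : EV X T.X₂ n := by
  intro i hi x
  obtain ⟨y, rfl⟩ := Ext.covariant_sequence_exact₂ X hT x (h₃ i hi _)
  rw [h₁ i hi y, Ext.zero_comp]

lemma EV.X₁ {X : C} {T : ShortComplex C} (hT : T.ShortExact) {n : ℕ}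
    (h₂ : EV X T.X₂ (n + 1)) (h₃ : EV X T.X₃ n) : EV X T.X₁ (n + 1) := by
  intro i hi x
  obtain ⟨j, rfl⟩ : ∃ j, i = j + 1 := ⟨i - 1, by omega⟩
  obtain ⟨y, rfl⟩ := Ext.covariant_sequence_exact₁ X hT x (h₂ _ hi _) rfl
  rw [h₃ j (by omega) y, Ext.zero_comp]

lemma EV.of_retract {X N N' : C} (r : Retract N N') {n : ℕ} (h : EV X N' n) : EV X N n := by
  intro i hi x
  have h1 := h i hi (x.comp (Ext.mk₀ r.i) (add_zero i))
  have h2 : (x.comp (Ext.mk₀ r.i) (add_zero i)).comp (Ext.mk₀ r.r) (add_zero i) = x := by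
    rw [Ext.comp_assoc_of_third_deg_zero, Ext.mk₀_comp_mk₀, r.retract, Ext.comp_mk₀_id]
  rw [← h2, h1, Ext.zero_comp]

lemma EV.of_injective {X I : C} [Injective I] : EV X I 1 := by
  intro i hi x
  obtain ⟨j, rfl⟩ : ∃ j, i = j + 1 := ⟨i - 1, by omega⟩
  exact Ext.eq_zero_of_injective x

lemma shortExact_ker {N M : C} (h : N ⟶ M) :
    (ShortComplex.mk (Limits.kernel.ι h) (Abelian.coimage.π h)
      (Limits.cokernel.condition _)).ShortExact where
  exact := ShortComplex.exact_cokernel _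

lemma shortExact_coker {N M : C} (h : N ⟶ M) [Mono h] :
    (ShortComplex.mk h (Limits.cokernel.π h) (Limits.cokernel.condition _)).ShortExact where
  exact := ShortComplex.exact_cokernel _

lemma shortExact_im {N M : C} (h : N ⟶ M) [Epi h] :
    (ShortComplex.mk (Limits.kernel.ι h) h (Limits.kernel.condition _)).ShortExact where
  exact := ShortComplex.exact_kernel _

variable (F : C ⥤ D) [F.Additive] [Limits.PreservesFiniteLimits F] [Limits.PreservesFiniteColimits F]

lemma isZero_F_kernel {N M : C} (h : N ⟶ M) [Mono (F.map h)] :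
    Limits.IsZero (F.obj (Limits.kernel h)) := by
  have : F.map (Limits.kernel.ι h) = 0 := by
    rw [← cancel_mono (F.map h), ← F.map_comp, Limits.kernel.condition, F.map_zero,
      Limits.zero_comp]
  exact Limits.IsZero.of_mono_eq_zero _ this

lemma isZero_F_cokernel {N M : C} (h : N ⟶ M) [Epi (F.map h)] :
    Limits.IsZero (F.obj (Limits.cokernel h)) := by
  have : F.map (Limits.cokernel.π h) = 0 := by
    rw [← cancel_epi (F.map h), ← F.map_comp, Limits.cokernel.condition, F.map_zero,
      Limits.comp_zero]
  exact Limits.IsZero.of_epi_eq_zero _ this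

lemma isIso_F_g {T : ShortComplex C} (hT : T.ShortExact) (h : Limits.IsZero (F.obj T.X₁)) :
    IsIso (F.map T.g) := by
  have hT' := hT.map_of_exact F
  have : Mono (F.map T.g) := hT'.exact.mono_g (h.eq_of_src _ _)
  have : Epi (F.map T.g) := hT'.epi_g
  exact isIso_of_mono_of_epi _

lemma isIso_F_f {T : ShortComplex C} (hT : T.ShortExact) (h : Limits.IsZero (F.obj T.X₃)) :
    IsIso (F.map T.f) := by
  have hT' := hT.map_of_exact F
  have : Epi (F.map T.f) := hT'.exact.epi_f (h.eq_of_tgt _ _)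
  have : Mono (F.map T.f) := hT'.mono_f
  exact isIso_of_mono_of_epi _

variable {F}

lemma exists_EV [EnoughInjectives D] {G : D ⥤ C} (adj : F ⊣ G) [∀ I, IsIso (adj.counit.app I)]
    (S : C) (N0 : ℕ) (hE : ∀ Z, Limits.IsZero (F.obj Z) → EV S Z N0) (d : ℕ) :
    ∃ n0, ∀ N : C, HasInjectiveDimensionLT (F.obj N) (d + 1) → EV S N n0 := by
  -- the step
  have step : ∀ (N : C) (I : D) (φ : F.obj N ⟶ I) [Mono φ] [Injective I],
      ∃ (N' : C) (g : N ⟶ N') (Q : C) (T : ShortComplex C) (hT : T.ShortExact)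
        (e1 : T.X₁ ≅ N') (e2 : T.X₂ ≅ G.obj I) (e3 : T.X₃ ≅ Q), IsIso (F.map g) ∧
        (∀ n, N0 ≤ n → EV S N' n → EV S N n) ∧ (IsIso φ → Limits.IsZero (F.obj Q)) := by
    intro N I φ _ _
    let h := adj.homEquiv _ _ φ
    have hh : F.map h ≫ adj.counit.app I = φ := by
      exact (Adjunction.homEquiv_counit (adj := adj) _ _ _).symm.trans ((adj.homEquiv _ _).symm_apply_apply φ)
    have hm : Mono (F.map h) := by
      have : Mono (F.map h ≫ adj.counit.app I) := by rw [hh]; infer_instance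
      exact mono_of_mono _ (adj.counit.app I)
    have hz : Limits.IsZero (F.obj (Limits.kernel h)) := isZero_F_kernel F h
    have hSE := shortExact_ker h
    let k := Abelian.factorThruCoimage h
    refine ⟨Abelian.coimage h, Abelian.coimage.π h, Limits.cokernel k, _, shortExact_coker k,
      Iso.refl _, Iso.refl _, Iso.refl _, isIso_F_g F hSE hz, ?_, ?_⟩
    · intro n hn hN'
      exact EV.X₂ hSE ((hE _ hz).mono hn) hN'
    · intro hφ
      have h1 : IsIso (F.map h) := by
        have : F.map h = φ ≫ inv (adj.counit.app I) := by rw [← hh]; simp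
        rw [this]; infer_instance
      have h2 : F.map h = F.map (Abelian.coimage.π h) ≫ F.map k := by
        rw [← F.map_comp]
        congr 1
        exact (Abelian.coimage.fac h).symm
      have : Epi (F.map k) := by
        have : Epi (F.map (Abelian.coimage.π h) ≫ F.map k) := by rw [← h2]; infer_instance
        exact epi_of_epi (F.map (Abelian.coimage.π h)) _
      exact isZero_F_cokernel F k
  have : Functor.PreservesMonomorphisms F := inferInstance
  have hGI : ∀ (I : D) [Injective I], Injective (G.obj I) := fun I _ =>
    Injective.injective_of_adjoint adj I
  induction d with
  | zero =>
    refine ⟨N0 + 1, fun N hN => ?_⟩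
    have : Injective (F.obj N) := inferInstance
    obtain ⟨N', g, Q, T, hT, e1, e2, e3, hg, hEV, hQ⟩ := step N (F.obj N) (𝟙 _)
    apply hEV _ (by omega)
    have h3 : EV S T.X₃ N0 := hE _ ((hQ inferInstance).of_iso (F.mapIso e3))
    have := hGI (F.obj N)
    have : EV S T.X₂ (N0 + 1) :=
      (EV.of_retract (Retract.ofIso e2) (EV.of_injective)).mono (by omega)
    exact EV.of_retract (Retract.ofIso e1.symm) (EV.X₁ hT this h3)
  | succ d ih =>
    obtain ⟨n0, hn0⟩ := ih
    refine ⟨N0 + n0 + 1, fun N hN => ?_⟩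
    let I := Injective.under (F.obj N)
    obtain ⟨N', g, Q, T, hT, e1, e2, e3, hg, hEV, hQ⟩ := step N I (Injective.ι (F.obj N))
    apply hEV _ (by omega)
    have := hGI I
    have h2 : EV S T.X₂ (n0 + 1) :=
      (EV.of_retract (Retract.ofIso e2) (EV.of_injective)).mono (by omega)
    have hT' := hT.map_of_exact F
    have hX2 : HasInjectiveDimensionLT (F.obj T.X₂) (d + 1) := by
      have := hasInjectiveDimensionLT_of_iso ((asIso (adj.counit.app I)).symm ≪≫ F.mapIso e2.symm) 1
      exact hasInjectiveDimensionLT_of_ge _ 1 _ (by omega)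
    have hX1 : HasInjectiveDimensionLT (F.obj T.X₁) (d + 2) := by
      have hN : HasInjectiveDimensionLT (F.obj N) (d + 2) := hN
      exact hasInjectiveDimensionLT_of_iso (asIso (F.map g) ≪≫ F.mapIso e1.symm) _
    have h3 : EV S T.X₃ n0 := hn0 _ (hT'.hasInjectiveDimensionLT_X₃ (d + 1) hX2 hX1)
    exact (EV.of_retract (Retract.ofIso e1.symm) (EV.X₁ hT h2 h3)).mono (by omega)

lemma exists_pd [EnoughProjectives D] {L : D ⥤ C} (adj : L ⊣ F) [∀ I, IsIso (adj.unit.app I)]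
    (N0 : ℕ) (hE : ∀ Z, Limits.IsZero (F.obj Z) → HasProjectiveDimensionLT Z N0) (d : ℕ) :
    ∃ n0, ∀ N : C, HasProjectiveDimensionLT (F.obj N) (d + 1) → HasProjectiveDimensionLT N n0 := by
  have step : ∀ (N : C) (I : D) (φ : I ⟶ F.obj N) [Epi φ] [Projective I],
      ∃ (N' : C) (g : N' ⟶ N) (T : ShortComplex C) (hT : T.ShortExact)
        (e1 : T.X₃ ≅ N') (e2 : T.X₂ ≅ L.obj I), IsIso (F.map g) ∧
        (∀ n, N0 ≤ n → HasProjectiveDimensionLT N' n → HasProjectiveDimensionLT N n) ∧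
        (IsIso φ → Limits.IsZero (F.obj T.X₁)) := by
    intro N I φ _ _
    let h := (adj.homEquiv _ _).symm φ
    have hh : adj.unit.app I ≫ F.map h = φ := by
      exact (Adjunction.homEquiv_unit (adj := adj) _ _ _).symm.trans ((adj.homEquiv _ _).apply_symm_apply φ)
    have hm : Epi (F.map h) := by
      have : Epi (adj.unit.app I ≫ F.map h) := by rw [hh]; infer_instance
      exact epi_of_epi (adj.unit.app I) _
    let k := Abelian.factorThruImage h
    have h2 : F.map h = F.map k ≫ F.map (Abelian.image.ι h) := by
      rw [← F.map_comp]
      congr 1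
      exact (Abelian.image.fac h).symm
    have hk : Epi (F.map (Abelian.image.ι h)) := by
      have : Epi (F.map k ≫ F.map (Abelian.image.ι h)) := by rw [← h2]; infer_instance
      exact epi_of_epi (F.map k) _
    have hz := isZero_F_cokernel F (Abelian.image.ι h)
    have hSE := shortExact_coker (Abelian.image.ι h)
    refine ⟨Abelian.image h, Abelian.image.ι h, _, shortExact_im k,
      Iso.refl _, Iso.refl _, isIso_F_f F hSE hz, ?_, ?_⟩
    · intro n hn hN'
      have := hE _ hz
      exact hSE.hasProjectiveDimensionLT_X₂ n hN' (hasProjectiveDimensionLT_of_ge _ N0 _ hn)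
    · intro hφ
      have h1 : IsIso (F.map h) := by
        have : F.map h = inv (adj.unit.app I) ≫ φ := by rw [← hh]; simp
        rw [this]; infer_instance
      have : Mono (F.map k) := by
        have : Mono (F.map k ≫ F.map (Abelian.image.ι h)) := by rw [← h2]; infer_instance
        exact mono_of_mono _ (F.map (Abelian.image.ι h))
      exact isZero_F_kernel F k
  have : Functor.PreservesEpimorphisms F := inferInstance
  have hGI : ∀ (I : D) [Projective I], Projective (L.obj I) := fun I _ =>
    adj.map_projective I inferInstance
  induction d with
  | zero =>
    refine ⟨N0 + 1, fun N hN => ?_⟩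
    have : Projective (F.obj N) := projective_iff_hasProjectiveDimensionLT_one.2 hN
    obtain ⟨N', g, T, hT, e1, e2, hg, hEV, hQ⟩ := step N (F.obj N) (𝟙 _)
    apply hEV _ (by omega)
    have h3 := hE _ (hQ inferInstance)
    have := hGI (F.obj N)
    have : HasProjectiveDimensionLT T.X₂ 1 := hasProjectiveDimensionLT_of_iso e2.symm 1
    have : HasProjectiveDimensionLT T.X₃ (N0 + 1) := hT.hasProjectiveDimensionLT_X₃ N0 h3
      (hasProjectiveDimensionLT_of_ge _ 1 _ (by omega))
    exact hasProjectiveDimensionLT_of_iso e1 _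
  | succ d ih =>
    obtain ⟨n0, hn0⟩ := ih
    refine ⟨N0 + n0 + 1, fun N hN => ?_⟩
    let I := Projective.over (F.obj N)
    obtain ⟨N', g, T, hT, e1, e2, hg, hEV, hQ⟩ := step N I (Projective.π (F.obj N))
    apply hEV _ (by omega)
    have := hGI I
    have h2 : HasProjectiveDimensionLT T.X₂ 1 := hasProjectiveDimensionLT_of_iso e2.symm 1
    have hT' := hT.map_of_exact F
    have hX2 : HasProjectiveDimensionLT (F.obj T.X₂) (d + 1) := by
      have := hasProjectiveDimensionLT_of_iso ((asIso (adj.unit.app I)) ≪≫ F.mapIso e2.symm) 1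
      exact hasProjectiveDimensionLT_of_ge _ 1 _ (by omega)
    have hX1 : HasProjectiveDimensionLT (F.obj T.X₃) (d + 2) := by
      have hN : HasProjectiveDimensionLT (F.obj N) (d + 2) := hN
      exact hasProjectiveDimensionLT_of_iso ((asIso (F.map g)).symm ≪≫ F.mapIso e1.symm) _
    have h3 : HasProjectiveDimensionLT T.X₁ n0 :=
      hn0 _ (hT'.hasProjectiveDimensionLT_X₁ (d + 1) hX2 hX1)
    have : HasProjectiveDimensionLT T.X₃ (n0 + 1) := hT.hasProjectiveDimensionLT_X₃ n0 h3
      (hasProjectiveDimensionLT_of_ge _ 1 _ (by omega))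
    have := hasProjectiveDimensionLT_of_iso e1 (n0 + 1)
    exact hasProjectiveDimensionLT_of_ge _ (n0 + 1) _ (by omega)

end Abstract
end
end GlDim

set_option linter.unusedSectionVars false
namespace GlDim
noncomputable section

/-! ### Part 5: module-theoretic part -/

section Jit

variable {R : Type} [Ring R]

/-- Iterated multiplication by the Jacobson radical. -/
def Jit {M : Type} [AddCommGroup M] [Module R M] (k : ℕ) (N : Submodule R M) : Submodule R M :=
  (fun N => Ring.jacobson R • N)^[k] N

variable {M M' : Type} [AddCommGroup M] [Module R M] [AddCommGroup M'] [Module R M']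

lemma jit_zero (N : Submodule R M) : Jit 0 N = N := rfl

lemma jit_succ (k : ℕ) (N : Submodule R M) : Jit (k + 1) N = Ring.jacobson R • Jit k N :=
  Function.iterate_succ_apply' _ _ _

lemma jit_add (a b : ℕ) (N : Submodule R M) : Jit (a + b) N = Jit a (Jit b N) :=
  Function.iterate_add_apply _ _ _ _

lemma jit_mono (k : ℕ) {N N' : Submodule R M} (h : N ≤ N') : Jit k N ≤ Jit k N' := by
  induction k with
  | zero => exact h
  | succ k ih => rw [jit_succ, jit_succ]; exact Submodule.smul_mono le_rfl ih

lemma jit_le (k : ℕ) (N : Submodule R M) : Jit k N ≤ N := by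
  induction k with
  | zero => exact le_rfl
  | succ k ih => rw [jit_succ]; exact Submodule.smul_le_right.trans ih

lemma jit_anti {a b : ℕ} (h : a ≤ b) (N : Submodule R M) : Jit b N ≤ Jit a N := by
  obtain ⟨c, rfl⟩ := Nat.exists_eq_add_of_le' h
  rw [jit_add]; exact jit_le _ _

lemma jit_map (f : M →ₗ[R] M') (k : ℕ) (N : Submodule R M) :
    (Jit k N).map f = Jit k (N.map f) := by
  induction k with
  | zero => rfl
  | succ k ih => rw [jit_succ, jit_succ, ← ih, Submodule.map_smul'']

lemma jit_bot (k : ℕ) : Jit k (⊥ : Submodule R M) = ⊥ := le_bot_iff.1 (jit_le _ _)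

/-- `M` is killed by the `k`-th power of the radical. -/
def JK (k : ℕ) (M : Type) [AddCommGroup M] [Module R M] : Prop := Jit k (⊤ : Submodule R M) = ⊥

lemma JK.mono {a b : ℕ} (h : JK (R := R) a M) (hab : a ≤ b) : JK (R := R) b M :=
  le_bot_iff.1 ((jit_anti hab ⊤).trans h.le)

lemma JK.of_injective {k : ℕ} (f : M →ₗ[R] M') (hf : Function.Injective f)
    (h : JK (R := R) k M') : JK (R := R) k M := by
  have : (Jit k (⊤ : Submodule R M)).map f = ⊥ := by
    rw [jit_map]; exact le_bot_iff.1 ((jit_mono k le_top).trans h.le)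
  exact Submodule.map_injective_of_injective hf (this.trans (Submodule.map_bot f).symm)

lemma JK.of_surjective {k : ℕ} (f : M →ₗ[R] M') (hf : Function.Surjective f)
    (h : JK (R := R) k M) : JK (R := R) k M' := by
  have : (Jit k (⊤ : Submodule R M)).map f = Jit k ⊤ := by
    rw [jit_map, Submodule.map_top, LinearMap.range_eq_top.2 hf]
  rw [JK, ← this, h, Submodule.map_bot]

lemma JK.ext {M'' : Type} [AddCommGroup M''] [Module R M''] (f : M' →ₗ[R] M) (g : M →ₗ[R] M'')
    (hfg : ∀ x, g x = 0 → ∃ y, f y = x) {a b : ℕ} (ha : JK (R := R) a M') (hb : JK (R := R) b M'') :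
    JK (R := R) (a + b) M := by
  have h1 : Jit b (⊤ : Submodule R M) ≤ (⊤ : Submodule R M').map f := by
    intro x hx
    have : g x ∈ (Jit b (⊤ : Submodule R M)).map g := ⟨x, hx, rfl⟩
    rw [jit_map] at this
    have h2 : g x = 0 := by
      have := (jit_mono b le_top) this
      rw [show Jit b (⊤ : Submodule R M'') = ⊥ from hb] at this
      exact this
    obtain ⟨y, hy⟩ := hfg x h2
    exact ⟨y, trivial, hy⟩
  have h3 := jit_mono a h1
  rw [← jit_add, ← jit_map, show Jit a (⊤ : Submodule R M') = ⊥ from ha, Submodule.map_bot] at h3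
  exact le_bot_iff.1 h3

lemma jk_one_iff : JK (R := R) 1 M ↔ ∀ j ∈ Ring.jacobson R, ∀ m : M, j • m = 0 := by
  rw [JK, jit_succ, jit_zero]
  constructor
  · intro h j hj m
    have : j • m ∈ (Ring.jacobson R • (⊤ : Submodule R M)) := Submodule.smul_mem_smul hj trivial
    rw [h] at this; exact this
  · intro h
    rw [eq_bot_iff, Submodule.smul_le]
    intro r hr n _
    rw [h r hr]; exact Submodule.zero_mem _

end Jit

section PiSum

variable {R : Type} [Ring R]

lemma shortExact_of {M N P : ModuleCat.{0} R} (f : M ⟶ N) (g : N ⟶ P)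
    (hf : Function.Injective f) (hg : Function.Surjective g) (hfg : ∀ x, g (f x) = 0)
    (hex : ∀ x, g x = 0 → ∃ y, f y = x) :
    (ShortComplex.mk f g (by ext x; exact hfg x)).ShortExact where
  exact := (ShortComplex.moduleCat_exact_iff _).2 hex
  mono_f := (ModuleCat.mono_iff_injective _).2 hf
  epi_g := (ModuleCat.epi_iff_surjective _).2 hg

lemma pd_finsupp (I : Type) (n : ℕ) : ∀ (S : ModuleCat.{0} R), HasProjectiveDimensionLT S n →
    HasProjectiveDimensionLT (ModuleCat.of R (I →₀ S)) n := by
  have hproj : ∀ (S : ModuleCat.{0} R), Projective S → Projective (ModuleCat.of R (I →₀ S)) := by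
    intro S hS
    rw [← IsProjective.iff_projective] at hS ⊢
    classical
    exact Module.Projective.of_equiv (finsuppLEquivDirectSum R S I).symm
  induction n with
  | zero =>
    intro S h
    have : Limits.IsZero S := isZero_of_hasProjectiveDimensionLT_zero S
    rw [ModuleCat.isZero_iff_subsingleton] at this
    apply Limits.IsZero.hasProjectiveDimensionLT_zero
    rw [ModuleCat.isZero_iff_subsingleton]
    exact inferInstanceAs (Subsingleton (I →₀ S))
  | succ n ih =>
    intro S h
    by_cases hn : n = 0
    · subst hn
      have : Projective S := projective_iff_hasProjectiveDimensionLT_one.2 h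
      exact projective_iff_hasProjectiveDimensionLT_one.1 (hproj S this)
    · obtain ⟨n, rfl⟩ := Nat.exists_eq_succ_of_ne_zero hn
      have hT := shortExact_im (Projective.π S)
      have hK : HasProjectiveDimensionLT (Limits.kernel (Projective.π S)) (n + 1) :=
        hT.hasProjectiveDimensionLT_X₁ (n + 1) (by
          have : HasProjectiveDimensionLT (Projective.over S) 1 := inferInstance
          exact hasProjectiveDimensionLT_of_ge _ 1 _ (by omega)) h
      have h1 := ih _ hK
      let f : ModuleCat.of R (I →₀ ↑(Limits.kernel (Projective.π S))) ⟶
          ModuleCat.of R (I →₀ ↑(Projective.over S)) :=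
        ModuleCat.ofHom (Finsupp.mapRange.linearMap (Limits.kernel.ι (Projective.π S)).hom)
      let g : ModuleCat.of R (I →₀ ↑(Projective.over S)) ⟶ ModuleCat.of R (I →₀ S) :=
        ModuleCat.ofHom (Finsupp.mapRange.linearMap (Projective.π S).hom)
      have hinj : Function.Injective (Limits.kernel.ι (Projective.π S)).hom :=
        (ModuleCat.mono_iff_injective _).1 inferInstance
      have hsurj : Function.Surjective (Projective.π S).hom :=
        (ModuleCat.epi_iff_surjective _).1 inferInstance
      have hSE := shortExact_of f g (Finsupp.mapRange_injective _ (map_zero _) hinj)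
        (Finsupp.mapRange_surjective _ (map_zero _) hsurj) (by
          intro x
          ext i
          have := congrArg (fun (q : Limits.kernel (Projective.π S) ⟶ S) => q.hom (x i)) (Limits.kernel.condition (Projective.π S))
          exact this) (by
          intro x hx
          have h2 : ∀ i, ∃ y, (Limits.kernel.ι (Projective.π S)).hom y = x i := by
            intro i
            exact (ShortComplex.moduleCat_exact_iff _).1 hT.exact (x i) (DFunLike.congr_fun hx i)
          choose y hy using h2
          classical
          refine ⟨Finsupp.onFinset x.support y ?_, ?_⟩
          · intro i hi
            rw [Finsupp.mem_support_iff]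
            intro h0
            apply hi
            apply hinj
            rw [hy, h0, map_zero]
          · ext i
            exact hy i)
      have h2 : Projective (ModuleCat.of R (I →₀ ↑(Projective.over S))) := hproj _ inferInstance
      have h3 : HasProjectiveDimensionLT (ModuleCat.of R (I →₀ ↑(Projective.over S))) 1 :=
        inferInstance
      exact hSE.hasProjectiveDimensionLT_X₃ (n + 1) h1 (hasProjectiveDimensionLT_of_ge _ 1 _ (by omega))

lemma ext_pi (I : Type) (W : ModuleCat.{0} R) (n : ℕ) : ∀ (X : ModuleCat.{0} R),
    (∀ x : Ext X W n, x = 0) → ∀ x : Ext X (ModuleCat.of R (I → W)) n, x = 0 := by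
  have ev : ∀ {Y : ModuleCat.{0} R} (f g : Y ⟶ ModuleCat.of R (I → W)),
      (∀ i, f ≫ ModuleCat.ofHom (LinearMap.proj i) = g ≫ ModuleCat.ofHom (LinearMap.proj i)) →
      f = g := by
    intro Y f g h
    apply ModuleCat.hom_ext; apply LinearMap.ext; intro y; funext i
    exact congrArg (fun (q : Y ⟶ W) => q.hom y) (h i)
  induction n with
  | zero =>
    intro X hX x
    obtain ⟨f, rfl⟩ := (Ext.mk₀_bijective _ _).2 x
    have : f = 0 := by
      apply ev
      intro i
      have := hX (Ext.mk₀ (f ≫ ModuleCat.ofHom (LinearMap.proj i)))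
      rw [Limits.zero_comp]
      exact (Ext.mk₀_bijective _ _).1 (by rw [this, Ext.mk₀_zero])
    rw [this, Ext.mk₀_zero]
  | succ n ih =>
    intro X hX x
    have hT := shortExact_im (Projective.π X)
    obtain ⟨y, rfl⟩ := Ext.contravariant_sequence_exact₃ hT _ x
      (Ext.eq_zero_of_projective _) (add_comm 1 n)
    cases n with
    | zero =>
      obtain ⟨f, rfl⟩ := (Ext.mk₀_bijective _ _).2 y
      have key : ∀ i, ∃ g : Projective.over X ⟶ W, Limits.kernel.ι (Projective.π X) ≫ g =
          f ≫ ModuleCat.ofHom (LinearMap.proj i) := by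
        intro i
        obtain ⟨z, hz⟩ := Ext.contravariant_sequence_exact₁ hT _
          (Ext.mk₀ (f ≫ ModuleCat.ofHom (LinearMap.proj i))) (add_comm 1 0) (hX _)
        obtain ⟨g, rfl⟩ := (Ext.mk₀_bijective _ _).2 z
        refine ⟨g, (Ext.mk₀_bijective _ _).1 ?_⟩
        rw [← hz, Ext.mk₀_comp_mk₀]
      choose g hg using key
      let g' : Projective.over X ⟶ ModuleCat.of R (I → W) :=
        ModuleCat.ofHom (LinearMap.pi fun i => (g i).hom)
      have : f = Limits.kernel.ι (Projective.π X) ≫ g' := by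
        apply ev
        intro i
        rw [← hg i, Category.assoc]
        rfl
      rw [this, ← Ext.mk₀_comp_mk₀]
      exact ShortComplex.ShortExact.extClass_comp_assoc hT _
    | succ n =>
      rw [ih _ _ y, Ext.comp_zero]
      intro z
      obtain ⟨z', rfl⟩ := Ext.contravariant_sequence_exact₁ hT _ z (add_comm 1 (n + 1)) (hX _)
      rw [Ext.eq_zero_of_projective z', Ext.comp_zero]

end PiSum
end
end GlDim

set_option linter.unusedSectionVars false
namespace GlDim
noncomputable section

/-! ### Part 6: the setup, and the first implication -/

section Setup

variable {R Λ : Type} [Ring R] [Ring Λ] {ι : Λ →ₙ+* R}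

/-- The data used: `Λ` is the corner of `R`, and `S` is the semisimple module. -/
structure Setup (ι : Λ →ₙ+* R) (S : ModuleCat.{0} R) (s : S) : Prop where
  inj : Function.Injective ι
  surj : ∀ x : R, ι 1 * x = x → x * ι 1 = x → ∃ l, ι l = x
  gen : ∀ x : S, ∃ r : R, x = r • s
  ann : ∀ r : R, r • s = 0 ↔ r * (1 - ι 1) ∈ Ring.jacobson R
  ss : ∀ (M : Type) [AddCommGroup M] [Module R M],
    (∀ j ∈ Ring.jacobson R, ∀ m : M, j • m = 0) → IsSemisimpleModule R M
  cor : ∀ x : R, ι 1 * x * (1 - ι 1) ∈ Ring.jacobson R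

/-- Modules killed by the idempotent `ι 1`. -/
def Es (ι : Λ →ₙ+* R) (M : Type) [AddCommGroup M] [Module R M] : Prop := ∀ m : M, ι 1 • m = 0

variable {S : ModuleCat.{0} R} {s : S}

lemma Setup.jkS (hS : Setup ι S s) : JK (R := R) 1 S := by
  rw [jk_one_iff]
  intro j hj m
  obtain ⟨r, rfl⟩ := hS.gen m
  rw [smul_smul, hS.ann]
  exact (Ring.jacobson R).mul_mem_right _ ((Ring.jacobson R).mul_mem_right _ hj)

lemma Setup.esS (hS : Setup ι S s) : Es ι S := by
  intro m
  obtain ⟨r, rfl⟩ := hS.gen m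
  rw [smul_smul, hS.ann]
  exact hS.cor r

variable {Z : Type} [AddCommGroup Z] [Module R Z]

lemma Setup.exists_hom (hS : Setup ι S s) (hZ : Es ι Z) (hJ : JK (R := R) 1 Z) (z : Z) :
    ∃ f : S →ₗ[R] Z, f s = z := by
  rw [jk_one_iff] at hJ
  have hsurj : Function.Surjective (LinearMap.toSpanSingleton R S s) := by
    intro x; obtain ⟨r, rfl⟩ := hS.gen x; exact ⟨r, rfl⟩
  have hle : LinearMap.ker (LinearMap.toSpanSingleton R S s) ≤
      LinearMap.ker (LinearMap.toSpanSingleton R Z z) := by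
    intro r hr
    rw [LinearMap.mem_ker, LinearMap.toSpanSingleton_apply] at hr ⊢
    have h1 := hJ _ ((hS.ann r).1 hr) z
    rw [mul_sub, mul_one, sub_smul, mul_smul, hZ z, smul_zero, sub_zero] at h1
    exact h1
  refine ⟨((LinearMap.ker (LinearMap.toSpanSingleton R S s)).liftQ _ hle).comp
    ((LinearMap.toSpanSingleton R S s).quotKerEquivOfSurjective hsurj).symm.toLinearMap, ?_⟩
  have : ((LinearMap.toSpanSingleton R S s).quotKerEquivOfSurjective hsurj).symm s =
      Submodule.Quotient.mk 1 := by
    rw [LinearEquiv.symm_apply_eq]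
    change _ = (1 : R) • s
    rw [one_smul]
  rw [LinearMap.comp_apply, LinearEquiv.coe_coe, this, Submodule.liftQ_apply,
    LinearMap.toSpanSingleton_apply, one_smul]

lemma Setup.exists_hom' (hS : Setup ι S s) (hZ : Es ι Z) (hJ : JK (R := R) 1 Z) (z : Z) (hz : z ≠ 0) :
    ∃ f : Z →ₗ[R] S, f z ≠ 0 := by
  obtain ⟨g, hg⟩ := hS.exists_hom hZ hJ z
  have h1 := hS.ss Z (jk_one_iff.1 hJ)
  have h2 := hS.ss S (jk_one_iff.1 hS.jkS)
  obtain ⟨h, hh⟩ := IsSemisimpleModule.lifting_property g.rangeRestrict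
    g.surjective_rangeRestrict LinearMap.id
  obtain ⟨f, hf⟩ := IsSemisimpleModule.extension_property (LinearMap.range g).subtype
    (Submodule.injective_subtype _) h
  refine ⟨f, fun h0 => hz ?_⟩
  let z' : LinearMap.range g := ⟨z, ⟨s, hg⟩⟩
  have h3 : f z = h z' := LinearMap.congr_fun hf z'
  have h4 : g.rangeRestrict (h z') = z' := LinearMap.congr_fun hh z'
  rw [← h3, h0, map_zero] at h4
  exact (congrArg Subtype.val h4).symm

/-- `Z` is a retract of a power of `S`. -/
lemma Setup.retract_pi (hS : Setup ι S s) (Z : ModuleCat.{0} R) (hZ : Es ι Z) (hJ : JK (R := R) 1 Z) :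
    ∃ I : Type, Nonempty (Retract Z (ModuleCat.of R (I → S))) := by
  refine ⟨Z →ₗ[R] S, ?_⟩
  let i : Z →ₗ[R] ((Z →ₗ[R] S) → S) := LinearMap.pi fun f => f
  have hi : Function.Injective i := by
    rw [injective_iff_map_eq_zero]
    intro z hz
    by_contra h
    obtain ⟨f, hf⟩ := hS.exists_hom' hZ hJ z h
    exact hf (congrFun hz f)
  have := hS.ss ((Z →ₗ[R] S) → S) (by
    intro j hj m
    funext f
    exact jk_one_iff.1 hS.jkS j hj _)
  obtain ⟨r, hr⟩ := IsSemisimpleModule.extension_property i hi LinearMap.id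
  exact ⟨⟨ModuleCat.ofHom i, ModuleCat.ofHom r, by ext x; exact LinearMap.congr_fun hr x⟩⟩

/-- `Z` is a retract of a direct sum of copies of `S`. -/
lemma Setup.retract_finsupp (hS : Setup ι S s) (Z : ModuleCat.{0} R) (hZ : Es ι Z) (hJ : JK (R := R) 1 Z) :
    Nonempty (Retract Z (ModuleCat.of R (Z →₀ S))) := by
  classical
  choose f hf using fun z : Z => hS.exists_hom hZ hJ z
  let p : (Z →₀ S) →ₗ[R] Z := Finsupp.lsum ℕ f
  have hp : Function.Surjective p := by
    intro z
    exact ⟨Finsupp.single z s, by simp [p, hf]⟩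
  have := hS.ss S (jk_one_iff.1 hS.jkS)
  obtain ⟨r, hr⟩ := IsSemisimpleModule.lifting_property p hp LinearMap.id
  exact ⟨⟨ModuleCat.ofHom r, ModuleCat.ofHom p, by ext x; exact LinearMap.congr_fun hr x⟩⟩

/-- A finitely generated `Z` is a retract of a finite power of `S`. -/
lemma Setup.retract_fin (hS : Setup ι S s) (Z : ModuleCat.{0} R) (hZ : Es ι Z) (hJ : JK (R := R) 1 Z)
    [Module.Finite R Z] :
    ∃ n : ℕ, Nonempty (Retract Z (ModuleCat.of R (Fin n → S))) := by
  classical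
  obtain ⟨n, z, hz⟩ := Module.Finite.exists_fin (R := R) (M := Z)
  choose f hf using fun z : Z => hS.exists_hom hZ hJ z
  let p : (Fin n → S) →ₗ[R] Z := LinearMap.lsum R (fun _ => S) ℕ (fun i => f (z i))
  have hp : Function.Surjective p := by
    rw [← LinearMap.range_eq_top, eq_top_iff, ← hz, Submodule.span_le]
    rintro _ ⟨i, rfl⟩
    exact ⟨Pi.single i s, by simp [p, hf, LinearMap.lsum_apply, LinearMap.sum_apply, Pi.single_apply,
      apply_ite]⟩
  have := hS.ss (Fin n → S) (by
    intro j hj m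
    funext f
    exact jk_one_iff.1 hS.jkS j hj _)
  obtain ⟨r, hr⟩ := IsSemisimpleModule.lifting_property p hp LinearMap.id
  exact ⟨n, ⟨⟨ModuleCat.ofHom r, ModuleCat.ofHom p, by ext x; exact LinearMap.congr_fun hr x⟩⟩⟩

end Setup

section Back

variable {R Λ : Type} [Ring R] [Ring Λ] {ι : Λ →ₙ+* R}

/-- Induction along the radical filtration. -/
lemma es_induction (P : ModuleCat.{0} R → Prop)
    (h1 : ∀ Z : ModuleCat.{0} R, Es ι Z → JK (R := R) 1 Z → P Z)
    (hext : ∀ T : ShortComplex (ModuleCat.{0} R), T.ShortExact → P T.X₁ → P T.X₃ → P T.X₂)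
    (k : ℕ) : ∀ Z : ModuleCat.{0} R, Es ι Z → JK (R := R) k Z → P Z := by
  induction k with
  | zero => exact fun Z hZ hJ => h1 Z hZ (hJ.mono (by omega))
  | succ k ih =>
    intro Z hZ hJ
    let N : Submodule R Z := Ring.jacobson R • ⊤
    have hT := shortExact_of (ModuleCat.ofHom N.subtype) (ModuleCat.ofHom N.mkQ)
      (Submodule.injective_subtype _) (Submodule.mkQ_surjective _)
      (fun x => (Submodule.Quotient.mk_eq_zero _).2 x.2)
      (fun x hx => ⟨⟨x, (Submodule.Quotient.mk_eq_zero _).1 hx⟩, rfl⟩)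
    refine hext _ hT (ih _ (fun x => Subtype.ext (hZ x.1)) ?_) (h1 _ ?_ ?_)
    · have : (Jit k (⊤ : Submodule R N)).map N.subtype = ⊥ := by
        rw [jit_map, Submodule.map_top, Submodule.range_subtype]
        have : N = Jit 1 ⊤ := rfl
        rw [this, ← jit_add]
        exact hJ
      exact Submodule.map_injective_of_injective (Submodule.injective_subtype N)
        (this.trans (Submodule.map_bot _).symm)
    · intro x
      obtain ⟨y, rfl⟩ := Submodule.mkQ_surjective N x
      change ι 1 • N.mkQ y = 0
      rw [← map_smul, hZ y, map_zero]
    · rw [jk_one_iff]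
      intro j hj x
      obtain ⟨y, rfl⟩ := Submodule.mkQ_surjective N x
      change j • N.mkQ y = 0
      rw [← map_smul]
      exact (Submodule.Quotient.mk_eq_zero _).2 (Submodule.smul_mem_smul hj trivial)

variable {S : ModuleCat.{0} R} {s : S}

theorem back (hS : Setup ι S s) (k : ℕ) (hk : ∀ Z : ModuleCat.{0} R, Es ι Z → JK (R := R) k Z) (N0 : ℕ)
    (hN : EV S S N0) (d : ℕ)
    (hΛ : ∀ (M N : ModuleCat.{0} Λ) (i : ℕ), d < i → Subsingleton (Ext M N i)) :
    ∃ n, ∀ M : ModuleCat.{0} R, HasProjectiveDimensionLT M n := by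
  have hEV : ∀ Z : ModuleCat.{0} R, Limits.IsZero ((F ι).obj Z) → EV S Z N0 := by
    intro Z hZ
    have hZ' := (isZero_F_iff ι Z).1 hZ
    refine es_induction (ι := ι) (fun Z => EV S Z N0) ?_ ?_ k Z hZ' (hk Z hZ')
    · intro Z hZ hJ
      obtain ⟨I, ⟨r⟩⟩ := hS.retract_pi Z hZ hJ
      exact EV.of_retract r fun i hi => ext_pi I S i S (hN i hi)
    · intro T hT h1 h3
      exact EV.X₂ hT h1 h3
  have hc : ∀ I, IsIso ((adj ι).counit.app I) := isIso_counit ι hS.inj hS.surj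
  have hu : ∀ I, IsIso ((adjL ι).unit.app I) := isIso_unit_L ι hS.inj hS.surj
  have hpdΛ : ∀ M : ModuleCat.{0} Λ, HasProjectiveDimensionLT M (d + 1) := fun M =>
    hasProjectiveDimensionLT_of_enoughInjectives M (d + 1) (fun Y => hΛ M Y _ (by omega))
  have hidΛ : ∀ M : ModuleCat.{0} Λ, HasInjectiveDimensionLT M (d + 1) := fun M =>
    hasInjectiveDimensionLT_of_enoughProjectives M (d + 1) (fun Y => hΛ Y M _ (by omega))
  obtain ⟨n0, hn0⟩ := exists_EV (adj ι) S N0 hEV d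
  have hpdS : HasProjectiveDimensionLT S n0 :=
    hasProjectiveDimensionLT_of_enoughInjectives S n0 (fun Y =>
      ⟨fun a b => by rw [hn0 Y (hidΛ _) n0 le_rfl a, hn0 Y (hidΛ _) n0 le_rfl b]⟩)
  have hpdE : ∀ Z : ModuleCat.{0} R, Limits.IsZero ((F ι).obj Z) → HasProjectiveDimensionLT Z n0 := by
    intro Z hZ
    have hZ' := (isZero_F_iff ι Z).1 hZ
    refine es_induction (ι := ι) (fun Z => HasProjectiveDimensionLT Z n0) ?_ ?_ k Z hZ' (hk Z hZ')
    · intro Z hZ hJ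
      obtain ⟨r⟩ := hS.retract_finsupp Z hZ hJ
      have := pd_finsupp Z n0 S hpdS
      exact r.hasProjectiveDimensionLT n0
    · intro T hT h1 h3
      exact hT.hasProjectiveDimensionLT_X₂ n0 h1 h3
  obtain ⟨n, hn⟩ := exists_pd (adjL ι) n0 hpdE d
  exact ⟨n, fun M => hn M (hpdΛ _)⟩

end Back
end
end GlDim

set_option linter.unusedSectionVars false
namespace GlDim
noncomputable section

/-! ### Part 7: the graded module of shifted morphisms -/

section GradedHom

universe v u

variable {T : Type u} [Category.{v} T] [Limits.HasZeroObject T] [HasShift T ℤ] [Preadditive T]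
  [∀ n : ℤ, (shiftFunctor T n).Additive]

/-- An identification of a graded ring with the graded endomorphism ring of `S`. -/
structure GData (S : T) (Yg : ℕ → Type v) [∀ i, AddCommGroup (Yg i)] [DirectSum.GRing Yg] where
  φ : ∀ i, Yg i ≃+ (S ⟶ S⟦(i : ℤ)⟧)
  one : φ 0 GradedMonoid.GOne.one = ShiftedHom.mk₀ _ Nat.cast_zero (𝟙 S)
  mul : ∀ (i j : ℕ) (a : Yg i) (b : Yg j), φ (i + j) (GradedMonoid.GMul.mul a b) =
    ShiftedHom.comp (φ i a) (φ j b) (by push_cast; ring)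
  neg : ∀ n : ℤ, n < 0 → ∀ f : S ⟶ S⟦n⟧, f = 0

variable {S : T} {Yg : ℕ → Type v} [∀ i, AddCommGroup (Yg i)] [DirectSum.GRing Yg]
  (D : GData S Yg)

/-- The graded module of shifted morphisms to `S`. -/
def HM (D : GData S Yg) (M : T) : Type v := ⨁ n : ℤ, (M ⟶ S⟦n⟧)

instance (M : T) : AddCommGroup (HM D M) := inferInstanceAs (AddCommGroup (⨁ n : ℤ, (M ⟶ S⟦n⟧)))

variable {M N : T}

/-- The homogeneous elements. -/
def hof (n : ℤ) : (M ⟶ S⟦n⟧) →+ HM D M := DirectSum.of (fun n : ℤ => (M ⟶ S⟦n⟧)) n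

/-- The components. -/
def hcomp (x : HM D M) (n : ℤ) : M ⟶ S⟦n⟧ := DFinsupp.toFun x n

lemma hof_induction {p : HM D M → Prop} (x : HM D M) (h0 : p 0) (hof : ∀ n z, p (hof D n z))
    (hadd : ∀ x y, p x → p y → p (x + y)) : p x :=
  DirectSum.induction_on x h0 hof hadd

lemma hcomp_add (x y : HM D M) (n : ℤ) : hcomp D (x + y) n = hcomp D x n + hcomp D y n := rfl
lemma hcomp_zero (n : ℤ) : hcomp D (0 : HM D M) n = 0 := rfl
lemma hcomp_hof_same (n : ℤ) (z : M ⟶ S⟦n⟧) : hcomp D (hof D n z) n = z :=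
  DirectSum.of_eq_same _ _
lemma hcomp_hof_ne (n m : ℤ) (h : n ≠ m) (z : M ⟶ S⟦n⟧) : hcomp D (hof D n z) m = 0 :=
  DirectSum.of_eq_of_ne _ _ _ h.symm
lemma hcomp_ext {x y : HM D M} (h : ∀ n, hcomp D x n = hcomp D y n) : x = y :=
  DFinsupp.ext h

lemma hof_congr {a b c c' : ℤ} (f : ShiftedHom M S a) (g : ShiftedHom S S b) (h : b + a = c)
    (h' : b + a = c') : hof D c (f.comp g h) = hof D c' (f.comp g h') := by
  subst h; subst h'; rfl

/-- The homogeneous parts of the action. -/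
def act₀ (M : T) (n : ℤ) (i : ℕ) : (M ⟶ S⟦n⟧) →+ Yg i →+ HM D M :=
  AddMonoidHom.mk' (fun z => AddMonoidHom.mk' (fun y =>
    hof D (i + n) (ShiftedHom.comp z (D.φ i y) rfl)) (fun a b => by
      rw [map_add, ShiftedHom.comp_add, map_add])) (fun a b => by
      ext y
      exact (congrArg (hof D (i + n)) (ShiftedHom.add_comp a b (D.φ i y) rfl)).trans (map_add _ _ _))

/-- The action. -/
def act (M : T) : HM D M →+ (⨁ i, Yg i) →+ HM D M :=
  DirectSum.toAddMonoid fun n => AddMonoidHom.flip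
    (DirectSum.toAddMonoid fun i => (act₀ D M n i).flip)

lemma act_of (n c : ℤ) (i : ℕ) (z : M ⟶ S⟦n⟧) (y : Yg i) (h : i + n = c) :
    act D M (hof D n z) (DirectSum.of Yg i y) = hof D c (ShiftedHom.comp z (D.φ i y) h) := by
  subst h
  change (DirectSum.toAddMonoid (fun n => AddMonoidHom.flip
    (DirectSum.toAddMonoid fun i => (act₀ D M n i).flip))
      (DirectSum.of (fun n : ℤ => (M ⟶ S⟦n⟧)) n z)) _ = _
  rw [DirectSum.toAddMonoid_of, AddMonoidHom.flip_apply, DirectSum.toAddMonoid_of]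
  rfl

lemma act_one (z : HM D M) : act D M z 1 = z := by
  induction z using hof_induction with
  | h0 => rw [map_zero, AddMonoidHom.zero_apply]
  | hof n z =>
    have : (1 : ⨁ i, Yg i) = DirectSum.of Yg 0 GradedMonoid.GOne.one := rfl
    rw [this, act_of D n n 0 z _ (by simp), D.one]
    congr 1
    exact ShiftedHom.comp_mk₀_id _ _ _
  | hadd x y hx hy => rw [map_add, AddMonoidHom.add_apply, hx, hy]

lemma act_mul (z : HM D M) (a b : ⨁ i, Yg i) :
    act D M z (a * b) = act D M (act D M z a) b := by
  induction z using hof_induction with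
  | h0 => simp only [map_zero, AddMonoidHom.zero_apply]
  | hadd x y hx hy => simp only [map_add, AddMonoidHom.add_apply, hx, hy]
  | hof n z =>
    induction a using DirectSum.induction_on with
    | zero => simp only [map_zero, AddMonoidHom.zero_apply, zero_mul]
    | add x y hx hy => simp only [map_add, AddMonoidHom.add_apply, hx, hy, add_mul]
    | of i a =>
      induction b using DirectSum.induction_on with
      | zero => simp only [map_zero, AddMonoidHom.zero_apply, mul_zero]
      | add x y hx hy => simp only [map_add, AddMonoidHom.add_apply, hx, hy, mul_add]
      | of j b =>
        rw [DirectSum.of_mul_of, act_of D n _ i z a rfl, act_of D _ (j + (i + n)) j _ b rfl,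
          act_of D n (j + (i + n)) (i + j) z _ (by push_cast; ring), D.mul]
        congr 1
        exact (ShiftedHom.comp_assoc z (D.φ i a) (D.φ j b) rfl (by push_cast; ring) (by ring)).symm

instance (M : T) : Module (⨁ i, Yg i)ᵐᵒᵖ (HM D M) where
  smul y z := act D M z y.unop
  one_smul z := act_one D z
  mul_smul a b z := act_mul D z _ _
  smul_zero y := by
    change act D M 0 _ = 0
    rw [map_zero, AddMonoidHom.zero_apply]
  smul_add y a b := by
    change act D M (a + b) _ = act D M a _ + act D M b _
    rw [map_add, AddMonoidHom.add_apply]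
  add_smul a b z := map_add (act D M z) _ _
  zero_smul z := map_zero (act D M z)

lemma smul_hof (n c : ℤ) (i : ℕ) (z : M ⟶ S⟦n⟧) (y : Yg i) (h : i + n = c) :
    MulOpposite.op (DirectSum.of Yg i y) • hof D n z = hof D c (ShiftedHom.comp z (D.φ i y) h) :=
  act_of D n c i z y h

lemma op_smul_induction {p : (⨁ i, Yg i)ᵐᵒᵖ → Prop} (y : (⨁ i, Yg i)ᵐᵒᵖ) (h0 : p 0)
    (hof : ∀ i y, p (MulOpposite.op (DirectSum.of Yg i y)))
    (hadd : ∀ x y, p x → p y → p (x + y)) : p y := by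
  obtain ⟨y, rfl⟩ := MulOpposite.op_surjective y
  induction y using DirectSum.induction_on with
  | zero => exact h0
  | of i y => exact hof i y
  | add x y hx hy => exact hadd _ _ hx hy

/-- Functoriality (additive version). -/
def hmapAdd (f : M ⟶ N) : HM D N →+ HM D M :=
  DirectSum.toAddMonoid fun n => (hof D n).comp (Preadditive.leftComp (S⟦n⟧) f)

lemma hmapAdd_hof (f : M ⟶ N) (n : ℤ) (z : N ⟶ S⟦n⟧) :
    hmapAdd D f (hof D n z) = hof D n (f ≫ z) := by
  change DirectSum.toAddMonoid (fun n => (hof D n).comp (Preadditive.leftComp (S⟦n⟧) f))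
    (DirectSum.of (fun n : ℤ => (N ⟶ S⟦n⟧)) n z) = _
  rw [DirectSum.toAddMonoid_of]; rfl

lemma comp_precomp (f : M ⟶ N) {a b c : ℤ} (z : N ⟶ S⟦a⟧) (y : S ⟶ S⟦b⟧) (h : b + a = c) :
    ShiftedHom.comp (f ≫ z) y h = f ≫ ShiftedHom.comp z y h :=
  Category.assoc _ _ _

/-- Functoriality. -/
def hmap (f : M ⟶ N) : HM D N →ₗ[(⨁ i, Yg i)ᵐᵒᵖ] HM D M where
  __ := hmapAdd D f
  map_smul' := by
    intro y z
    change hmapAdd D f (y • z) = y • hmapAdd D f z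
    induction y using op_smul_induction with
    | h0 => rw [zero_smul, zero_smul, map_zero]
    | hadd x y hx hy => rw [add_smul, add_smul, map_add, hx, hy]
    | hof i y =>
      induction z using hof_induction with
      | h0 => rw [smul_zero, map_zero, smul_zero]
      | hadd x y hx hy => rw [smul_add, map_add, map_add, smul_add, hx, hy]
      | hof n z =>
        rw [smul_hof D n _ i z y rfl, hmapAdd_hof, hmapAdd_hof, smul_hof D n _ i _ y rfl,
          comp_precomp]

lemma hmap_hof (f : M ⟶ N) (n : ℤ) (z : N ⟶ S⟦n⟧) :
    hmap D f (hof D n z) = hof D n (f ≫ z) := hmapAdd_hof D f n z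

lemma hmap_comp {P : T} (f : M ⟶ N) (g : N ⟶ P) (x : HM D P) :
    hmap D (f ≫ g) x = hmap D f (hmap D g x) := by
  induction x using hof_induction with
  | h0 => simp only [map_zero]
  | hadd x y hx hy => simp only [map_add, hx, hy]
  | hof n z => rw [hmap_hof, hmap_hof, hmap_hof, Category.assoc]

lemma hcomp_hmap (f : M ⟶ N) (x : HM D N) (n : ℤ) : hcomp D (hmap D f x) n = f ≫ hcomp D x n := by
  induction x using hof_induction with
  | h0 => rw [map_zero, hcomp_zero, hcomp_zero, Limits.comp_zero]
  | hadd x y hx hy => rw [map_add, hcomp_add, hcomp_add, hx, hy, Preadditive.comp_add]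
  | hof m z =>
    rw [hmap_hof]
    by_cases h : m = n
    · subst h; rw [hcomp_hof_same, hcomp_hof_same]
    · rw [hcomp_hof_ne _ _ _ h, hcomp_hof_ne _ _ _ h, Limits.comp_zero]

lemma hcomp_smul (n c : ℤ) (i : ℕ) (h : i + n = c) (x : HM D M) (y : Yg i) :
    hcomp D (MulOpposite.op (DirectSum.of Yg i y) • x) c =
      ShiftedHom.comp (hcomp D x n) (D.φ i y) h := by
  induction x using hof_induction with
  | h0 => rw [smul_zero, hcomp_zero, hcomp_zero, ShiftedHom.zero_comp]
  | hadd x y hx hy => rw [smul_add, hcomp_add, hcomp_add, hx, hy, ShiftedHom.add_comp]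
  | hof m z =>
    rw [smul_hof D m _ i z y rfl]
    by_cases hm : m = n
    · subst hm; subst h; rw [hcomp_hof_same, hcomp_hof_same]
    · rw [hcomp_hof_ne _ _ _ hm, hcomp_hof_ne _ _ _ (by omega), ShiftedHom.zero_comp]

/-- every morphism between shifts is a shift of a morphism -/
lemma exists_shift {X Y : T} (a m n : ℤ) (h : a + m = n) (f : X⟦m⟧ ⟶ Y⟦n⟧) :
    ∃ g : X ⟶ Y⟦a⟧, f = ShiftedHom.comp (𝟙 (X⟦m⟧)) g h := by
  obtain ⟨g, hg⟩ := (shiftFunctor T m).map_surjective (f ≫ (shiftFunctorAdd' T a m n h).hom.app Y)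
  refine ⟨g, ?_⟩
  rw [ShiftedHom.comp, hg]
  simp

lemma shift_inj {X Y : T} (a m n : ℤ) (h : a + m = n) (g : X ⟶ Y⟦a⟧)
    (h0 : ShiftedHom.comp (𝟙 (X⟦m⟧)) g h = 0) : g = 0 := by
  rw [ShiftedHom.comp, Category.id_comp] at h0
  apply (shiftFunctor T m).map_injective
  rw [Functor.map_zero, ← cancel_mono ((shiftFunctorAdd' T a m n h).inv.app Y), h0,
    Limits.zero_comp]

lemma exists_factor (m n : ℤ) (f : S⟦m⟧ ⟶ S⟦n⟧) :
    f = 0 ∨ ∃ (i : ℕ) (h : i + m = n) (y : Yg i), f = ShiftedHom.comp (𝟙 (S⟦m⟧)) (D.φ i y) h := by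
  obtain ⟨g, hg⟩ := exists_shift (n - m) m n (by ring) f
  by_cases hnm : n - m < 0
  · left
    rw [hg, D.neg _ hnm g, ShiftedHom.comp_zero]
  · right
    obtain ⟨i, hi⟩ := Int.eq_ofNat_of_zero_le (not_lt.1 hnm)
    obtain rfl : n = i + m := by omega
    obtain ⟨g', hg'⟩ := exists_shift (i : ℤ) m _ rfl f
    exact ⟨i, rfl, (D.φ i).symm g', by rw [AddEquiv.apply_symm_apply, ← hg']⟩

end GradedHom
end
end GlDim

set_option linter.unusedSectionVars false
namespace GlDim
noncomputable section

/-! ### Part 8: the tower -/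

section Tower

universe v u

lemma shortExact_univ {R : Type v} [Ring R] {M N P : ModuleCat.{v} R} (f : M ⟶ N) (g : N ⟶ P)
    (hf : Function.Injective f) (hg : Function.Surjective g) (hfg : ∀ x, g (f x) = 0)
    (hex : ∀ x, g x = 0 → ∃ y, f y = x) :
    (ShortComplex.mk f g (by ext x; exact hfg x)).ShortExact where
  exact := (ShortComplex.moduleCat_exact_iff _).2 hex
  mono_f := (ModuleCat.mono_iff_injective _).2 hf
  epi_g := (ModuleCat.epi_iff_surjective _).2 hg

variable {T : Type u} [Category.{v} T] [Limits.HasZeroObject T] [HasShift T ℤ] [Preadditive T]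
  [∀ n : ℤ, (shiftFunctor T n).Additive] [Pretriangulated T] [IsTriangulated T]

/-- The conclusion of the tower construction. -/
def Good (Q 𝒟 : ObjectProperty T) (S M : T) : Prop :=
  ∃ (E K : T) (_ : Retract M E) (f : K ⟶ E), Q.trW f ∧ 𝒟 K ∧ ∀ (n : ℤ) (k : K ⟶ S⟦n⟧), k = 0

variable {S : T} {Yg : ℕ → Type v} [∀ i, AddCommGroup (Yg i)] [DirectSum.GRing Yg]
  (D : GData S Yg)

variable {M F : T}

/-- Surjectivity on shifted morphisms. -/
def HSurj (S : T) (t : M ⟶ F) : Prop := ∀ (n : ℤ) (z : M ⟶ S⟦n⟧), ∃ x : F ⟶ S⟦n⟧, t ≫ x = z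

lemma HSurj.shift {t : M ⟶ F} (ht : HSurj S t) (n : ℤ) (g : M⟦(1 : ℤ)⟧ ⟶ S⟦n⟧) :
    ∃ x : F⟦(1 : ℤ)⟧ ⟶ S⟦n⟧, t⟦(1 : ℤ)⟧' ≫ x = g := by
  obtain ⟨g', rfl⟩ := exists_shift (n - 1) 1 n (by ring) g
  obtain ⟨x, rfl⟩ := ht _ g'
  refine ⟨ShiftedHom.comp (𝟙 _) x (by ring), ?_⟩
  simp only [ShiftedHom.comp, Category.id_comp, Functor.map_comp, Category.assoc]

lemma HSurj.cone_zero {C : T} {t : M ⟶ F} {w : F ⟶ C} {δ : C ⟶ M⟦(1 : ℤ)⟧}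
    (hT : Pretriangulated.Triangle.mk t w δ ∈ Pretriangulated.distinguishedTriangles)
    (ht : HSurj S t) {n : ℤ} (g : C ⟶ S⟦n⟧) (hg : w ≫ g = 0) : g = 0 := by
  obtain ⟨g', hg'⟩ := Pretriangulated.Triangle.yoneda_exact₃ _ hT g hg
  obtain ⟨x, rfl⟩ := ht.shift n g'
  have h : δ ≫ t⟦(1 : ℤ)⟧' = 0 := Pretriangulated.comp_distTriang_mor_zero₃₁ _ hT
  replace hg' : g = δ ≫ t⟦(1 : ℤ)⟧' ≫ x := hg'
  rw [hg', reassoc_of% h, Limits.zero_comp]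

section Free

variable {r : ℕ} (m : Fin r → ℤ)

/-- The finite sum of shifts of `S`. -/
abbrev Fb (S : T) {r : ℕ} (m : Fin r → ℤ) : T := Limits.biproduct (fun i => S⟦m i⟧)

/-- The projections. -/
abbrev pr (S : T) {r : ℕ} (m : Fin r → ℤ) (i : Fin r) : Fb S m ⟶ S⟦m i⟧ :=
  Limits.biproduct.π (fun i => S⟦m i⟧) i

lemma hcomp_smul_id (n : ℤ) (i : ℕ) (y : (⨁ i, Yg i)ᵐᵒᵖ) :
    hcomp D (y • hof D n (𝟙 (S⟦n⟧))) (i + n) =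
      ShiftedHom.comp (𝟙 (S⟦n⟧)) (D.φ i (y.unop i)) rfl := by
  induction y using op_smul_induction with
  | h0 =>
    rw [zero_smul, hcomp_zero]
    change _ = ShiftedHom.comp (𝟙 (S⟦n⟧)) (D.φ i 0) rfl
    rw [map_zero, ShiftedHom.comp_zero]
  | hadd x y hx hy =>
    rw [add_smul, hcomp_add, hx, hy, ← ShiftedHom.comp_add, ← map_add]
    rfl
  | hof j y =>
    rw [smul_hof D n _ j _ y rfl, MulOpposite.unop_op]
    by_cases h : j = i
    · subst h; rw [hcomp_hof_same, DirectSum.of_eq_same]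
    · rw [hcomp_hof_ne _ _ _ (by omega), DirectSum.of_eq_of_ne _ _ _ (Ne.symm h), map_zero,
        ShiftedHom.comp_zero]

lemma free_inj (n : ℤ) (y : (⨁ i, Yg i)ᵐᵒᵖ) (h : y • hof D n (𝟙 (S⟦n⟧)) = 0) : y = 0 := by
  apply MulOpposite.unop_injective
  apply DFinsupp.ext
  intro i
  have h1 := hcomp_smul_id D n i y
  rw [h, hcomp_zero] at h1
  have h2 := shift_inj (i : ℤ) n _ rfl _ h1.symm
  exact (D.φ i).map_eq_zero_iff.1 h2

lemma pr_comp {n : ℤ} {i : Fin r} {j : ℕ} (h : j + m i = n) (y : Yg j) :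
    pr S m i ≫ ShiftedHom.comp (𝟙 (S⟦m i⟧)) (D.φ j y) h = ShiftedHom.comp (pr S m i) (D.φ j y) h := by
  rw [← comp_precomp, Category.comp_id]

/-- An induction principle for morphisms out of the sum. -/
lemma fb_induction {n : ℤ} (p : (Fb S m ⟶ S⟦n⟧) → Prop) (h0 : p 0)
    (hadd : ∀ x y, p x → p y → p (x + y))
    (hof : ∀ (i : Fin r) (j : ℕ) (h : j + m i = n) (y : Yg j),
      p (ShiftedHom.comp (pr S m i) (D.φ j y) h)) (x : Fb S m ⟶ S⟦n⟧) : p x := by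
  have hx : x = ∑ i, pr S m i ≫ Limits.biproduct.ι (fun i => S⟦m i⟧) i ≫ x := by
    have := Limits.biproduct.total (f := fun i => S⟦m i⟧)
    calc x = (∑ j, Limits.biproduct.π (fun i => S⟦m i⟧) j ≫
          Limits.biproduct.ι (fun i => S⟦m i⟧) j) ≫ x := by rw [this, Category.id_comp]
      _ = _ := by rw [Preadditive.sum_comp]; simp only [Category.assoc]
  rw [hx]
  refine Finset.sum_induction _ p hadd h0 fun i _ => ?_
  obtain h | ⟨j, h, y, hy⟩ := exists_factor D (m i) n (Limits.biproduct.ι (fun i => S⟦m i⟧) i ≫ x)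
  · rw [h, Limits.comp_zero]; exact h0
  · rw [hy, pr_comp]; exact hof i j h y

/-- The comparison with the free module. -/
def psi : (Fin r → (⨁ i, Yg i)ᵐᵒᵖ) →ₗ[(⨁ i, Yg i)ᵐᵒᵖ] HM D (Fb S m) :=
  Fintype.linearCombination _ (fun i => hof D (m i) (pr S m i))

lemma psi_bij : Function.Bijective (psi D m) := by
  constructor
  · rw [injective_iff_map_eq_zero]
    intro y hy
    funext j
    have h1 := congrArg (hmap D (Limits.biproduct.ι (fun i => S⟦m i⟧) j)) hy
    rw [psi, Fintype.linearCombination_apply, map_sum, map_zero, Finset.sum_eq_single j] at h1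
    · rw [map_smul, hmap_hof, Limits.biproduct.ι_π_self] at h1
      exact free_inj D _ _ h1
    · intro i _ hij
      rw [map_smul, hmap_hof, Limits.biproduct.ι_π_ne _ hij.symm, map_zero, smul_zero]
    · intro h; exact absurd (Finset.mem_univ _) h
  · rw [← LinearMap.range_eq_top, eq_top_iff]
    intro x _
    induction x using hof_induction with
    | h0 => exact Submodule.zero_mem _
    | hadd x y hx hy => exact Submodule.add_mem _ (hx trivial) (hy trivial)
    | hof n x =>
      refine fb_induction D m (fun x => hof D n x ∈ LinearMap.range (psi D m)) ?_ ?_ ?_ x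
      · rw [map_zero]; exact Submodule.zero_mem _
      · intro x y hx hy; rw [map_add]; exact Submodule.add_mem _ hx hy
      · intro i j h y
        rw [← smul_hof]
        refine Submodule.smul_mem _ _ ⟨Pi.single i 1, ?_⟩
        rw [psi, Fintype.linearCombination_apply_single, one_smul]

instance : Module.Projective (⨁ i, Yg i)ᵐᵒᵖ (HM D (Fb S m)) :=
  Module.Projective.of_equiv (LinearEquiv.ofBijective _ (psi_bij D m))

instance : Module.Finite (⨁ i, Yg i)ᵐᵒᵖ (HM D (Fb S m)) :=
  Module.Finite.of_surjective _ (psi_bij D m).2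

end Free

lemma exists_gens [Module.Finite (⨁ i, Yg i)ᵐᵒᵖ (HM D M)] :
    ∃ (r : ℕ) (m : Fin r → ℤ) (z : ∀ i, M ⟶ S⟦m i⟧),
      Submodule.span (⨁ i, Yg i)ᵐᵒᵖ (Set.range fun i => hof D (m i) (z i)) = ⊤ := by
  classical
  obtain ⟨G, hG⟩ := Module.Finite.fg_top (R := (⨁ i, Yg i)ᵐᵒᵖ) (M := HM D M)
  -- homogeneous elements
  have key : ∀ g : HM D M, ∃ B : Finset (Σ n : ℤ, (M ⟶ S⟦n⟧)),
      g ∈ Submodule.span (⨁ i, Yg i)ᵐᵒᵖ ((fun p : Σ n : ℤ, (M ⟶ S⟦n⟧) => hof D p.1 p.2) '' B) := by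
    intro g
    induction g using hof_induction with
    | h0 => exact ⟨∅, Submodule.zero_mem _⟩
    | hof n z => exact ⟨{⟨n, z⟩}, Submodule.subset_span ⟨⟨n, z⟩, by simp, rfl⟩⟩
    | hadd x y hx hy =>
      obtain ⟨B, hB⟩ := hx
      obtain ⟨B', hB'⟩ := hy
      refine ⟨B ∪ B', Submodule.add_mem _ ?_ ?_⟩
      · refine Submodule.span_mono (Set.image_mono ?_) hB
        rw [Finset.coe_union]; exact Set.subset_union_left
      · refine Submodule.span_mono (Set.image_mono ?_) hB'
        rw [Finset.coe_union]; exact Set.subset_union_right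
  choose B hB using key
  let B' := G.biUnion B
  let e := B'.equivFin.symm
  refine ⟨B'.card, fun i => (e i).1.1, fun i => (e i).1.2, ?_⟩
  rw [eq_top_iff, ← hG, Submodule.span_le]
  intro g hg
  refine Submodule.span_mono ?_ (hB g)
  rintro _ ⟨p, hp, rfl⟩
  have hp' : p ∈ B' := Finset.mem_biUnion.2 ⟨g, hg, hp⟩
  refine ⟨e.symm ⟨p, hp'⟩, ?_⟩
  have h3 : e (e.symm ⟨p, hp'⟩) = ⟨p, hp'⟩ := e.apply_symm_apply _
  exact congrArg (fun q : B' => hof D q.1.1 q.1.2) h3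

section Step

variable {r : ℕ} {m : Fin r → ℤ} (z : ∀ i, M ⟶ S⟦m i⟧)
  (hz : Submodule.span (⨁ i, Yg i)ᵐᵒᵖ (Set.range fun i => hof D (m i) (z i)) = ⊤)

lemma hmap_t_surj (hz : Submodule.span (⨁ i, Yg i)ᵐᵒᵖ (Set.range fun i => hof D (m i) (z i)) = ⊤) :
    Function.Surjective (hmap D (Limits.biproduct.lift z : M ⟶ Fb S m)) := by
  rw [← LinearMap.range_eq_top, eq_top_iff, ← hz, Submodule.span_le]
  rintro _ ⟨i, rfl⟩
  exact ⟨hof D (m i) (pr S m i), by rw [hmap_hof, Limits.biproduct.lift_π]⟩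

lemma hsurj_t (hz : Submodule.span (⨁ i, Yg i)ᵐᵒᵖ (Set.range fun i => hof D (m i) (z i)) = ⊤) :
    HSurj S (Limits.biproduct.lift z : M ⟶ Fb S m) := by
  intro n x
  obtain ⟨X, hX⟩ := hmap_t_surj D z hz (hof D n x)
  refine ⟨hcomp D X n, ?_⟩
  rw [← hcomp_hmap, hX, hcomp_hof_same]

lemma hSE {C : T} {t : M ⟶ F} {w : F ⟶ C} {δ : C ⟶ M⟦(1 : ℤ)⟧}
    (hT : Pretriangulated.Triangle.mk t w δ ∈ Pretriangulated.distinguishedTriangles)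
    (ht : HSurj S t) :
    Function.Injective (hmap D w) ∧ (∀ x, hmap D t (hmap D w x) = 0) ∧
      (∀ x, hmap D t x = 0 → ∃ y, hmap D w y = x) := by
  have h12 : t ≫ w = 0 := Pretriangulated.comp_distTriang_mor_zero₁₂ _ hT
  refine ⟨?_, ?_, ?_⟩
  · rw [injective_iff_map_eq_zero]
    intro x hx
    apply hcomp_ext
    intro n
    rw [hcomp_zero]
    apply ht.cone_zero hT
    rw [← hcomp_hmap, hx, hcomp_zero]
  · intro x
    apply hcomp_ext
    intro n
    rw [hcomp_hmap, hcomp_hmap, reassoc_of% h12, Limits.zero_comp, hcomp_zero]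
  · intro x hx
    have h1 : ∀ n, ∃ g : C ⟶ S⟦n⟧, hcomp D x n = w ≫ g := by
      intro n
      apply Pretriangulated.Triangle.yoneda_exact₂ _ hT
      change t ≫ hcomp D x n = 0
      rw [← hcomp_hmap, hx, hcomp_zero]
    choose g hg using h1
    classical
    have h2 : ∀ s : Finset ℤ, (∀ n, n ∉ s → hcomp D x n = 0) →
        hmap D w (∑ n ∈ s, hof D n (g n)) = x := by
      intro s hs
      rw [map_sum]
      apply hcomp_ext
      intro k
      simp only [hmap_hof, ← hg]
      have h3 : ∀ s : Finset ℤ, hcomp D (∑ n ∈ s, hof D n (hcomp D x n)) k =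
          if k ∈ s then hcomp D x k else 0 := by
        intro s
        induction s using Finset.induction_on with
        | empty => rw [Finset.sum_empty, hcomp_zero]; simp
        | insert a s ha ih =>
          rw [Finset.sum_insert ha, hcomp_add, ih]
          by_cases hk : a = k
          · subst hk; rw [hcomp_hof_same]; simp [ha]
          · rw [hcomp_hof_ne _ _ _ hk, zero_add]
            simp [Ne.symm hk]
      rw [h3]
      split_ifs with h
      · rfl
      · exact (hs k h).symm
    refine ⟨_, h2 (DFinsupp.support (β := fun n : ℤ => (M : T) ⟶ S⟦n⟧) 0 ∪
      DFinsupp.support (β := fun n : ℤ => F ⟶ S⟦n⟧) x) ?_⟩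
    intro n hn
    rw [Finset.mem_union, not_or] at hn
    exact DFinsupp.notMem_support_iff.1 hn.2

end Step
end Tower
end
end GlDim

set_option linter.unusedSectionVars false
namespace GlDim
noncomputable section

/-! ### Part 8, continued: the tower, conclusion -/

section Tower2

universe v u

variable {T : Type u} [Category.{v} T] [Limits.HasZeroObject T] [HasShift T ℤ] [Preadditive T]
  [∀ n : ℤ, (shiftFunctor T n).Additive] [Pretriangulated T] [IsTriangulated T]

variable {S : T} {Yg : ℕ → Type v} [∀ i, AddCommGroup (Yg i)] [DirectSum.GRing Yg]
  (D : GData S Yg) {M : T}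

open Pretriangulated

lemma prop_shift (P : ObjectProperty T) [P.IsTriangulated] {X : T} (h : P X) (n : ℤ) : P (X⟦n⟧) :=
  P.le_shift n _ h

lemma prop_Fb (P : ObjectProperty T) [P.IsTriangulated] [P.IsClosedUnderIsomorphisms]
    (hS : P S) {r : ℕ} (m : Fin r → ℤ) : P (Fb S m) :=
  P.prop_of_iso (Limits.biproduct.isoProduct _).symm
    (P.prop_pi _ (fun i => prop_shift P hS (m i)))

section Base

variable {r : ℕ} {m : Fin r → ℤ} (s : HM D M →ₗ[(⨁ i, Yg i)ᵐᵒᵖ] HM D (Fb S m))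

/-- the homogeneous part of the section -/
def s0 (n : ℤ) (z : M ⟶ S⟦n⟧) : Fb S m ⟶ S⟦n⟧ := hcomp D (s (hof D n z)) n

lemma s0_zero (n : ℤ) : s0 D s n 0 = 0 := by
  rw [s0, map_zero, map_zero, hcomp_zero]

lemma s0_add (n : ℤ) (x y) : s0 D s n (x + y) = s0 D s n x + s0 D s n y := by
  rw [s0, map_add, map_add, hcomp_add]; rfl

lemma s0_comp (n c : ℤ) (i : ℕ) (h : i + n = c) (z : M ⟶ S⟦n⟧) (y : Yg i) :
    s0 D s c (ShiftedHom.comp z (D.φ i y) h) = ShiftedHom.comp (s0 D s n z) (D.φ i y) h := by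
  rw [s0, ← smul_hof, map_smul, hcomp_smul D n c i h]; rfl

lemma t_s0 {t : M ⟶ Fb S m} (hs : ∀ x, hmap D t (s x) = x) (n : ℤ) (z : M ⟶ S⟦n⟧) :
    t ≫ s0 D s n z = z := by
  rw [s0, ← hcomp_hmap, hs, hcomp_hof_same]

lemma base {z : ∀ i, M ⟶ S⟦m i⟧} (hs : ∀ x, hmap D (Limits.biproduct.lift z) (s x) = x)
    {C : T} {w : Fb S m ⟶ C} {δ : C ⟶ M⟦(1 : ℤ)⟧}
    (hT : Triangle.mk (Limits.biproduct.lift z) w δ ∈ distinguishedTriangles)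
    (ht : HSurj S (Limits.biproduct.lift z : M ⟶ Fb S m)) :
    ∃ h : M ⊞ C ⟶ Fb S m, HSurj S h ∧ ∀ (n : ℤ) (x : Fb S m ⟶ S⟦n⟧), h ≫ x = 0 → x = 0 := by
  set t : M ⟶ Fb S m := Limits.biproduct.lift z with ht'
  have h12 : t ≫ w = 0 := comp_distTriang_mor_zero₁₂ _ hT
  have h1 : ∀ i, ∃ u : C ⟶ S⟦m i⟧, pr S m i - s0 D s (m i) (z i) = w ≫ u := by
    intro i
    apply Triangle.yoneda_exact₂ _ hT
    change t ≫ _ = 0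
    rw [Preadditive.comp_sub, t_s0 D s hs, ht', Limits.biproduct.lift_π, sub_self]
  choose u hu using h1
  have key : ∀ (n : ℤ) (x : Fb S m ⟶ S⟦n⟧),
      w ≫ Limits.biproduct.lift u ≫ x + s0 D s n (t ≫ x) = x := by
    intro n x
    refine fb_induction D m (fun x => w ≫ Limits.biproduct.lift u ≫ x + s0 D s n (t ≫ x) = x)
      ?_ ?_ ?_ x
    · simp only [Limits.comp_zero, s0_zero, add_zero]
    · intro x y hx hy
      simp only [Preadditive.comp_add, s0_add]
      rw [add_add_add_comm, hx, hy]
    · intro i j h y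
      rw [← comp_precomp, ← comp_precomp, ← comp_precomp, Limits.biproduct.lift_π, ← hu, ht',
        Limits.biproduct.lift_π, s0_comp, ← ShiftedHom.add_comp, sub_add_cancel]
  refine ⟨Limits.biprod.desc t (Limits.biproduct.lift u), ?_, ?_⟩
  · intro n z'
    have e1 : t ≫ (s0 D s n (Limits.biprod.inl ≫ z') + w ≫ Limits.biprod.inr ≫ z') =
        Limits.biprod.inl ≫ z' := by
      rw [Preadditive.comp_add, t_s0 D s hs, reassoc_of% h12, Limits.zero_comp, add_zero]
    have e2 := key n (s0 D s n (Limits.biprod.inl ≫ z') + w ≫ Limits.biprod.inr ≫ z')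
    rw [e1, add_comm, add_right_inj] at e2
    refine ⟨s0 D s n (Limits.biprod.inl ≫ z') + w ≫ Limits.biprod.inr ≫ z',
      Limits.biprod.hom_ext' _ _ ?_ ?_⟩
    · rw [Limits.biprod.inl_desc_assoc, e1]
    · rw [Limits.biprod.inr_desc_assoc, ← sub_eq_zero]
      apply ht.cone_zero hT
      rw [Preadditive.comp_sub, e2, sub_self]
  · intro n x hx
    have e1 : t ≫ x = 0 := by
      have := congrArg (fun q => Limits.biprod.inl ≫ q) hx
      simpa using this
    have e2 : Limits.biproduct.lift u ≫ x = 0 := by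
      have := congrArg (fun q => Limits.biprod.inr ≫ q) hx
      simpa using this
    rw [← key n x, e1, e2, s0_zero, Limits.comp_zero, add_zero]

end Base

lemma zero_of_shift {K : T} (hK : ∀ (n : ℤ) (k : K ⟶ S⟦n⟧), k = 0) (a n : ℤ) (k : K⟦a⟧ ⟶ S⟦n⟧) :
    k = 0 := by
  obtain ⟨g, rfl⟩ := exists_shift (n - a) a n (by ring) k
  rw [hK _ g, ShiftedHom.comp_zero]

theorem lemmaA (Q 𝒟 : ObjectProperty T) [Q.IsTriangulated] [Q.IsClosedUnderIsomorphisms]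
    [𝒟.IsTriangulated] [𝒟.IsClosedUnderIsomorphisms] (hQ : Q S) (h𝒟 : 𝒟 S)
    [IsNoetherianRing (⨁ i, Yg i)ᵐᵒᵖ] [HasExt.{v + 1} (ModuleCat.{v} (⨁ i, Yg i)ᵐᵒᵖ)] (d : ℕ) :
    ∀ (M : T), 𝒟 M → Module.Finite (⨁ i, Yg i)ᵐᵒᵖ (HM D M) →
    HasProjectiveDimensionLT (ModuleCat.of (⨁ i, Yg i)ᵐᵒᵖ (HM D M)) (d + 1) → Good Q 𝒟 S M := by
  induction d with
  | zero =>
    intro M hM hfin hpd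
    obtain ⟨r, m, z, hz⟩ := exists_gens D (M := M)
    have ht := hsurj_t D z hz
    obtain ⟨C, w, δ, hT⟩ := distinguished_cocone_triangle (Limits.biproduct.lift z : M ⟶ Fb S m)
    have hproj : Module.Projective (⨁ i, Yg i)ᵐᵒᵖ (HM D M) := by
      have := projective_iff_hasProjectiveDimensionLT_one.2 hpd
      exact (IsProjective.iff_projective _).2 this
    obtain ⟨s, hs⟩ := Module.projective_lifting_property
      (hmap D (Limits.biproduct.lift z : M ⟶ Fb S m)) LinearMap.id (hmap_t_surj D z hz)
    obtain ⟨h, hh, hinj⟩ := base D s (fun x => LinearMap.congr_fun hs x) hT ht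
    obtain ⟨C', w', δ', hT'⟩ := distinguished_cocone_triangle h
    have hC' : ∀ (n : ℤ) (k : C' ⟶ S⟦n⟧), k = 0 := by
      intro n k
      apply hh.cone_zero hT'
      apply hinj
      have : h ≫ w' = 0 := comp_distTriang_mor_zero₁₂ _ hT'
      rw [reassoc_of% this, Limits.zero_comp]
    have hF := prop_Fb 𝒟 h𝒟 m
    have hC : 𝒟 C := 𝒟.ext_of_isTriangulatedClosed₃ _ hT hM hF
    have hE : 𝒟 (M ⊞ C) :=
      𝒟.ext_of_isTriangulatedClosed₂ _ (binaryBiproductTriangle_distinguished M C) hM hC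
    have hD : 𝒟 C' := 𝒟.ext_of_isTriangulatedClosed₃ _ hT' hE hF
    have hI := inv_rot_of_distTriang _ hT'
    refine ⟨M ⊞ C, C'⟦(-1 : ℤ)⟧, ⟨Limits.biprod.inl, Limits.biprod.fst, by simp⟩,
      _, ObjectProperty.trW.mk Q hI (prop_Fb Q hQ m), prop_shift 𝒟 hD _, ?_⟩
    exact fun n k => zero_of_shift hC' _ _ k
  | succ d ih =>
    intro M hM hfin hpd
    obtain ⟨r, m, z, hz⟩ := exists_gens D (M := M)
    have ht := hsurj_t D z hz
    obtain ⟨C, w, δ, hT⟩ := distinguished_cocone_triangle (Limits.biproduct.lift z : M ⟶ Fb S m)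
    obtain ⟨i1, i2, i3⟩ := hSE D hT ht
    have hF := prop_Fb 𝒟 h𝒟 m
    have hC : 𝒟 C := 𝒟.ext_of_isTriangulatedClosed₃ _ hT hM hF
    have hse := shortExact_univ (ModuleCat.ofHom (hmap D w))
      (ModuleCat.ofHom (hmap D (Limits.biproduct.lift z : M ⟶ Fb S m))) i1 (hmap_t_surj D z hz) i2 i3
    have hpF : HasProjectiveDimensionLT (ModuleCat.of (⨁ i, Yg i)ᵐᵒᵖ (HM D (Fb S m))) 1 := by
      rw [← projective_iff_hasProjectiveDimensionLT_one]
      exact (IsProjective.iff_projective _).1 inferInstance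
    have hpC := hse.hasProjectiveDimensionLT_X₁ (d + 1)
      (hasProjectiveDimensionLT_of_ge _ 1 (d + 1) (by omega)) hpd
    have hfC : Module.Finite (⨁ i, Yg i)ᵐᵒᵖ (HM D C) := Module.Finite.of_injective _ i1
    obtain ⟨E, K, ρ, f, hf, hK, hK0⟩ := ih C hC hfC hpC
    obtain ⟨E', a, b, hT2⟩ := distinguished_cocone_triangle₁ (w ≫ ρ.i)
    have hA : w ≫ ρ.i = 𝟙 (Fb S m) ≫ w ≫ ρ.i := (Category.id_comp _).symm
    have hB : (w ≫ ρ.i) ≫ ρ.r = 𝟙 (Fb S m) ≫ w := by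
      rw [Category.assoc, ρ.retract, Category.comp_id, Category.id_comp]
    obtain ⟨p, hp1, hp2⟩ := complete_distinguished_triangle_morphism₁ _ _ hT hT2 (𝟙 _) ρ.i hA
    obtain ⟨q, hq1, hq2⟩ := complete_distinguished_triangle_morphism₁ _ _ hT2 hT (𝟙 _) ρ.r hB
    let φ : Triangle.mk (Limits.biproduct.lift z : M ⟶ Fb S m) w δ ⟶ Triangle.mk a (w ≫ ρ.i) b :=
      { hom₁ := p, hom₂ := 𝟙 _, hom₃ := ρ.i, comm₁ := hp1, comm₂ := hA, comm₃ := hp2 }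
    let ψ : Triangle.mk a (w ≫ ρ.i) b ⟶ Triangle.mk (Limits.biproduct.lift z : M ⟶ Fb S m) w δ :=
      { hom₁ := q, hom₂ := 𝟙 _, hom₃ := ρ.r, comm₁ := hq1, comm₂ := hB, comm₃ := hq2 }
    have hiso : IsIso (φ ≫ ψ).hom₁ := by
      refine isIso₁_of_isIso₂₃ (φ ≫ ψ) hT hT ?_ ?_
      · change IsIso (𝟙 (Fb S m) ≫ 𝟙 (Fb S m))
        infer_instance
      · change IsIso (ρ.i ≫ ρ.r)
        rw [ρ.retract]; infer_instance
    obtain ⟨ζ, hζ, -⟩ := hiso.out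
    replace hζ : p ≫ q ≫ ζ = 𝟙 M := by
      rw [← Category.assoc]; exact hζ
    have hb : Q.trW b := by
      have := ObjectProperty.trW.mk Q (rot_of_distTriang _ (rot_of_distTriang _ hT2))
        (prop_shift Q (prop_Fb Q hQ m) 1)
      exact this
    have hfb : Q.trW (f ≫ b) := Q.trW.comp_mem _ _ hf hb
    have hfb' := ObjectProperty.trW.shift hfb (-1)
    refine ⟨E', K⟦(-1 : ℤ)⟧, ⟨p, q ≫ ζ, hζ⟩,
      (f ≫ b)⟦(-1 : ℤ)⟧' ≫ (shiftFunctorCompIsoId T (1 : ℤ) (-1) (by simp)).hom.app E', ?_,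
      prop_shift 𝒟 hK _, fun n k => zero_of_shift hK0 _ _ k⟩
    exact MorphismProperty.RespectsIso.postcomp (P := Q.trW) _ _ hfb'

end Tower2
end
end GlDim

set_option linter.unusedSectionVars false
namespace GlDim
noncomputable section

/-! ### Part 9: the derived category of modules -/

/-- The derived categories used below. -/
@[reducible] def hdc (R : Type) [Ring R] : HasDerivedCategory.{1} (ModuleCat.{0} R) :=
  HasDerivedCategory.standard _

section Derived

attribute [local instance] hdc

variable {R : Type} [Ring R]

/-- The derived category. -/
abbrev DD (R : Type) [Ring R] := DerivedCategory (ModuleCat.{0} R)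

/-- Modules as complexes in degree zero. -/
abbrev sg (X : ModuleCat.{0} R) : DD R := (DerivedCategory.singleFunctor _ 0).obj X

lemma hom_zero_of_lt {X Y : DD R} (a b : ℤ) (h : a < b) [X.IsLE a] [Y.IsGE b] (f : X ⟶ Y) : f = 0 :=
  DerivedCategory.TStructure.t.zero f a b h

lemma hom_shift_neg (X Y : ModuleCat.{0} R) (n : ℤ) (hn : n < 0) (f : sg X ⟶ (sg Y)⟦n⟧) : f = 0 := by
  have : DerivedCategory.IsGE ((sg Y)⟦n⟧) (-n) :=
    DerivedCategory.TStructure.t.isGE_shift (sg Y) 0 n (-n)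
  exact hom_zero_of_lt 0 (-n) (by omega) f

lemma hom_shift_proj (P Y : ModuleCat.{0} R) [Projective P] (n : ℤ) (hn : n ≠ 0)
    (f : sg P ⟶ (sg Y)⟦n⟧) : f = 0 := by
  rcases lt_or_gt_of_ne hn with h | h
  · exact hom_shift_neg P Y n h f
  · obtain ⟨k, rfl⟩ : ∃ k : ℕ, n = ((k + 1 : ℕ) : ℤ) := ⟨(n - 1).toNat, by omega⟩
    have h1 : Ext.homEquiv.symm f = 0 := Ext.eq_zero_of_projective _
    have h2 := congrArg (Ext.homAddEquiv (X := P) (Y := Y)) h1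
    rw [map_zero] at h2
    rw [← h2]
    exact (Equiv.apply_symm_apply _ _).symm

/-- The comparison of the Yoneda ring with endomorphisms in the derived category. -/
def gdata (X : ModuleCat.{0} R) :
    letI := ExtYoneda.gring X
    GData (sg X) (fun i : ℕ => Ext X X i) :=
  letI := ExtYoneda.gring X
  { φ := fun i => Ext.homAddEquiv
    one := (Ext.mk₀_hom (𝟙 X)).trans (by rw [CategoryTheory.Functor.map_id])
    mul := fun i j a b => Ext.comp_hom a b rfl
    neg := hom_shift_neg X X }

theorem good_of {S P : ModuleCat.{0} R} [Projective P] (π : P ⟶ S)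
    (hπ : ∀ g : P ⟶ S, ∃ y : S ⟶ S, g = π ≫ y)
    (hN : IsNoetherianRing (ExtRing S)ᵐᵒᵖ) (hg : HasFiniteGlobalDimension (ExtRing S))
    (Q 𝒟 : ObjectProperty (DD R)) [Q.IsTriangulated] [Q.IsClosedUnderIsomorphisms]
    [𝒟.IsTriangulated] [𝒟.IsClosedUnderIsomorphisms] (hQ : Q (sg S)) (h𝒟 : 𝒟 (sg S))
    (hP : 𝒟 (sg P)) : Good Q 𝒟 (sg S) (sg P) := by
  let _ := ExtYoneda.gring S
  have : IsNoetherianRing (⨁ i : ℕ, Ext S S i)ᵐᵒᵖ := hN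
  let D := gdata S
  have hfin : Module.Finite (⨁ i : ℕ, Ext S S i)ᵐᵒᵖ (HM D (sg P)) := by
    let z : sg P ⟶ (sg S)⟦((0 : ℕ) : ℤ)⟧ := (Ext.mk₀ π).hom
    refine ⟨{hof D _ z}, ?_⟩
    rw [eq_top_iff, Finset.coe_singleton]
    intro x _
    induction x using hof_induction with
    | h0 => exact Submodule.zero_mem _
    | hadd x y hx hy => exact Submodule.add_mem _ (hx trivial) (hy trivial)
    | hof n x =>
      by_cases hn : n = ((0 : ℕ) : ℤ)
      · subst hn
        obtain ⟨g, hg⟩ := (Ext.mk₀_bijective P S).2 (Ext.homEquiv.symm x)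
        obtain ⟨y, rfl⟩ := hπ g
        have hx : x = ShiftedHom.comp z (D.φ 0 (Ext.mk₀ y)) (by simp) := by
          have : x = Ext.hom (Ext.mk₀ (π ≫ y)) := by
            rw [hg]; exact (Equiv.apply_symm_apply _ _).symm
          rw [this, ← Ext.mk₀_comp_mk₀, Ext.comp_hom]
          rfl
        rw [hx, ← smul_hof]
        exact Submodule.smul_mem _ _ (Submodule.mem_span_singleton_self _)
      · rw [hom_shift_proj P S n (by simpa using hn) x, map_zero]
        exact Submodule.zero_mem _
  obtain ⟨d, hd⟩ := hg
  refine lemmaA D Q 𝒟 hQ h𝒟 d (sg P) hP hfin ?_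
  rw [hasProjectiveDimensionLT_iff.{_, _, 2}]
  intro i hi Y e
  exact (hd _ Y i (by omega)).elim _ _

end Derived
end
end GlDim

set_option linter.unusedSectionVars false
namespace GlDim
noncomputable section

/-! ### Part 10: modules killed by the idempotent have bounded radical length -/

section Van

attribute [local instance] hdc
open Pretriangulated Limits ZeroObject

variable {R Λ : Type} [Ring R] [Ring Λ] {ι : Λ →ₙ+* R}

/-- All homs from `K` to shifts of `Z` vanish. -/
def Van (K : DD R) (Z : ModuleCat.{0} R) : Prop := ∀ (n : ℤ) (k : K ⟶ (sg Z)⟦n⟧), k = 0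

/-- The shifted embedding. -/
abbrev sgs (R : Type) [Ring R] (n : ℤ) : ModuleCat.{0} R ⥤ DD R :=
  DerivedCategory.singleFunctor _ 0 ⋙ shiftFunctor _ n

lemma Van.retract {K : DD R} {Z W : ModuleCat.{0} R} (h : Van K W) (r : Retract Z W) : Van K Z := by
  intro n k
  have h1 : (sgs R n).map r.i ≫ (sgs R n).map r.r = 𝟙 _ := by
    rw [← CategoryTheory.Functor.map_comp, r.retract, CategoryTheory.Functor.map_id]
  have h2 : k = (k ≫ (sgs R n).map r.i) ≫ (sgs R n).map r.r := by
    rw [Category.assoc, h1]; exact (Category.comp_id k).symm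
  rw [h2, h n (k ≫ (sgs R n).map r.i)]
  exact zero_comp

lemma Van.pi {K : DD R} {S : ModuleCat.{0} R} (h : Van K S) (m : ℕ) :
    Van K (ModuleCat.of R (Fin m → S)) := by
  classical
  intro n k
  let p (j : Fin m) : ModuleCat.of R (Fin m → S) ⟶ S := ModuleCat.ofHom (LinearMap.proj j)
  let i (j : Fin m) : S ⟶ ModuleCat.of R (Fin m → S) :=
    ModuleCat.ofHom (LinearMap.single R (fun _ => (S : Type)) j)
  have h0 : 𝟙 (ModuleCat.of R (Fin m → S)) = ∑ j, p j ≫ i j := by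
    refine ModuleCat.hom_ext (LinearMap.ext fun x => ?_)
    rw [ModuleCat.hom_sum, LinearMap.sum_apply]
    exact (Finset.univ_sum_single x).symm
  have h1 : 𝟙 ((sgs R n).obj (ModuleCat.of R (Fin m → S))) =
      ∑ j, (sgs R n).map (p j) ≫ (sgs R n).map (i j) := by
    rw [← CategoryTheory.Functor.map_id, h0, Functor.map_sum]
    simp only [CategoryTheory.Functor.map_comp]
  have h2 : k = k ≫ 𝟙 ((sgs R n).obj (ModuleCat.of R (Fin m → S))) := (Category.comp_id k).symm
  rw [h2, h1, Preadditive.comp_sum]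
  refine Finset.sum_eq_zero fun j _ => ?_
  rw [← Category.assoc, h n (k ≫ (sgs R n).map (p j))]
  exact zero_comp

lemma Van.ext {K : DD R} {T : ShortComplex (ModuleCat.{0} R)} (hT : T.ShortExact)
    (h1 : Van K T.X₁) (h3 : Van K T.X₃) : Van K T.X₂ := by
  intro n k
  have hd := Triangle.shift_distinguished _ hT.singleTriangle_distinguished n
  obtain ⟨g, hg⟩ := Triangle.coyoneda_exact₂ _ hd k (h3 n _)
  rw [hg, h1 n g]
  exact zero_comp

variable {S : ModuleCat.{0} R} {s : S}

lemma Setup.van (hS : Setup ι S s) [IsNoetherianRing R] {K : DD R} (hK : Van K S) (k : ℕ) 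
    (Z : ModuleCat.{0} R) (hZ : Es ι Z) (hJ : JK (R := R) k Z) (hf : Module.Finite R Z) : Van K Z := by
  revert hf
  refine es_induction (ι := ι) (fun Z => Module.Finite R Z → Van K Z) ?_ ?_ k Z hZ hJ
  · intro Z hZ hJ hf
    obtain ⟨n, ⟨r⟩⟩ := hS.retract_fin Z hZ hJ
    exact (hK.pi n).retract r
  · intro T hT h1 h3 hf
    refine Van.ext hT (h1 ?_) (h3 ?_)
    · exact Module.Finite.of_injective T.f.hom ((ModuleCat.mono_iff_injective _).1 hT.mono_f)
    · exact Module.Finite.of_surjective T.g.hom ((ModuleCat.epi_iff_surjective _).1 hT.epi_g)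

/-- Complexes whose homology modules are killed by powers of the radical. -/
def QJ (R : Type) [Ring R] : ObjectProperty (DD R) := fun X =>
  ∀ n : ℤ, ∃ k : ℕ, JK (R := R) k ((DerivedCategory.homologyFunctor (ModuleCat.{0} R) n).obj X)

lemma JK.of_iso {M N : ModuleCat.{0} R} (e : M ≅ N) {k : ℕ} (h : JK (R := R) k M) : JK (R := R) k N :=
  h.of_surjective e.hom.hom ((ModuleCat.epi_iff_surjective e.hom).1 inferInstance)

instance : (QJ R).IsClosedUnderIsomorphisms where
  of_iso e h n := by
    obtain ⟨k, hk⟩ := h n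
    exact ⟨k, hk.of_iso ((DerivedCategory.homologyFunctor (ModuleCat.{0} R) n).mapIso e)⟩

lemma QJ_zero {X : DD R} (hX : IsZero X) : QJ R X := fun n => ⟨0, by
  have h : IsZero ((DerivedCategory.homologyFunctor (ModuleCat.{0} R) n).obj X) := Functor.map_isZero _ hX
  have := ModuleCat.subsingleton_of_isZero h
  exact Subsingleton.elim _ _⟩

instance : (QJ R).IsTriangulated where
  exists_zero := ⟨0, isZero_zero _, QJ_zero (isZero_zero _)⟩
  isStableUnderShiftBy a :=
    { le_shift := fun X hX n => by
        obtain ⟨k, hk⟩ := hX (a + n)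
        exact ⟨k, hk.of_iso (((DerivedCategory.homologyFunctor (ModuleCat.{0} R) 0).shiftIso
          a n (a + n) rfl).app X).symm⟩ }
  toIsTriangulatedClosed₂ := .mk' fun T hT h1 h3 n => by
    obtain ⟨a, ha⟩ := h1 n
    obtain ⟨b, hb⟩ := h3 n
    have := DerivedCategory.HomologySequence.exact₂ T hT n
    rw [ShortComplex.moduleCat_exact_iff] at this
    exact ⟨a + b, JK.ext _ _ this ha hb⟩

lemma QJ_sg {Z : ModuleCat.{0} R} {k : ℕ} (h : JK (R := R) k Z) : QJ R (sg Z) := by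
  intro n
  by_cases hn : n = 0
  · subst hn
    exact ⟨k, h.of_iso ((DerivedCategory.singleFunctorCompHomologyFunctorIso _ 0).app Z).symm⟩
  · refine ⟨0, ?_⟩
    have h0 : IsZero ((DerivedCategory.homologyFunctor (ModuleCat.{0} R) n).obj (sg Z)) := by
      rcases lt_or_gt_of_ne hn with h | h
      · exact DerivedCategory.isZero_of_isGE _ 0 n h
      · exact DerivedCategory.isZero_of_isLE _ 0 n h
    have := ModuleCat.subsingleton_of_isZero h0
    exact Subsingleton.elim _ _

end Van
end
end GlDim

set_option linter.unusedSectionVars false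
namespace GlDim
noncomputable section

section Bound

attribute [local instance] hdc
open Pretriangulated Limits ZeroObject

variable {R Λ : Type} [Ring R] [Ring Λ] {ι : Λ →ₙ+* R}

lemma exists_P (ι : Λ →ₙ+* R) : ∃ (P : ModuleCat.{0} R) (p : P), Projective P ∧ 
    (∀ x : P, ∃ r : R, x = r • p) ∧
    ∀ (Z : Type) [AddCommGroup Z] [Module R Z] (z : Z), ι 1 • z = 0 → ∃ f : P →ₗ[R] Z, f p = z := by
  let P : Submodule R R := Submodule.span R {1 - ι 1}
  have hid : ι 1 * ι 1 = ι 1 := by rw [← map_mul, mul_one]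
  have hid' : (1 - ι 1) * (1 - ι 1) = 1 - ι 1 := by
    rw [mul_sub, sub_mul, sub_mul, hid]; simp
  let p : P := ⟨1 - ι 1, Submodule.mem_span_singleton_self _⟩
  let q : R →ₗ[R] P := LinearMap.toSpanSingleton R P p
  have hq : q ∘ₗ P.subtype = LinearMap.id := by
    refine LinearMap.ext fun x => Subtype.ext ?_
    obtain ⟨r, hr⟩ := Submodule.mem_span_singleton.1 x.2
    change x.1 * (1 - ι 1) = x.1
    rw [← hr, smul_eq_mul, mul_assoc, hid']
  refine ⟨ModuleCat.of R P, p, ?_, ?_, ?_⟩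
  · rw [← IsProjective.iff_projective]
    exact Module.Projective.of_split P.subtype q hq
  · intro x
    obtain ⟨r, hr⟩ := Submodule.mem_span_singleton.1 x.2
    exact ⟨r, Subtype.ext hr.symm⟩
  · intro Z _ _ z hz
    refine ⟨LinearMap.toSpanSingleton R Z z ∘ₗ P.subtype, ?_⟩
    change (1 - ι 1) • z = z
    rw [sub_smul, hz, one_smul, sub_zero]

lemma jit_iSup {M : Type} [AddCommGroup M] [Module R M] {I : Type} (N : I → Submodule R M) (k : ℕ) :
    Jit k (⨆ i, N i) = ⨆ i, Jit k (N i) := by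
  induction k with
  | zero => rfl
  | succ k ih => 
    rw [jit_succ, ih, Submodule.smul_iSup]
    exact iSup_congr fun i => (jit_succ _ _).symm

variable {S : ModuleCat.{0} R} {s : S}

lemma Setup.exists_pi (hS : Setup ι S s) : ∃ (P : ModuleCat.{0} R) (p : P), Projective P ∧ 
    (∀ x : P, ∃ r : R, x = r • p) ∧
    (∀ (Z : Type) [AddCommGroup Z] [Module R Z] (z : Z), ι 1 • z = 0 → ∃ f : P →ₗ[R] Z, f p = z) ∧
    ∃ π : P ⟶ S, ∀ g : P ⟶ S, ∃ y : S ⟶ S, g = π ≫ y := by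
  obtain ⟨P, p, hP, hp, hZ⟩ := exists_P ι
  obtain ⟨π, hπ⟩ := hZ S s (hS.esS s)
  refine ⟨P, p, hP, hp, hZ, ModuleCat.ofHom π, fun g => ?_⟩
  obtain ⟨y, hy⟩ := hS.exists_hom hS.esS hS.jkS (g.hom p)
  refine ⟨ModuleCat.ofHom y, ?_⟩
  refine ModuleCat.hom_ext (LinearMap.ext fun x => ?_)
  obtain ⟨r, rfl⟩ := hp x
  change g.hom (r • p) = y (π (r • p))
  rw [map_smul, map_smul, map_smul, hπ, hy]

theorem Setup.bound (hS : Setup ι S s) [IsNoetherianRing R]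
    (hN : IsNoetherianRing (ExtRing S)ᵐᵒᵖ) (hg : HasFiniteGlobalDimension (ExtRing S)) :
    ∃ k : ℕ, ∀ Z : ModuleCat.{0} R, Es ι Z → JK (R := R) k Z := by
  obtain ⟨P, p, hP, hp, hZ, π, hπ⟩ := hS.exists_pi
  obtain ⟨E, K, ρ, f, ⟨C, g, h, hT, hC⟩, -, hK⟩ := good_of π hπ hN hg (QJ R)
    DerivedCategory.TStructure.t.minus (QJ_sg hS.jkS)
    ⟨0, inferInstanceAs (DerivedCategory.IsLE (sg S) 0)⟩
    ⟨0, inferInstanceAs (DerivedCategory.IsLE (sg P) 0)⟩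
  have hK : Van K S := hK
  obtain ⟨k, hk⟩ := hC 0
  have hPf : Module.Finite R P := ⟨{p}, by
    rw [eq_top_iff, Finset.coe_singleton]
    intro x _
    obtain ⟨r, rfl⟩ := hp x
    exact Submodule.smul_mem _ _ (Submodule.mem_span_singleton_self _)⟩
  let N0 : Submodule R P := Submodule.span R (Set.range fun x : P => ι 1 • x)
  let Z0 := P ⧸ N0
  have hZ0 : Es ι Z0 := by
    intro m
    obtain ⟨x, rfl⟩ := N0.mkQ_surjective m
    rw [← map_smul]
    exact (Submodule.Quotient.mk_eq_zero _).2 (Submodule.subset_span ⟨x, rfl⟩)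
  have key : JK (R := R) k Z0 := by
    let U : Submodule R Z0 := Jit (k + 1) ⊤
    let Z1 : ModuleCat.{0} R := ModuleCat.of R (Z0 ⧸ U)
    have hZ1 : Es ι Z1 := by
      intro m
      obtain ⟨x, rfl⟩ := U.mkQ_surjective m
      rw [← map_smul, hZ0 x, map_zero]
    have hJ1 : JK (R := R) (k + 1) Z1 := by
      have : Jit (k + 1) (⊤ : Submodule R (Z0 ⧸ U)) = Submodule.map U.mkQ U := by
        rw [jit_map, Submodule.map_top, Submodule.range_mkQ]
      rw [JK]
      refine this.trans ?_
      rw [Submodule.mkQ_map_self]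
    have hf1 : Module.Finite R Z1 := inferInstanceAs (Module.Finite R (Z0 ⧸ U))
    have hV : Van K Z1 := hS.van hK (k + 1) Z1 hZ1 hJ1 hf1
    let a : P ⟶ Z1 := ModuleCat.ofHom (U.mkQ ∘ₗ N0.mkQ)
    have ha : Epi a := (ModuleCat.epi_iff_surjective _).2
      (U.mkQ_surjective.comp N0.mkQ_surjective)
    let φ : E ⟶ sg Z1 := ρ.r ≫ (DerivedCategory.singleFunctor _ 0).map a
    have h0 : f ≫ φ = 0 := by
      have := hV 0 ((f ≫ φ) ≫ (shiftFunctorZero _ ℤ).inv.app _)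
      rw [← cancel_mono ((shiftFunctorZero (DD R) ℤ).inv.app (sg Z1)), zero_comp]
      exact this
    obtain ⟨c, hc'⟩ : ∃ c : C ⟶ sg Z1, φ = g ≫ c := Triangle.yoneda_exact₂ _ hT φ h0
    have h1 : (DerivedCategory.singleFunctor _ 0).map a = (ρ.i ≫ g) ≫ c := by
      rw [Category.assoc, ← hc', ρ.retract_assoc]
    let H := DerivedCategory.homologyFunctor (ModuleCat.{0} R) 0
    let i := DerivedCategory.singleFunctorCompHomologyFunctorIso (ModuleCat.{0} R) 0
    have h2 : Epi (H.map ((DerivedCategory.singleFunctor _ 0).map a)) := by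
      have h3 := i.hom.naturality a
      have h4 : H.map ((DerivedCategory.singleFunctor _ 0).map a) = i.hom.app P ≫ a ≫ i.inv.app Z1 := by
        rw [← Category.assoc, ← Iso.app_inv, Iso.eq_comp_inv]
        exact h3
      rw [h4]
      exact epi_comp _ _
    have h3 : Epi (H.map c) := by
      rw [h1, CategoryTheory.Functor.map_comp] at h2
      exact epi_of_epi (H.map (ρ.i ≫ g)) (H.map c)
    have h4 : JK (R := R) k Z1 := 
      (hk.of_surjective (H.map c).hom ((ModuleCat.epi_iff_surjective _).1 h3)).of_iso (i.app Z1)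
    have h5 : Jit k (⊤ : Submodule R Z0) ≤ U := by
      have : (Jit k (⊤ : Submodule R Z0)).map U.mkQ = ⊥ := by
        rw [jit_map]
        exact le_bot_iff.1 ((jit_mono k le_top).trans (le_of_eq h4))
      intro x hx
      have hx' : U.mkQ x ∈ (Jit k (⊤ : Submodule R Z0)).map U.mkQ := ⟨x, hx, rfl⟩
      rw [this] at hx'
      exact (Submodule.Quotient.mk_eq_zero _).1 hx'
    refine Submodule.FG.eq_bot_of_le_jacobson_smul (IsNoetherian.noetherian _) ?_
    rw [← jit_succ]
    exact h5
  refine ⟨k, fun Z hZE => ?_⟩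
  have hex : ∀ z : Z, ∃ f : Z0 →ₗ[R] Z, z ∈ LinearMap.range f := by
    intro z
    obtain ⟨f, hf⟩ := hZ Z z (hZE z)
    refine ⟨N0.liftQ f ?_, ⟨N0.mkQ p, hf⟩⟩
    rw [Submodule.span_le]
    rintro _ ⟨x, rfl⟩
    change f (ι 1 • x) = 0
    rw [map_smul, hZE]
  choose F hF using hex
  have htop : (⊤ : Submodule R Z) = ⨆ z : Z, LinearMap.range (F z) := by
    rw [eq_comm, eq_top_iff]
    intro z _
    exact Submodule.mem_iSup_of_mem z (hF z)
  rw [JK, htop, jit_iSup]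
  refine iSup_eq_bot.2 fun z => ?_
  rw [← Submodule.map_top, ← jit_map, show Jit k (⊤ : Submodule R Z0) = ⊥ from key, Submodule.map_bot]

end Bound
end
end GlDim

set_option linter.unusedSectionVars false
namespace GlDim
noncomputable section

/-! ### Part 11: objects of finite projective dimension in the derived category -/

section PP

attribute [local instance] hdc
open Pretriangulated Limits ZeroObject DerivedCategory.TStructure

variable {R : Type} [Ring R]

/-- Objects without nonzero maps to very negative objects. -/
def PP (R : Type) [Ring R] : ObjectProperty (DD R) := fun E =>
  ∃ m : ℤ, ∀ V : DD R, V.IsLE m → ∀ f : E ⟶ V, f = 0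

lemma PP.of_retract {E E' : DD R} (r : Retract E E') (h : PP R E') : PP R E := by
  obtain ⟨m, hm⟩ := h
  refine ⟨m, fun V hV f => ?_⟩
  rw [← Category.id_comp f, ← r.retract, Category.assoc, hm V hV (r.r ≫ f), comp_zero]

instance : (PP R).IsClosedUnderIsomorphisms where
  of_iso e h := h.of_retract ⟨e.inv, e.hom, e.inv_hom_id⟩

lemma hom_shift_zero {E V : DD R} (a : ℤ) (h : ∀ g : E ⟶ V⟦-a⟧, g = 0) (f : E⟦a⟧ ⟶ V) : f = 0 := by
  have h1 := h ((shiftShiftNeg E a).inv ≫ f⟦-a⟧')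
  apply (shiftFunctor (DD R) (-a)).map_injective
  rw [Functor.map_zero]
  rw [← cancel_epi (shiftShiftNeg E a).inv, comp_zero]
  exact h1

instance : (PP R).IsTriangulated where
  exists_zero := ⟨0, isZero_zero _, 0, fun V _ f => (isZero_zero _).eq_of_src _ _⟩
  isStableUnderShiftBy a :=
    { le_shift := fun X hX => by
        obtain ⟨m, hm⟩ := hX
        refine ⟨m - a, fun V hV f => ?_⟩
        refine hom_shift_zero a (fun g => hm _ ?_ g) f
        exact t.isLE_shift V (m - a) (-a) m (by omega) }
  toIsTriangulatedClosed₂ := .mk' fun T hT h1 h3 => by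
    obtain ⟨a, ha⟩ := h1
    obtain ⟨b, hb⟩ := h3
    refine ⟨min a b, fun V hV f => ?_⟩
    obtain ⟨g, hg⟩ := Triangle.yoneda_exact₂ T hT f
      (ha V (t.isLE_of_le V _ _ (min_le_left a b)) _)
    rw [hg, hb V (t.isLE_of_le V _ _ (min_le_right a b)) g, comp_zero]

lemma hom_proj_zero (P : ModuleCat.{0} R) [Projective P] (V : DD R) (n : ℤ) (hn : n < 0) 
    (hV : V.IsLE n) (f : sg P ⟶ V) : f = 0 := by
  obtain ⟨L, hL, ⟨e⟩⟩ := DerivedCategory.exists_iso_Q_obj_of_isLE V n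
  let i := (DerivedCategory.singleFunctorIsoCompQ (ModuleCat.{0} R) 0).app P
  have := DerivedCategory.from_singleFunctor_obj_eq_zero_of_projective (i.inv ≫ f ≫ e.hom) n hn
  rw [← cancel_epi i.inv, ← cancel_mono e.hom, comp_zero, zero_comp, Category.assoc]
  exact this

lemma PP_proj (P : ModuleCat.{0} R) [Projective P] : PP R (sg P) :=
  ⟨-1, fun V hV f => hom_proj_zero P V (-1) (by omega) hV f⟩

lemma shortExact_epi {N M : ModuleCat.{0} R} (h : N ⟶ M) [Epi h] :
    (ShortComplex.mk (Limits.kernel.ι h) h (Limits.kernel.condition h)).ShortExact where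
  exact := ShortComplex.exact_kernel _

lemma PP_of_pd (n : ℕ) : ∀ (X : ModuleCat.{0} R), HasProjectiveDimensionLT X n → PP R (sg X) := by
  induction n with
  | zero =>
    intro X hX
    have : IsZero (sg X) := Functor.map_isZero _ (isZero_of_hasProjectiveDimensionLT_zero X)
    exact ⟨0, fun V _ f => this.eq_of_src _ _⟩
  | succ n ih =>
    intro X hX
    by_cases hn : n = 0
    · subst hn
      have : Projective X := projective_iff_hasProjectiveDimensionLT_one.2 hX
      exact PP_proj X
    · have hT := shortExact_epi (Projective.π X)
      have h1 : HasProjectiveDimensionLT (Projective.over X) 1 :=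
        projective_iff_hasProjectiveDimensionLT_one.1 inferInstance
      have h2 := hT.hasProjectiveDimensionLT_X₁ n (hasProjectiveDimensionLT_of_ge _ 1 n (by omega)) hX
      exact (PP R).ext_of_isTriangulatedClosed₃ _ hT.singleTriangle_distinguished (ih _ h2)
        (PP_proj (Projective.over X))

lemma pd_of_PP (X : ModuleCat.{0} R) (h : PP R (sg X)) : ∃ n, HasProjectiveDimensionLT X n := by
  obtain ⟨m, hm⟩ := h
  refine ⟨(-m).toNat, ?_⟩
  rw [hasProjectiveDimensionLT_iff.{_, _, 1}]
  intro i hi Y e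
  apply (Ext.homAddEquiv (X := X) (Y := Y)).injective
  rw [map_zero]
  refine hm _ ?_ _
  have : DerivedCategory.IsLE ((sg Y)⟦(i : ℤ)⟧) (-i) := t.isLE_shift (sg Y) 0 i (-i)
  exact t.isLE_of_le _ (-i) m (by omega)

end PP
end
end GlDim

set_option linter.unusedSectionVars false
namespace GlDim
noncomputable section

section Claim

attribute [local instance] hdc
open Pretriangulated Limits ZeroObject DerivedCategory.TStructure

variable {R Λ : Type} [Ring R] [Ring Λ] {ι : Λ →ₙ+* R}

lemma exists_LQ (ι : Λ →ₙ+* R) (X : ModuleCat.{0} R) : ∃ (Q : ModuleCat.{0} Λ) (_ : Projective Q) 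
    (v : (L ι).obj Q ⟶ X), ∀ x : X, ι 1 • x = x → ∃ y, v.hom y = x := by
  let q := Projective.π ((F ι).obj X)
  let v := ((adjL ι).homEquiv _ _).symm q
  refine ⟨Projective.over ((F ι).obj X), inferInstance, v, fun x hx => ?_⟩
  have h1 : (adjL ι).unit.app _ ≫ (F ι).map v = q :=
    ((adjL ι).homEquiv_unit _ _ _).symm.trans (Equiv.apply_symm_apply _ _)
  have h2 : Epi ((F ι).map v) := by
    have : Epi ((adjL ι).unit.app _ ≫ (F ι).map v) := by rw [h1]; infer_instance
    exact epi_of_epi ((adjL ι).unit.app _) _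
  obtain ⟨y, hy⟩ := (ModuleCat.epi_iff_surjective _).1 h2 (⟨x, hx⟩ : Fm ι X)
  exact ⟨(show Fm ι ((L ι).obj _) from y).1, congrArg Subtype.val hy⟩

variable {S : ModuleCat.{0} R} {s : S}

lemma Setup.epi_of (hS : Setup ι S s) (k : ℕ) (hk : ∀ Z : ModuleCat.{0} R, Es ι Z → JK (R := R) k Z)
    {W N : ModuleCat.{0} R} (v : W ⟶ N) (hv : ∀ x : N, ι 1 • x = x → ∃ y, v.hom y = x)
    (hno : ∀ g : N ⟶ S, g = 0) : Epi v := by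
  rw [ModuleCat.epi_iff_surjective]
  change Function.Surjective v.hom
  rw [← LinearMap.range_eq_top]
  let U := LinearMap.range v.hom
  let Z := N ⧸ U
  have hZ : Es ι Z := by
    intro z
    obtain ⟨x, rfl⟩ := U.mkQ_surjective z
    rw [← map_smul]
    refine (Submodule.Quotient.mk_eq_zero _).2 (hv _ ?_)
    rw [smul_smul, iota_one_mul]
  let B : Submodule R Z := Ring.jacobson R • ⊤
  have hB : B = ⊤ := by
    by_contra hne
    obtain ⟨z, hz⟩ : ∃ z : Z, z ∉ B := by
      by_contra h; push Not at h
      exact hne (eq_top_iff.2 fun z _ => h z)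
    obtain ⟨f, hf⟩ := hS.exists_hom' (Z := Z ⧸ B)
      (by
        intro y
        obtain ⟨x, rfl⟩ := B.mkQ_surjective y
        rw [← map_smul, hZ x, map_zero])
      (jk_one_iff.2 (by
        intro j hj y
        obtain ⟨x, rfl⟩ := B.mkQ_surjective y
        rw [← map_smul]
        exact (Submodule.Quotient.mk_eq_zero _).2 (Submodule.smul_mem_smul hj trivial)))
      (B.mkQ z) (fun h => hz ((Submodule.Quotient.mk_eq_zero _).1 h))
    obtain ⟨x, rfl⟩ := U.mkQ_surjective z
    have := hno (ModuleCat.ofHom (f ∘ₗ B.mkQ ∘ₗ U.mkQ))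
    exact hf (LinearMap.congr_fun (congrArg ModuleCat.Hom.hom this) x)
  have hit : ∀ j : ℕ, Jit j (⊤ : Submodule R Z) = ⊤ := by
    intro j
    induction j with
    | zero => rfl
    | succ j ih => rw [jit_succ, ih]; exact hB
  have h0 : (⊤ : Submodule R Z) = ⊥ := (hit k).symm.trans (hk (ModuleCat.of R Z) hZ)
  rw [eq_top_iff]
  intro x _
  have : U.mkQ x ∈ (⊤ : Submodule R Z) := trivial
  rw [h0] at this
  exact (Submodule.Quotient.mk_eq_zero _).1 this

lemma Setup.L_hom_zero (hS : Setup ι S s) (Q : ModuleCat.{0} Λ) (g : (L ι).obj Q ⟶ S) : g = 0 := by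
  apply ((adjL ι).homEquiv _ _).injective
  exact ((isZero_F_iff ι S).2 hS.esS).eq_of_tgt _ _

lemma Setup.L_van (hS : Setup ι S s) (Q : ModuleCat.{0} Λ) [Projective Q] :
    Van (sg ((L ι).obj Q)) S := by
  intro n k
  have := projective_L ι Q
  by_cases hn : n = 0
  · subst hn
    obtain ⟨g, hg⟩ := (DerivedCategory.singleFunctor (ModuleCat.{0} R) 0).map_surjective
      (k ≫ (shiftFunctorZero (DD R) ℤ).hom.app (sg S))
    rw [hS.L_hom_zero Q g, Functor.map_zero] at hg
    rw [← cancel_mono ((shiftFunctorZero (DD R) ℤ).hom.app (sg S)), zero_comp]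
    exact hg.symm
  · exact hom_shift_proj _ _ n hn k

lemma isLE_cone {X K Y K' : DD R} {N W : ModuleCat.{0} R} {a : X ⟶ K} {b : K ⟶ Y} {c : Y ⟶ X⟦(1 : ℤ)⟧}
    (hT : Triangle.mk a b c ∈ distTriang (DD R)) (hX : X.IsLE (-1)) (e : Y ≅ sg N)
    (v : W ⟶ N) [Epi v] {u : sg W ⟶ K} {p : K ⟶ K'} {q : K' ⟶ (sg W)⟦(1 : ℤ)⟧}
    (hT' : Triangle.mk u p q ∈ distTriang (DD R)) 
    (hu : u ≫ b ≫ e.hom = (DerivedCategory.singleFunctor _ 0).map v) : K'.IsLE (-1) := by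
  refine (t.isLE_iff_orthogonal (-1) 0 (by omega) K').2 fun G φ hG => ?_
  have h1 : a ≫ p ≫ φ = 0 := t.zero _ (-1) 0 (by omega)
  obtain ⟨y, hy⟩ : ∃ y : Y ⟶ G, p ≫ φ = b ≫ y := Triangle.yoneda_exact₂ _ hT (p ≫ φ) h1
  have hup : u ≫ p = 0 := comp_distTriang_mor_zero₁₂ _ hT'
  have h2 : (DerivedCategory.singleFunctor _ 0).map v ≫ e.inv ≫ y = 0 := by
    rw [← hu]
    simp only [Category.assoc, Iso.hom_inv_id_assoc]
    rw [← hy, ← Category.assoc, hup, zero_comp]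
  have hv := (shortExact_epi v)
  obtain ⟨z, hz⟩ : ∃ z : (sg (kernel v))⟦(1 : ℤ)⟧ ⟶ G, e.inv ≫ y = hv.singleTriangle.mor₃ ≫ z :=
    Triangle.yoneda_exact₃ _ hv.singleTriangle_distinguished (e.inv ≫ y) h2
  have : DerivedCategory.IsLE ((sg (kernel v))⟦(1 : ℤ)⟧) (-1) := t.isLE_shift (sg (kernel v)) 0 1 (-1)
  have hz0 : z = 0 := t.zero _ (-1) 0 (by omega)
  have hy0 : e.inv ≫ y = 0 := by rw [hz, hz0]; exact comp_zero
  have hy1 : y = 0 := by rw [← cancel_epi e.inv, hy0, comp_zero]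
  rw [hy1, comp_zero] at hy
  obtain ⟨ψ, hψ⟩ : ∃ ψ : (sg W)⟦(1 : ℤ)⟧ ⟶ G, φ = q ≫ ψ := Triangle.yoneda_exact₃ _ hT' φ hy
  have : DerivedCategory.IsLE ((sg W)⟦(1 : ℤ)⟧) (-1) := t.isLE_shift (sg W) 0 1 (-1)
  rw [hψ, t.zero ψ (-1) 0 (by omega), comp_zero]

theorem Setup.claim (hS : Setup ι S s) (k : ℕ) (hk : ∀ Z : ModuleCat.{0} R, Es ι Z → JK (R := R) k Z)
    (PF : ObjectProperty (DD R)) [PF.IsTriangulated] [PF.IsClosedUnderIsomorphisms]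
    (hret : ∀ X Y : DD R, Retract X Y → PF Y → PF X)
    (hL : ∀ (Q : ModuleCat.{0} Λ), Projective Q → PF (sg ((L ι).obj Q))) (d : ℕ) :
    ∀ K : DD R, K.IsLE 0 → Van K S → (∀ V : DD R, V.IsLE (-d) → ∀ f : K ⟶ V, f = 0) → PF K := by
  induction d with
  | zero =>
    intro K hK _ h
    exact hret K (sg ((L ι).obj 0)) ⟨0, 0, by
      rw [comp_zero]; exact (h K (by simpa using hK) (𝟙 K)).symm⟩ (hL 0 inferInstance)
  | succ d ih =>
    intro K hK hV h
    obtain ⟨X, Y, hX, hY, a, b, c, hT⟩ := t.exists_triangle K (-1) 0 (by omega)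
    have hX' : X.IsLE (-1) := ⟨hX⟩
    have hY' : Y.IsGE 0 := ⟨hY⟩
    have hX1 : DerivedCategory.IsLE (X⟦(1 : ℤ)⟧) (-2) := t.isLE_shift X (-1) 1 (-2)
    have hY0 : Y.IsLE 0 := t.isLE₂ _ (rot_of_distTriang _ hT) 0 hK
      (t.isLE_of_le (X⟦(1 : ℤ)⟧) (-2) 0 (by omega))
    obtain ⟨N, ⟨e⟩⟩ := DerivedCategory.exists_iso_singleFunctor_obj_of_isGE_of_isLE Y 0
    have hno : ∀ g : N ⟶ S, g = 0 := by
      intro g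
      apply (DerivedCategory.singleFunctor (ModuleCat.{0} R) 0).map_injective
      rw [Functor.map_zero]
      let y : Y ⟶ sg S := e.hom ≫ (DerivedCategory.singleFunctor (ModuleCat.{0} R) 0).map g
      have h1 : b ≫ y = 0 := by
        have := hV 0 ((b ≫ y) ≫ (shiftFunctorZero _ ℤ).inv.app _)
        rw [← cancel_mono ((shiftFunctorZero (DD R) ℤ).inv.app (sg S)), zero_comp]
        exact this
      obtain ⟨z, hz⟩ : ∃ z : X⟦(1 : ℤ)⟧ ⟶ sg S, y = c ≫ z := Triangle.yoneda_exact₃ _ hT y h1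
      rw [← cancel_epi e.hom, comp_zero]
      change y = 0
      rw [hz, hom_zero_of_lt (-2) 0 (by omega) z, comp_zero]
    obtain ⟨Q, hQ, v, hv⟩ := exists_LQ ι N
    have hev : Epi v := hS.epi_of k hk v hv hno
    have hWp := projective_L ι Q
    let w : sg ((L ι).obj Q) ⟶ Y := (DerivedCategory.singleFunctor (ModuleCat.{0} R) 0).map v ≫ e.inv
    obtain ⟨u, hu⟩ : ∃ u : sg ((L ι).obj Q) ⟶ K, w = u ≫ b :=
      Triangle.coyoneda_exact₃ _ hT w (hom_proj_zero _ _ (-2) (by omega) hX1 _)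
    obtain ⟨K', p, q, hT'⟩ := distinguished_cocone_triangle u
    have hK' : K'.IsLE (-1) := isLE_cone hT hX' e v hT' (by
      rw [← Category.assoc, ← hu]; simp [w])
    by_cases hd : d = 0
    · subst hd
      have hp : p = 0 := h K' (by simpa using hK') p
      obtain ⟨g, hg⟩ : ∃ g : K ⟶ sg ((L ι).obj Q), 𝟙 K = g ≫ u :=
        Triangle.coyoneda_exact₂ _ hT' (𝟙 K) ((Category.id_comp p).trans hp)
      exact hret _ _ ⟨g, u, hg.symm⟩ (hL Q hQ)
    · have hVK' : Van K' S := by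
        intro n φ
        obtain ⟨ψ, hψ⟩ : ∃ ψ : (sg ((L ι).obj Q))⟦(1 : ℤ)⟧ ⟶ (sg S)⟦n⟧, φ = q ≫ ψ :=
          Triangle.yoneda_exact₃ _ hT' φ (hV n _)
        rw [hψ, zero_of_shift (hS.L_van Q) 1 n ψ, comp_zero]
      have h1 : PF (K'⟦(-1 : ℤ)⟧) := by
        refine ih _ (t.isLE_shift K' (-1) (-1) 0) (fun n => zero_of_shift hVK' (-1) n) ?_
        intro V hVV
        refine hom_shift_zero (-1) fun φ => ?_
        have hV1 : DerivedCategory.IsLE (V⟦(-(-1) : ℤ)⟧) (-((d + 1 : ℕ) : ℤ)) :=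
          t.isLE_shift V (-d) (-(-1)) _ (by push_cast; ring)
        obtain ⟨ψ, hψ⟩ : ∃ ψ : (sg ((L ι).obj Q))⟦(1 : ℤ)⟧ ⟶ V⟦(-(-1) : ℤ)⟧, φ = q ≫ ψ :=
          Triangle.yoneda_exact₃ _ hT' φ (h _ hV1 _)
        rw [hψ, hom_shift_zero 1 (fun χ => ?_) ψ, comp_zero]
        refine hom_proj_zero _ _ (-d) (by omega) ?_ χ
        exact t.isLE_shift _ (-((d + 1 : ℕ) : ℤ)) (-1) (-d) (by push_cast; ring)
      have h2 : PF K' := by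
        have := prop_shift PF h1 1
        exact PF.prop_of_iso (shiftNegShift K' 1) this
      exact PF.ext_of_isTriangulatedClosed₂ _ hT' (hL Q hQ) h2

end Claim
end
end GlDim

set_option linter.unusedSectionVars false
namespace GlDim
noncomputable section

section Forward

attribute [local instance] hdc
open Pretriangulated Limits ZeroObject DerivedCategory.TStructure

variable {R Λ : Type} [Ring R] [Ring Λ] {ι : Λ →ₙ+* R}

/-- Zero objects. -/
def QZ (R : Type) [Ring R] : ObjectProperty (DD R) := fun X => IsZero X

instance : (QZ R).IsClosedUnderIsomorphisms where
  of_iso e h := IsZero.of_iso h e.symm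

instance : (QZ R).IsTriangulated where
  exists_zero := ⟨0, isZero_zero _, isZero_zero _⟩
  isStableUnderShiftBy a :=
    { le_shift := fun X hX => Functor.map_isZero (shiftFunctor (DD R) a) hX }
  toIsTriangulatedClosed₂ := .mk' fun T hT h1 h3 => Triangle.isZero₂_of_isZero₁₃ T hT h1 h3

/-- The derived corner functor. -/
abbrev FD (ι : Λ →ₙ+* R) : DD R ⥤ DD Λ := (F ι).mapDerivedCategory

/-- It commutes with the embedding of modules. -/
def FDsg (ι : Λ →ₙ+* R) (X : ModuleCat.{0} R) : (FD ι).obj (sg X) ≅ sg ((F ι).obj X) :=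
  ((F ι).mapDerivedCategorySingleFunctor 0).app X

lemma fm_finsupp (ι : Λ →ₙ+* R) (I : Type) (P : ModuleCat.{0} R) :
    Nonempty (Retract ((F ι).obj (ModuleCat.of R (I →₀ P))) (ModuleCat.of Λ (I →₀ (F ι).obj P))) := by
  let i : Fm ι (I →₀ P) →ₗ[Λ] (I →₀ Fm ι P) :=
    { toFun := fun x => Finsupp.mapRange (toFm ι) (Subtype.ext (smul_zero _)) x.1
      map_add' := fun x y => by
        refine Finsupp.ext fun j => Subtype.ext ?_
        exact smul_add (ι 1) (x.1 j) (y.1 j)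
      map_smul' := fun l x => by
        refine Finsupp.ext fun j => Subtype.ext ?_
        change ι 1 • ι l • x.1 j = ι l • ι 1 • x.1 j
        rw [smul_smul, smul_smul, iota_one_mul, iota_mul_one] }
  let r : (I →₀ Fm ι P) →ₗ[Λ] Fm ι (I →₀ P) :=
    { toFun := fun x => ⟨Finsupp.mapRange Subtype.val rfl x, Finsupp.ext fun j => (x j).2⟩
      map_add' := fun x y => Subtype.ext (Finsupp.ext fun j => rfl)
      map_smul' := fun l x => Subtype.ext (Finsupp.ext fun j => rfl) }
  refine ⟨⟨ModuleCat.ofHom i, ModuleCat.ofHom r, ?_⟩⟩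
  refine ModuleCat.hom_ext (LinearMap.ext fun x => Subtype.ext (Finsupp.ext fun j => ?_))
  exact DFunLike.congr_fun (show ι 1 • x.1 = x.1 from x.2) j

variable {S : ModuleCat.{0} R} {s : S}

lemma isIso_of_trW {K E : DD R} (f : K ⟶ E) (hf : ((QZ Λ).inverseImage (FD ι)).trW f) :
    Nonempty ((FD ι).obj K ≅ (FD ι).obj E) := by
  obtain ⟨C, g, h, hT, hC⟩ := hf
  have hd := (FD ι).map_distinguished _ hT
  have : IsIso ((FD ι).map f) := (Triangle.isZero₃_iff_isIso₁ _ hd).1 hC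
  exact ⟨asIso ((FD ι).map f)⟩

lemma Setup.pd_FP (hS : Setup ι S s) (k : ℕ) (hk : ∀ Z : ModuleCat.{0} R, Es ι Z → JK (R := R) k Z)
    (hN : IsNoetherianRing (ExtRing S)ᵐᵒᵖ) (hg : HasFiniteGlobalDimension (ExtRing S)) (n : ℕ)
    (hR : ∀ X : ModuleCat.{0} R, HasProjectiveDimensionLT X n) (P : ModuleCat.{0} R) [Projective P]
    (π : P ⟶ S) (hπ : ∀ g : P ⟶ S, ∃ y : S ⟶ S, g = π ≫ y) :
    ∃ b, HasProjectiveDimensionLT ((F ι).obj P) b := by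
  have hZ : IsZero ((FD ι).obj (sg S)) :=
    IsZero.of_iso (Functor.map_isZero _ ((isZero_F_iff ι S).2 hS.esS)) (FDsg ι S)
  obtain ⟨E, K, ρ, f, hf, ⟨⟨c, hc⟩, ⟨m, hm⟩⟩, hK⟩ := good_of π hπ hN hg ((QZ Λ).inverseImage (FD ι))
    (DerivedCategory.TStructure.t.minus ⊓ PP R) hZ
    ⟨⟨0, inferInstanceAs (DerivedCategory.IsLE (sg S) 0)⟩, PP_of_pd n S (hR S)⟩
    ⟨⟨0, inferInstanceAs (DerivedCategory.IsLE (sg P) 0)⟩, PP_of_pd n P (hR P)⟩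
  let PF : ObjectProperty (DD R) := (PP Λ).inverseImage (FD ι)
  have hret : ∀ X Y : DD R, Retract X Y → PF Y → PF X := fun X Y r h =>
    PP.of_retract (r.map (FD ι)) h
  have hL : ∀ (Q : ModuleCat.{0} Λ), Projective Q → PF (sg ((L ι).obj Q)) := by
    intro Q hQ
    have := isIso_unit_L ι hS.inj hS.surj Q
    refine (PP Λ).prop_of_iso ((DerivedCategory.singleFunctor _ 0).mapIso
      (asIso ((adjL ι).unit.app Q)) ≪≫ (FDsg ι _).symm) (PP_proj Q)
  have h1 : PF (K⟦c⟧) := by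
    refine hS.claim k hk PF hret hL (c - m).toNat _ (t.isLE_shift K c c 0)
      (fun n => zero_of_shift hK c n) ?_
    intro V hV
    refine hom_shift_zero c (fun g => hm _ ?_ g)
    have : DerivedCategory.IsLE (V⟦-c⟧) (-((c - m).toNat : ℤ) + c) :=
      t.isLE_shift V (-((c - m).toNat : ℤ)) (-c) _ (by ring)
    exact t.isLE_of_le _ (-((c - m).toNat : ℤ) + c) m (by omega)
  have h2 : PF K := PF.prop_of_iso (shiftShiftNeg K c) (prop_shift PF h1 (-c))
  obtain ⟨e⟩ := isIso_of_trW f hf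
  have h3 : PF E := (PP Λ).prop_of_iso e h2
  have h4 : PF (sg P) := hret _ _ ρ h3
  exact pd_of_PP _ ((PP Λ).prop_of_iso (FDsg ι P) h4)

lemma Setup.cover (hS : Setup ι S s) (b : ℕ) (hb : 1 ≤ b) (P : ModuleCat.{0} R) (p : P) [Projective P]
    (hP : ∀ (Z : Type) [AddCommGroup Z] [Module R Z] (z : Z), ι 1 • z = 0 → ∃ f : P →ₗ[R] Z, f p = z)
    (hF : HasProjectiveDimensionLT ((F ι).obj P) b) (X : ModuleCat.{0} R) :
    ∃ (G : ModuleCat.{0} R) (g : G ⟶ X), Projective G ∧ Epi g ∧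
      HasProjectiveDimensionLT ((F ι).obj G) b := by
  classical
  let I : Type := {x : X // ι 1 • x = 0}
  let M : ModuleCat.{0} R := ModuleCat.of R (I →₀ P)
  have hM : Projective M := by
    rw [projective_iff_hasProjectiveDimensionLT_one]
    exact pd_finsupp I 1 P (projective_iff_hasProjectiveDimensionLT_one.1 inferInstance)
  have hFM : HasProjectiveDimensionLT ((F ι).obj M) b := by
    obtain ⟨r⟩ := fm_finsupp ι I P
    have := pd_finsupp I b _ hF
    exact r.hasProjectiveDimensionLT b
  choose f hf using fun x : I => hP X x.1 x.2
  let φ : M ⟶ X := ModuleCat.ofHom (Finsupp.lsum ℕ f)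
  obtain ⟨Q, hQ, v, hv⟩ := exists_LQ ι X
  have hLQ := projective_L ι Q
  have hFL : HasProjectiveDimensionLT ((F ι).obj ((L ι).obj Q)) b := by
    have := isIso_unit_L ι hS.inj hS.surj Q
    have h1 : HasProjectiveDimensionLT Q 1 := projective_iff_hasProjectiveDimensionLT_one.1 hQ
    have h2 : HasProjectiveDimensionLT Q b := hasProjectiveDimensionLT_of_ge Q 1 b hb
    let e : Q ≅ (F ι).obj ((L ι).obj Q) := asIso ((adjL ι).unit.app Q)
    exact hasProjectiveDimensionLT_of_iso e b
  refine ⟨M ⊞ (L ι).obj Q, biprod.desc φ v, inferInstance, ?_, ?_⟩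
  · rw [ModuleCat.epi_iff_surjective]
    intro x
    have hid : ι 1 * ι 1 = ι 1 := iota_one_mul ι 1
    obtain ⟨y, hy⟩ := hv (ι 1 • x) (by rw [smul_smul, hid])
    let x' : I := ⟨x - ι 1 • x, by rw [smul_sub, smul_smul, hid, sub_self]⟩
    have h1 : φ.hom (Finsupp.single x' p) = x'.1 := by
      change Finsupp.lsum ℕ f (Finsupp.single x' p) = _
      simp [hf]
    have h2 : ∀ m, (biprod.desc φ v).hom ((biprod.inl : M ⟶ M ⊞ (L ι).obj Q).hom m) = φ.hom m := 
      fun m => LinearMap.congr_fun (congrArg ModuleCat.Hom.hom (biprod.inl_desc φ v)) m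
    have h3 : ∀ m, (biprod.desc φ v).hom ((biprod.inr : (L ι).obj Q ⟶ M ⊞ (L ι).obj Q).hom m) = v.hom m := 
      fun m => LinearMap.congr_fun (congrArg ModuleCat.Hom.hom (biprod.inr_desc φ v)) m
    refine ⟨(biprod.inl : M ⟶ M ⊞ (L ι).obj Q).hom (Finsupp.single x' p) +
      (biprod.inr : (L ι).obj Q ⟶ M ⊞ (L ι).obj Q).hom y, ?_⟩
    change (biprod.desc φ v).hom _ = x
    rw [map_add, h2, h3, h1, hy]
    exact sub_add_cancel _ _
  · exact ((ShortComplex.Splitting.ofHasBinaryBiproduct M ((L ι).obj Q)).shortExact.map_of_exact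
      (F ι)).hasProjectiveDimensionLT_X₂ b hFM hFL

theorem Setup.forward (hS : Setup ι S s) (k : ℕ) (hk : ∀ Z : ModuleCat.{0} R, Es ι Z → JK (R := R) k Z)
    (hN : IsNoetherianRing (ExtRing S)ᵐᵒᵖ) (hg : HasFiniteGlobalDimension (ExtRing S)) (n : ℕ)
    (hR : ∀ X : ModuleCat.{0} R, HasProjectiveDimensionLT X n) :
    ∃ m, ∀ N : ModuleCat.{0} Λ, HasProjectiveDimensionLT N m := by
  obtain ⟨P, p, hP, hp, hZ, π, hπ⟩ := hS.exists_pi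
  obtain ⟨b0, hb0⟩ := hS.pd_FP k hk hN hg n hR P π hπ
  obtain ⟨b, hb1, hb⟩ : ∃ b, 1 ≤ b ∧ HasProjectiveDimensionLT ((F ι).obj P) b :=
    ⟨b0 + 1, by omega, hasProjectiveDimensionLT_of_ge _ b0 _ (by omega)⟩
  have key : ∀ (j : ℕ) (X : ModuleCat.{0} R), HasProjectiveDimensionLT X (j + 1) →
      HasProjectiveDimensionLT ((F ι).obj X) (j + b) := by
    intro j
    induction j with
    | zero =>
      intro X hX
      have hXp : Projective X := projective_iff_hasProjectiveDimensionLT_one.2 hX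
      obtain ⟨G, g, hG, hge, hFG⟩ := hS.cover b hb1 P p hZ hb X
      have r : Retract X G := ⟨Projective.factorThru (𝟙 X) g, g, Projective.factorThru_comp _ _⟩
      rw [zero_add]
      exact (r.map (F ι)).hasProjectiveDimensionLT b
    | succ j ih =>
      intro X hX
      obtain ⟨G, g, hG, hge, hFG⟩ := hS.cover b hb1 P p hZ hb X
      have hT := shortExact_epi g
      have h1 : HasProjectiveDimensionLT G 1 := projective_iff_hasProjectiveDimensionLT_one.1 hG
      have h2 := ih _ (hT.hasProjectiveDimensionLT_X₁ (j + 1)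
        (hasProjectiveDimensionLT_of_ge G 1 _ (by omega)) hX)
      have h4 : HasProjectiveDimensionLT ((F ι).obj G) (j + b + 1) :=
        hasProjectiveDimensionLT_of_ge _ b _ (by omega)
      have h3 := (hT.map_of_exact (F ι)).hasProjectiveDimensionLT_X₃ (j + b) h2 h4
      rw [show j + 1 + b = j + b + 1 by ring]
      exact h3
  refine ⟨n + b, fun N => ?_⟩
  have := isIso_unit_L ι hS.inj hS.surj N
  have h1 := hR ((L ι).obj N)
  have h2 := key n ((L ι).obj N) (hasProjectiveDimensionLT_of_ge _ n (n + 1) (by omega))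
  let e : (F ι).obj ((L ι).obj N) ≅ N := (asIso ((adjL ι).unit.app N)).symm
  exact hasProjectiveDimensionLT_of_iso e (n + b)

end Forward
end
end GlDim

set_option linter.unusedSectionVars false
namespace GlDim
noncomputable section
section Final

section Art
variable {C : Type u} [Category.{v} C] [Abelian C] [HasExt.{w} C] (X : C)

/-- The homogeneous element of the Yoneda ring given by an extension class. -/
def yof (i : ℕ) (a : Ext X X i) : ExtRing X := DirectSum.of (fun i : ℕ => Ext X X i) i a

/-- The homogeneous components, as additive maps. -/
def yco (i : ℕ) : ExtRing X →+ Ext X X i :=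
  DFinsupp.evalAddMonoidHom (β := fun i : ℕ => Ext X X i) i

lemma yco_self (i : ℕ) (a : Ext X X i) : yco X i (yof X i a) = a :=
  DirectSum.of_eq_same (β := fun i : ℕ => Ext X X i) i a

lemma yco_ne (i j : ℕ) (h : i ≠ j) (a : Ext X X i) : yco X j (yof X i a) = 0 :=
  DirectSum.of_eq_of_ne (β := fun i : ℕ => Ext X X i) i j a h.symm

lemma yof_mul (i j : ℕ) (a : Ext X X i) (b : Ext X X j) :
    yof X i a * yof X j b = yof X (i + j) (a.comp b rfl) :=
  letI := ExtYoneda.gring X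
  DirectSum.of_mul_of (A := fun i : ℕ => Ext X X i) a b

/-- The left ideal of elements of degree at least `n`. -/
def yge (n : ℕ) : Submodule (ExtRing X) (ExtRing X) where
  __ := AddSubgroup.closure {x | ∃ i, n ≤ i ∧ ∃ a, x = yof X i a}
  smul_mem' := by
    intro y x hx
    change x ∈ AddSubgroup.closure _ at hx
    change y * x ∈ AddSubgroup.closure _
    induction hx using AddSubgroup.closure_induction with
    | mem x hx =>
      obtain ⟨i, hi, a, rfl⟩ := hx
      induction y using DirectSum.induction_on with
      | zero => 
        have : (0 : ExtRing X) * yof X i a = 0 := zero_mul _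
        exact this ▸ zero_mem _
      | of j b =>
        refine AddSubgroup.subset_closure ⟨j + i, by omega, b.comp a rfl, yof_mul X j i b a⟩
      | add y z hy hz =>
        have key : ∀ y z : ExtRing X, (y + z) * yof X i a = y * yof X i a + z * yof X i a :=
          fun y z => add_mul y z _
        have := key y z
        exact this ▸ add_mem hy hz
    | zero => rw [mul_zero]; exact zero_mem _
    | add x z _ _ hx hz => rw [mul_add]; exact add_mem hx hz
    | neg x _ hx => rw [mul_neg]; exact neg_mem hx

lemma yof_mem (n i : ℕ) (h : n ≤ i) (a : Ext X X i) : yof X i a ∈ yge X n :=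
  AddSubgroup.subset_closure ⟨i, h, a, rfl⟩

lemma yco_yge (n j : ℕ) (h : j < n) (x : ExtRing X) (hx : x ∈ yge X n) : yco X j x = 0 := by
  change x ∈ AddSubgroup.closure _ at hx
  induction hx using AddSubgroup.closure_induction with
  | mem x hx =>
    obtain ⟨i, hi, a, rfl⟩ := hx
    exact yco_ne X i j (by omega) a
  | zero => exact map_zero _
  | add x z _ _ hx hz => rw [map_add, hx, hz, add_zero]
  | neg x _ hx => rw [map_neg, hx, neg_zero]

lemma yge_anti : Antitone (yge X) := by
  intro n m h
  change AddSubgroup.closure _ ≤ AddSubgroup.closure _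
  refine AddSubgroup.closure_mono ?_
  rintro x ⟨i, hi, a, rfl⟩
  exact ⟨i, h.trans hi, a, rfl⟩

lemma ev_of_artinian (h : IsArtinianRing (ExtRing X)) : ∃ n, EV X X n := by
  obtain ⟨n, hn⟩ := IsArtinian.monotone_stabilizes (R := ExtRing X) (M := ExtRing X)
    ⟨fun n => OrderDual.toDual (yge X n), fun a b hab => yge_anti X hab⟩
  refine ⟨n, fun i hi x => ?_⟩
  have h1 : yge X n = yge X (i + 1) := hn (i + 1) (by omega)
  have h2 := yof_mem X n i hi x
  rw [h1] at h2
  rw [← yco_self X i x]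
  exact yco_yge X (i + 1) i (by omega) _ h2
end Art

lemma hfg_iff (R : Type) [Ring R] : (∃ n : ℕ, ∀ (M N : ModuleCat.{0} R) (i : ℕ), n < i →
    Subsingleton (Ext M N i)) ↔ ∃ n, ∀ M : ModuleCat.{0} R, HasProjectiveDimensionLT M n := by
  constructor
  · rintro ⟨n, hn⟩
    refine ⟨n + 1, fun M => ?_⟩
    rw [hasProjectiveDimensionLT_iff.{_, _, 1}]
    intro i hi Y e
    have := hn M Y i (by omega)
    exact Subsingleton.elim _ _
  · rintro ⟨n, hn⟩
    refine ⟨n, fun M N i hi => ⟨fun a b => ?_⟩⟩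
    have := hn M
    rw [hasProjectiveDimensionLT_iff.{_, _, 1}] at this
    rw [this i hi.le a, this i hi.le b]

variable (A : Type) [Ring A] (e : A) (he : IsIdempotentElem e)

/-- The inclusion of the (opposite) corner ring. -/
def iotaC : (CornerRing (1 - e) he.one_sub)ᵐᵒᵖ →ₙ+* Aᵐᵒᵖ where
  toFun x := MulOpposite.op x.unop.1
  map_zero' := rfl
  map_add' _ _ := rfl
  map_mul' _ _ := rfl

lemma iotaC_one : iotaC A e he 1 = MulOpposite.op (1 - e) := rfl

lemma one_sub_iotaC : 1 - iotaC A e he 1 = MulOpposite.op e := by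
  rw [iotaC_one]
  apply MulOpposite.unop_injective
  simp

lemma exists_setup (hsemi : IsSemiperfectRing A) (hbasic : IsBasicRing A) :
    ∃ s : Se A e, Setup (iotaC A e he) (Se A e) s := by
  obtain ⟨s, hgen, hann⟩ := exists_gen_Se e he
  refine ⟨s, ?_, ?_, hgen, ?_, ?_, ?_⟩
  · intro x y h
    exact MulOpposite.unop_injective (Subtype.ext (congrArg MulOpposite.unop h))
  · intro x h1 h2
    rw [iotaC_one] at h1 h2
    exact ⟨MulOpposite.op ⟨x.unop, congrArg MulOpposite.unop h2, congrArg MulOpposite.unop h1⟩, rfl⟩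
  · rw [one_sub_iotaC]
    exact hann
  · intro M _ _ h
    exact isSemisimple_of_J_smul hsemi hbasic M h
  · intro x
    rw [one_sub_iotaC, iotaC_one]
    have := op_mem_J_iff.2 (corner_mem_J hsemi hbasic e he x.unop)
    rw [mul_assoc] at this
    exact this

theorem final (hNoeth : IsTwoSidedNoetherian A)
    (hsemi : IsSemiperfectRing A) (hbasic : IsBasicRing A)
    (hYart : IsTwoSidedArtinian (YonedaRing A e))
    (hYgl : HasFiniteGlobalDimension (YonedaRing A e)) :
    HasFiniteGlobalDimension A ↔
      HasFiniteGlobalDimension (CornerRing (1 - e) he.one_sub) := by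
  obtain ⟨s, hS⟩ := exists_setup A e he hsemi hbasic
  have hA : IsNoetherianRing Aᵐᵒᵖ := hNoeth.2
  have hg : HasFiniteGlobalDimension (ExtRing (Se A e)) := hYgl
  have hart1 : IsArtinianRing (ExtRing (Se A e)) := hYart.1
  have hart2 : IsArtinianRing (ExtRing (Se A e))ᵐᵒᵖ := hYart.2
  have hN : IsNoetherianRing (ExtRing (Se A e))ᵐᵒᵖ := inferInstance
  obtain ⟨k, hk⟩ := hS.bound hN hg
  obtain ⟨N0, hN0⟩ := ev_of_artinian (Se A e) hart1
  constructor
  · intro h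
    obtain ⟨n, hn⟩ := (hfg_iff Aᵐᵒᵖ).1 h
    exact (hfg_iff _).2 (hS.forward k hk hN hg n hn)
  · rintro ⟨d, hd⟩
    exact (hfg_iff _).2 (back hS k hk N0 hN0 d hd)
end Final
end
end GlDim

/-- **Theorem 1.** Let `A` be a Noetherian semiperfect basic ring and `e` an idempotent of `A`.
If the Yoneda ring `Y(e) = Ext_A^*(S_e, S_e)` is (left and right) Artinian and has finite
global dimension, then `A` has finite global dimension if and only if
`Γ = (1-e)A(1-e)` has finite global dimension. -/
theorem hasFiniteGlobalDimension_iff_corner_of_yonedaRing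
    (A : Type) [Ring A] (hNoeth : IsTwoSidedNoetherian A)
    (hsemi : IsSemiperfectRing A) (hbasic : IsBasicRing A)
    (e : A) (he : IsIdempotentElem e)
    (hYart : IsTwoSidedArtinian (YonedaRing A e))
    (hYgl : HasFiniteGlobalDimension (YonedaRing A e)) :
    HasFiniteGlobalDimension A ↔
      HasFiniteGlobalDimension (CornerRing (1 - e) he.one_sub) := by
  exact GlDim.final A e he hNoeth hsemi hbasic hYart hYgl
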